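/- Theorem 1.1 (critical one-arm exponent): For every x ∈ G the limit −lim_{R→∞} log ℙ(x ↔ B(x,R)^c in E^{≥0}) / log R exists and equals ν/2; i.e. the critical one-arm exponent 1/ρ equals ν/2. -/

import Mathlib

open MeasureTheory ProbabilityTheory Real Filter Topology
open scoped ENNReal NNReal BigOperators Classical

noncomputable section

/-! ## Generic exponents and corrections -/

/-- The exponent `b₁`: equal to `1` if `ν = 1` and `0` otherwise. -/
def bOne (ν : ℝ) : ℝ := if ν = 1 then 1 else 0

/-- The exponent `b₂`: equal to `1` if `α = 2ν` and `0` otherwise. -/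
def bTwo (ν α : ℝ) : ℝ := if α = 2 * ν then 1 else 0

/-- The polylogarithmic correction `q(r)` from Theorem 1.1. -/
def qArm (ν α r : ℝ) : ℝ :=
  if ν = 1 then Real.log (Real.log r)
  else if ν < α / 2 then Real.log r ^ ((ν - 1) / 2) * Real.log (Real.log r) ^ ν
  else Real.log r ^ ν * Real.log (Real.log r) ^ ν

/-- `exp(-t)` for an extended nonnegative real `t`. -/
def expNegE (t : ℝ≥0∞) : ℝ≥0∞ := if t = ⊤ then 0 else ENNReal.ofReal (Real.exp (-t.toReal))

/-! ## Transient weighted graphs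

A weighted graph `𝒢 = (G, λ)`, connected and locally finite, with controlled weights,
equipped with a metric `d`, a distinguished base point `o`, and exponents `α` (volume
growth) and `ν` (Green's function decay). -/

structure WGraph where
  (V : Type) (countableV : Countable V) (o : V)
  (lam : V → V → ℝ)
  (lam_nonneg : ∀ x y, 0 ≤ lam x y)
  (lam_symm : ∀ x y, lam x y = lam y x)
  (locFin : ∀ x, (Function.support (lam x)).Finite)
  (connectedG : ∀ x y, Relation.ReflTransGen (fun u v => 0 < lam u v) x y)
  -- controlled weights: `λ_{x,y}/λ_x ≥ c₀` for all neighbours `x ∼ y`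
  (ctrl : ∃ c₀ > (0:ℝ), ∀ x y, 0 < lam x y → c₀ * (∑ᶠ z, lam x z) ≤ lam x y)
  (d : V → V → ℝ)
  (d_symm : ∀ x y, d x y = d y x)
  (d_self : ∀ x, d x x = 0)
  (d_pos : ∀ x y, x ≠ y → 0 < d x y)
  (d_triangle : ∀ x y z, d x z ≤ d x y + d y z)
  (α : ℝ) (ν : ℝ)

namespace WGraph

variable (M : WGraph)

/-- Total weight `λ_x = Σ_{y} λ_{x,y}` at a vertex. -/
def lamTot (x : M.V) : ℝ := ∑ᶠ y, M.lam x y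

/-- The (closed) ball `B(x,r)` for the metric `d`. -/
def ball (x : M.V) (r : ℝ) : Set M.V := {y | M.d x y ≤ r}

/-- One-step transition probability of the random walk on `(G,λ)`. -/
def p (x y : M.V) : ℝ := M.lam x y / M.lamTot x

/-- `n`-step transition probability of the random walk. -/
def pstep : ℕ → M.V → M.V → ℝ
  | 0, x, y => if x = y then 1 else 0
  | n + 1, x, y => ∑ᶠ z, M.p x z * pstep n z y

/-- The Green's function `g(x,y) = λ_y^{-1} Σ_{n ≥ 0} P_x[Z_n = y]` of the walk. -/
def green (x y : M.V) : ℝ := (∑' n, M.pstep n x y) / M.lamTot y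

/-- Transience of the random walk on `𝒢`. -/
def Transient : Prop := ∀ x, Summable fun n => M.pstep n x x

/-- The volume growth condition `(V_α)`. -/
def VolGrowth : Prop :=
  ∃ c > (0:ℝ), ∃ C > (0:ℝ), ∀ (x : M.V) (r : ℝ), 1 ≤ r →
    c * r ^ M.α ≤ (∑ᶠ y ∈ M.ball x r, M.lamTot y) ∧
      (∑ᶠ y ∈ M.ball x r, M.lamTot y) ≤ C * r ^ M.α

/-- The Green's function decay condition `(G_ν)`. -/
def GreenDecay : Prop :=
  ∃ c > (0:ℝ), ∃ C > (0:ℝ),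
    (∀ x : M.V, c ≤ M.green x x ∧ M.green x x ≤ C) ∧
    ∀ x y : M.V, x ≠ y →
      c * M.d x y ^ (-M.ν) ≤ M.green x y ∧ M.green x y ≤ C * M.d x y ^ (-M.ν)

/-- The standing assumptions on the graph: transience, `(V_α)` and `(G_ν)`. -/
def Standing : Prop := M.Transient ∧ M.VolGrowth ∧ M.GreenDecay

/-- The graph distance `d_gr` on `𝒢`. -/
def graphDist (x y : M.V) : ℝ :=
  sInf {r : ℝ | ∃ n : ℕ, r = n ∧ ∃ γ : Fin (n + 1) → M.V, γ 0 = x ∧ γ (Fin.last n) = y ∧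
    ∀ i : Fin n, 0 < M.lam (γ i.castSucc) (γ i.succ)}

/-- Capacity of a finite set of vertices, via the variational characterization
`cap(K) = (inf_μ Σ_{x,y} μ(x) g(x,y) μ(y))⁻¹`, the infimum being over probability
measures supported on `K`. -/
def capFinset (K : Finset M.V) : ℝ :=
  (sInf {E : ℝ | ∃ μ : M.V → ℝ, (∀ x, 0 ≤ μ x) ∧ (∀ x, x ∉ K → μ x = 0) ∧
    (∑ x ∈ K, μ x) = 1 ∧ E = ∑ x ∈ K, ∑ y ∈ K, μ x * M.green x y * μ y})⁻¹

/-- Capacity of an arbitrary set of vertices. -/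
def cap (S : Set M.V) : ℝ := ⨆ K : {K : Finset M.V // ↑K ⊆ S}, M.capFinset K.1

/-- Weight `∏_{i<n} p(x_i, x_{i+1})` of a finite random walk trajectory. -/
def pathWt {n : ℕ} (γ : Fin (n + 1) → M.V) : ℝ := ∏ i : Fin n, M.p (γ i.castSucc) (γ i.succ)

/-- `P_z[H_x < H_O]`: the probability that the random walk started at `z` hits `x`
strictly before hitting the set `O`, expressed through a first-passage path decomposition. -/
def hitBefore (z x : M.V) (O : Set M.V) : ℝ :=
  ∑' n : ℕ, ∑' γ : Fin (n + 1) → M.V,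
    if γ 0 = z ∧ γ (Fin.last n) = x ∧ x ∉ O ∧
        (∀ i : Fin (n + 1), i ≠ Fin.last n → γ i ∉ O ∧ γ i ≠ x)
      then M.pathWt γ else 0

/-- Distance from a point to a set. -/
def dSet (x : M.V) (S : Set M.V) : ℝ := sInf (M.d x '' S)

/-! ### Discrete (rooted) loops

A rooted discrete loop visiting `m + 2` vertices (`m ≥ 0`), i.e. making at least two
jumps, encoded by its skeleton `Z_0, …, Z_{n-1}` (with `Z_n = Z_0`, indices mod `n`). -/

/-- The type of rooted discrete loops on `G` making `n = m + 2 ≥ 2` jumps. -/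
abbrev DLoop : Type := Σ m : ℕ, Fin (m + 2) → M.V

/-- The mass `(1/n) ∏_{0 ≤ i < n} λ_{x_i,x_{i+1}}/λ_{x_i}` that the loop measure `μ`
assigns to a given rooted discrete loop (its discrete skeleton intensity). -/
def dloopWt (γ : M.DLoop) : ℝ≥0∞ :=
  ENNReal.ofReal ((1 / ((γ.1 : ℝ) + 2)) * ∏ i : Fin (γ.1 + 2), M.p (γ.2 i) (γ.2 (i + 1)))

/-- The set of vertices visited by a discrete loop (`range(γ) ∩ G` for the
corresponding continuous loop). -/
def dloopRange (γ : M.DLoop) : Set M.V := Set.range γ.2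

/-- The loop measure `μ` evaluated on a set of (skeletons of) loops: since the events of
interest only depend on the vertices visited by a loop, the measure under `μ` of such an
event coincides with the total mass of the corresponding discrete skeletons. -/
def loopMeas (S : Set M.DLoop) : ℝ≥0∞ := ∑' γ : S, M.dloopWt γ

end WGraph

/-! ## Graphs equipped with an approximate renormalized lattice `Λ(L)` -/

structure LGraph extends WGraph where
  (Lat : ℝ → Set V)
  (Lat_base : ∀ L : ℝ, 1 ≤ L → o ∈ Lat L)
  (Lat_cover : ∀ L : ℝ, 1 ≤ L → ∀ x, ∃ y ∈ Lat L, d y x ≤ L)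
  (Lat_disj : ∀ L : ℝ, 1 ≤ L → ∀ y ∈ Lat L, ∀ z ∈ Lat L, y ≠ z →
    ∀ w, d y w ≤ L / 2 → ¬ d z w ≤ L / 2)
  (Lat_card : ∃ CΛ > (0:ℝ), ∀ L : ℝ, 1 ≤ L → ∀ (x : V) (N : ℕ), 1 ≤ N →
    {y | y ∈ Lat L ∧ d x y ≤ L * N}.Finite ∧
      ({y | y ∈ Lat L ∧ d x y ≤ L * N}.ncard : ℝ) ≤ CΛ * (N : ℝ) ^ α)

namespace LGraph

variable (M : LGraph)

/-- A path `π = (x_i)_{1 ≤ i ≤ M}` in `Λ(L)` from the base point `0` to `A ⊆ G`. -/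
def IsLatPath (L : ℝ) (A : Set M.V) {m : ℕ} (pa : Fin (m + 1) → M.V) : Prop :=
  pa 0 = M.o ∧ pa (Fin.last m) ∈ A ∧ (∀ i, pa i ∈ M.Lat L) ∧
    ∀ i : Fin m, ∃ x y, M.d (pa i.castSucc) x ≤ L ∧ M.d (pa i.succ) y ≤ L ∧ 0 < M.lam x y

/-- `𝒪 ⊆ G` is an `(L,R,n,κ)`-good obstacle: every path in `Λ(L)` from `0` to `B_R^c`
contains at least `n` points `y` (within `B_R`) with `cap(𝒪 ∩ B(y,L)) ≥ κ`. -/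
def GoodObstacle (O : Set M.V) (L R : ℝ) (n : ℝ) (κ : ℝ) : Prop :=
  ∀ (m : ℕ) (pa : Fin (m + 1) → M.V), M.IsLatPath L {y | R < M.d M.o y} pa →
    ∃ A : Finset M.V, (∀ y ∈ A, (∃ i, pa i = y) ∧ M.d M.o y ≤ R) ∧ n ≤ (A.card : ℝ) ∧
      ∀ y ∈ A, κ ≤ M.toWGraph.cap (O ∩ {z | M.d y z ≤ L})

/-- The layer `𝒜_k ⊆ Λ(L)` of lattice points whose `L`-ball meets the interior
boundary `∂B(0, C₁ k L)`. -/
def layer (C₁ L : ℝ) (k : ℕ) : Set M.V :=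
  {x | x ∈ M.Lat L ∧ ∃ y, M.d x y ≤ L ∧ M.d M.o y ≤ C₁ * k * L ∧
    ∃ z, 0 < M.lam y z ∧ C₁ * k * L < M.d M.o z}

/-- The annulus `𝔸_k = ∪_{x ∈ 𝒜_k} B(x,L)`. -/
def annulus (C₁ L : ℝ) (k : ℕ) : Set M.V := {v | ∃ x ∈ M.layer C₁ L k, M.d x v ≤ L}

end LGraph

/-! ## The Gaussian free field and its associated bond percolation `E^{≥a}` -/

/-- A transient weighted graph together with a Gaussian free field `φ` (law `ℙ`) and,
conditionally on `φ`, independent bond percolation configurations: each edge `{x,y}` is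
retained in `E^{≥a}` (i.e. `opn a`) independently with probability
`1 - exp(-2 λ_{x,y} (φ_x - a)_+ (φ_y - a)_+)`. -/
structure Model extends WGraph where
  (Ω : Type) [mΩ : MeasurableSpace Ω] (P : Measure Ω) (Pprob : IsProbabilityMeasure P)
  (φ : Ω → V → ℝ)
  (φ_meas : ∀ x, Measurable fun ω => φ ω x)
  -- `φ` is the centered Gaussian field with covariance the Green's function `g`
  (φ_gauss : ∀ (s : Finset V) (c : V → ℝ),
    Measure.map (fun ω => ∑ x ∈ s, c x * φ ω x) P =
      gaussianReal 0 (Real.toNNReal (∑ x ∈ s, ∑ y ∈ s, c x * c y * toWGraph.green x y)))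
  (opn : ℝ → Ω → V → V → Prop)
  (opn_symm : ∀ a ω x y, opn a ω x y → opn a ω y x)
  (opn_edge : ∀ a ω x y, opn a ω x y → 0 < lam x y)
  (opn_meas : ∀ a x y, MeasurableSet {ω | opn a ω x y})
  -- conditionally on `φ`, edges are open independently with the prescribed probabilities
  (opn_law : ∀ (a : ℝ) (s t : Finset (V × V)), Disjoint s t →
    (∀ e ∈ s ∪ t, ∀ f ∈ s ∪ t, e ≠ f → e ≠ Prod.swap f) →
    ∀ B : Set (V → ℝ), MeasurableSet B →
      P ({ω | φ ω ∈ B} ∩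
          {ω | (∀ e ∈ s, opn a ω e.1 e.2) ∧ (∀ e ∈ t, ¬ opn a ω e.1 e.2)}) =
      ∫⁻ ω in {ω | φ ω ∈ B},
        ENNReal.ofReal
          ((∏ e ∈ s,
            (1 - Real.exp (-(2 * lam e.1 e.2 * max (φ ω e.1 - a) 0 * max (φ ω e.2 - a) 0)))) *
           ∏ e ∈ t,
            Real.exp (-(2 * lam e.1 e.2 * max (φ ω e.1 - a) 0 * max (φ ω e.2 - a) 0))) ∂P)

attribute [instance] Model.mΩ

namespace Model

variable (M : Model)

/-- `x` and `y` are connected by a path of open edges of `E^{≥a}`. -/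
def conn (a : ℝ) (ω : M.Ω) (x y : M.V) : Prop :=
  Relation.ReflTransGen (fun u v => M.opn a ω u v) x y

/-- The open cluster `𝒦^a` of `x` in `E^{≥a}`. -/
def cluster (a : ℝ) (ω : M.Ω) (x : M.V) : Set M.V := {y | M.conn a ω x y}

/-- The probability of an event. -/
def prob (s : Set M.Ω) : ℝ := (M.P s).toReal

/-- The one-arm event `{x ↔ B(x,R)^c}` in `E^{≥0}`. -/
def armEvent (x : M.V) (R : ℝ) : Set M.Ω := {ω | ∃ y, R < M.d x y ∧ M.conn 0 ω x y}

/-- The truncated two-point function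
`τ_a^tr(x,y) = ℙ(x ↔ y in E^{≥a}, x ↮ ∞ in E^{≥a})`. -/
def tau (a : ℝ) (x y : M.V) : ℝ :=
  M.prob {ω | M.conn a ω x y ∧ (M.cluster a ω x).Finite}

/-- The truncated expected cluster volume `𝔼[|𝒦^a| 1_{|𝒦^a| < ∞}]`. -/
def clusterVol (a : ℝ) (x : M.V) : ℝ≥0∞ :=
  ∫⁻ ω, (if (M.cluster a ω x).Finite then ((M.cluster a ω x).ncard : ℝ≥0∞) else 0) ∂M.P

end Model

/-! ## The concrete case `G = ℤ³` with unit weights and the Euclidean distance -/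

/-- The vertex set `ℤ³`. -/
abbrev Z3 : Type := Fin 3 → ℤ

/-- Euclidean distance on `ℤ³`. -/
def dZ (x y : Z3) : ℝ := Real.sqrt (∑ i, ((x i : ℝ) - (y i : ℝ)) ^ 2)

/-- Unit weights: `λ_{x,y} = 1_{|x-y| = 1}`. -/
def lamZ (x y : Z3) : ℝ := if dZ x y = 1 then 1 else 0

/-- Transition probabilities of simple random walk on `ℤ³`. -/
def pZ (x y : Z3) : ℝ := lamZ x y / 6

/-- `n`-step transition probabilities of simple random walk on `ℤ³`. -/
def pstepZ : ℕ → Z3 → Z3 → ℝ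
  | 0, x, y => if x = y then 1 else 0
  | n + 1, x, y => ∑ᶠ z, pZ x z * pstepZ n z y

/-- The Green's function of simple random walk on `ℤ³` (with the normalization
`g(x,y) = λ_y^{-1} Σ_n P_x[Z_n = y]`, `λ_y = 6`). -/
def greenZ (x y : Z3) : ℝ := (∑' n, pstepZ n x y) / 6

/-- Euclidean distance between a point of `ℝ³` and a point of `ℤ³`. -/
def dMix (u : Fin 3 → ℝ) (z : Z3) : ℝ := Real.sqrt (∑ i, (u i - (z i : ℝ)) ^ 2)

/-- The Gaussian free field on `ℤ³` together with the associated bond percolation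
configurations `E^{≥a}`. -/
structure PercZ3 where
  (Ω : Type) [mΩ : MeasurableSpace Ω] (P : Measure Ω) (Pprob : IsProbabilityMeasure P)
  (φ : Ω → Z3 → ℝ)
  (φ_meas : ∀ x, Measurable fun ω => φ ω x)
  (φ_gauss : ∀ (s : Finset Z3) (c : Z3 → ℝ),
    Measure.map (fun ω => ∑ x ∈ s, c x * φ ω x) P =
      gaussianReal 0 (Real.toNNReal (∑ x ∈ s, ∑ y ∈ s, c x * c y * greenZ x y)))
  (opn : ℝ → Ω → Z3 → Z3 → Prop)
  (opn_symm : ∀ a ω x y, opn a ω x y → opn a ω y x)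
  (opn_edge : ∀ a ω x y, opn a ω x y → 0 < lamZ x y)
  (opn_meas : ∀ a x y, MeasurableSet {ω | opn a ω x y})
  (opn_law : ∀ (a : ℝ) (s t : Finset (Z3 × Z3)), Disjoint s t →
    (∀ e ∈ s ∪ t, ∀ f ∈ s ∪ t, e ≠ f → e ≠ Prod.swap f) →
    ∀ B : Set (Z3 → ℝ), MeasurableSet B →
      P ({ω | φ ω ∈ B} ∩
          {ω | (∀ e ∈ s, opn a ω e.1 e.2) ∧ (∀ e ∈ t, ¬ opn a ω e.1 e.2)}) =
      ∫⁻ ω in {ω | φ ω ∈ B},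
        ENNReal.ofReal
          ((∏ e ∈ s,
            (1 - Real.exp (-(2 * lamZ e.1 e.2 * max (φ ω e.1 - a) 0 * max (φ ω e.2 - a) 0)))) *
           ∏ e ∈ t,
            Real.exp (-(2 * lamZ e.1 e.2 * max (φ ω e.1 - a) 0 * max (φ ω e.2 - a) 0))) ∂P)

attribute [instance] PercZ3.mΩ

namespace PercZ3

variable (M : PercZ3)

/-- Connectivity by open edges in `E^{≥a}`. -/
def conn (a : ℝ) (ω : M.Ω) (x y : Z3) : Prop :=
  Relation.ReflTransGen (fun u v => M.opn a ω u v) x y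

/-- The open cluster of `x` in `E^{≥a}`. -/
def cluster (a : ℝ) (ω : M.Ω) (x : Z3) : Set Z3 := {y | M.conn a ω x y}

/-- The truncated two-point function on `ℤ³`. -/
def tau (a : ℝ) (x y : Z3) : ℝ :=
  ((M.P {ω | M.conn a ω x y ∧ (M.cluster a ω x).Finite}).toReal)

end PercZ3

/-! ## The metric graph (cable system) `𝔾̃`, killed Green's functions and killed GFFs -/

/-- The cable system `𝔾̃` over a graph `𝒢` (with renormalized lattice), together with the
killed Green's functions `g_U` and the laws `ℙ_U` of the Gaussian free field on open sets
`U ⊆ 𝔾̃` (the field killed outside `U`). -/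
structure CableG extends LGraph where
  (Gt : Type) [topGt : TopologicalSpace Gt] [msGt : MeasurableSpace Gt]
  (ι : V → Gt) (ι_inj : Function.Injective ι)
  (gU : Set Gt → Gt → Gt → ℝ)
  (gU_symm : ∀ U x y, gU U x y = gU U y x)
  (gU_zero : ∀ U x y, x ∉ U → gU U x y = 0)
  -- the Green's function of the full cable system restricts to `g` on `G`
  (gU_univ : ∀ x y : V, gU Set.univ (ι x) (ι y) = toWGraph.green x y)
  (PU : Set Gt → Measure (Gt → ℝ))
  (PU_prob : ∀ U, IsProbabilityMeasure (PU U))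
  -- `ℙ_U` is the law of the centered Gaussian field with covariance `g_U`
  (PU_gauss : ∀ (U : Set Gt) (s : Finset Gt) (c : Gt → ℝ),
    Measure.map (fun h => ∑ q ∈ s, c q * h q) (PU U) =
      gaussianReal 0 (Real.toNNReal (∑ q ∈ s, ∑ q' ∈ s, c q * c q' * gU U q q')))

attribute [instance] CableG.topGt CableG.msGt

/-- A probability space. -/
structure ProbSpace where
  (Ω : Type) [mΩ : MeasurableSpace Ω] (P : Measure Ω) (Pprob : IsProbabilityMeasure P)

attribute [instance] ProbSpace.mΩ

/-- A cable system as above, together with the laws of the vacant sets `Ṽ^u` of random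
interlacements at level `u > 0` on `𝔾̃`, axiomatized through their characterizing
properties: `Ṽ^u` is open and `ℙ(F ⊆ Ṽ^u) = exp(-u cap(F))` for finite `F ⊆ G`. -/
structure CableRI extends CableG where
  [msSetGt : MeasurableSpace (Set Gt)]
  (RIVacant : ℝ → Measure (Set Gt))
  (RIVacant_prob : ∀ u : ℝ, 0 < u → IsProbabilityMeasure (RIVacant u))
  (RIVacant_open : ∀ u : ℝ, 0 < u → ∀ᵐ S ∂(RIVacant u), @IsOpen Gt topGt S)
  (RIVacant_cap : ∀ u : ℝ, 0 < u → ∀ F : Finset V,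
    (RIVacant u {S | ∀ x ∈ F, ι x ∈ S}).toReal =
      Real.exp (-(u * toWGraph.capFinset F)))

attribute [instance] CableRI.msSetGt

/-! ## The Markovian loop soup at intensity `1/2` on the cable system -/

/-- The Poisson loop soup `ℒ` of intensity `(1/2)μ` on the cable system `𝔾̃` of a graph
`𝒢` (with renormalized lattice), under the law `Q`.  Continuous loops are axiomatized
through their ranges in `𝔾̃` and their discrete skeletons; the intensity measure `μ` is
pinned down via its (concrete) discrete skeleton intensity, and the law of the soup via
its void probabilities `Q(ℒ ∩ S = ∅) = exp(-μ(S)/2)`. -/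
structure LoopSoup extends LGraph where
  -- the cable system
  (Gt : Type) [topGt : TopologicalSpace Gt]
  (ι : V → Gt) (ι_inj : Function.Injective ι)
  (cable : V → V → Set Gt)
  (cable_symm : ∀ x y, cable x y = cable y x)
  (cable_ends : ∀ x y, 0 < lam x y → ι x ∈ cable x y ∧ ι y ∈ cable x y)
  (cable_vertices : ∀ x y, 0 < lam x y → ∀ v : V, ι v ∈ cable x y → v = x ∨ v = y)
  (cable_cover : ∀ q : Gt, (∃ v, q = ι v) ∨ ∃ x y, 0 < lam x y ∧ q ∈ cable x y)
  -- continuous loops on the cable system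
  (CLoop : Type) [msLoop : MeasurableSpace CLoop]
  (crange : CLoop → Set Gt)
  (traceG : CLoop → Set V)
  (trace_spec : ∀ γ, traceG γ = {v | ι v ∈ crange γ})
  -- the loop measure `μ` and its discrete skeleton
  (μC : Measure CLoop)
  (skel : CLoop → Option (Σ m : ℕ, Fin (m + 2) → V))
  (skel_spec : ∀ γ dγ, skel γ = some dγ → traceG γ = Set.range dγ.2)
  (skel_trivial : ∀ γ, skel γ = none → (traceG γ).Subsingleton)
  (μC_skel : ∀ S : Set (Σ m : ℕ, Fin (m + 2) → V),
    μC {γ | ∃ dγ ∈ S, skel γ = some dγ} = toWGraph.loopMeas S)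
  -- the loop soup and its law
  (Ωq : Type) [mΩq : MeasurableSpace Ωq] (Q : Measure Ωq) (Qprob : IsProbabilityMeasure Q)
  (soup : Ωq → Set CLoop)
  (soup_void : ∀ S : Set CLoop, MeasurableSet S →
    Q {ω | ∀ γ ∈ soup ω, γ ∉ S} = expNegE (μC S / 2))

attribute [instance] LoopSoup.topGt LoopSoup.msLoop LoopSoup.mΩq

namespace LoopSoup

variable (M : LoopSoup)

/-- Two loops of the soup are linked if they can be joined by a finite chain of loops of
the soup whose ranges successively intersect. -/
def linked (ω : M.Ωq) (γ γ' : M.CLoop) : Prop :=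
  Relation.ReflTransGen
    (fun g g' => g ∈ M.soup ω ∧ g' ∈ M.soup ω ∧ (M.crange g ∩ M.crange g').Nonempty) γ γ'

/-- The trace `𝒞` on `𝔾̃` of the cluster of loops of `ℒ` containing the base point `0`. -/
def C0 (ω : M.Ωq) : Set M.Gt :=
  {q | ∃ γ ∈ M.soup ω, q ∈ M.crange γ ∧
    ∃ γ₀ ∈ M.soup ω, M.ι M.o ∈ M.crange γ₀ ∧ M.linked ω γ γ₀}

/-- A loop is big (for the parameters `δ, L`) if `cap(range(γ) ∩ G) ≥ δ L^ν (log L)^{-b₂}`. -/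
def isBig (δ L : ℝ) (γ : M.CLoop) : Prop :=
  δ * L ^ M.ν * Real.log L ^ (-(bTwo M.ν M.α)) ≤ M.toWGraph.cap (M.traceG γ)

/-- The box `B̃(x,L) ⊆ 𝔾̃`: the ball `B(x,L)` together with all cables joining
neighbouring vertices of `B(x,L)`. -/
def Btilde (x : M.V) (L : ℝ) : Set M.Gt :=
  (M.ι '' {y | M.d x y ≤ L}) ∪
    ⋃ (u : M.V) (v : M.V) (_ : 0 < M.lam u v ∧ M.d x u ≤ L ∧ M.d x v ≤ L), M.cable u v

/-- A loop belongs to (the support of) `ℒ_k^b`: it is big and its range is contained in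
`B̃(x,L)` for some `x ∈ 𝒜_k`. -/
def inLayerBig (C₁ δ L : ℝ) (k : ℕ) (γ : M.CLoop) : Prop :=
  M.isBig δ L γ ∧ ∃ x ∈ M.toLGraph.layer C₁ L k, M.crange γ ⊆ M.Btilde x L

/-- The event `𝐁_k`: the cluster `𝒞` of `0` reaches `B_R^c` but contains no big loop of
`ℒ_k^b`. -/
def Bk (C₁ δ L R : ℝ) (k : ℕ) : Set M.Ωq :=
  {ω | (∃ y : M.V, R < M.d M.o y ∧ M.ι y ∈ M.C0 ω) ∧
    ∀ γ ∈ M.soup ω, M.inLayerBig C₁ δ L k γ → ¬ M.crange γ ⊆ M.C0 ω}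

/-- The number `N` of bad annuli among `k ∈ {1, …, ℓ}`. -/
def Nbad (C₁ δ L R : ℝ) (ℓ : ℕ) (ω : M.Ωq) : ℕ :=
  ((Finset.Icc 1 ℓ).filter fun k => ω ∈ M.Bk C₁ δ L R k).card

/-- The obstacle set `𝒪 = G ∩ 𝐼̃_D^b`: all vertices visited by a big loop of the soup
contained in a box `B̃(x,L)` with `x ∈ 𝒜_k` for some `k ∈ D`. -/
def obstacleD (C₁ δ L : ℝ) (D : Finset ℕ) (ω : M.Ωq) : Set M.V :=
  {v | ∃ γ ∈ M.soup ω, (∃ k ∈ D, M.inLayerBig C₁ δ L k γ) ∧ M.ι v ∈ M.crange γ}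

end LoopSoup

namespace WGraph

variable (M : WGraph)

/-- The finite set of neighbours of a vertex. -/
def nbr (x : M.V) : Finset M.V := (M.locFin x).toFinset

lemma mem_nbr {x y : M.V} : y ∈ M.nbr x ↔ M.lam x y ≠ 0 := by simp [nbr]

lemma lam_eq_zero {x y : M.V} (h : y ∉ M.nbr x) : M.lam x y = 0 := by
  simpa [mem_nbr] using h

lemma lamTot_eq_sum (x : M.V) : M.lamTot x = ∑ y ∈ M.nbr x, M.lam x y :=
  finsum_eq_sum_of_support_subset _ (by simp [nbr])

lemma lamTot_nonneg (x : M.V) : 0 ≤ M.lamTot x := by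
  rw [lamTot_eq_sum]; exact Finset.sum_nonneg fun y _ => M.lam_nonneg x y

lemma p_nonneg (x y : M.V) : 0 ≤ M.p x y := div_nonneg (M.lam_nonneg x y) (M.lamTot_nonneg x)

lemma finsum_p_mul (x : M.V) (f : M.V → ℝ) :
    ∑ᶠ z, M.p x z * f z = ∑ z ∈ M.nbr x, M.p x z * f z := by
  refine finsum_eq_sum_of_support_subset _ fun z hz => ?_
  simp only [Function.mem_support] at hz
  rw [Finset.mem_coe, mem_nbr]
  intro h
  exact hz (by simp [p, h])

lemma pstep_succ (n : ℕ) (x y : M.V) :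
    M.pstep (n + 1) x y = ∑ z ∈ M.nbr x, M.p x z * M.pstep n z y := by
  rw [pstep, finsum_p_mul]

lemma pstep_succ' (n : ℕ) (x y : M.V) :
    M.pstep (n + 1) x y = ∑ z ∈ M.nbr y, M.pstep n x z * M.p z y := by
  induction n generalizing x with
  | zero =>
    rw [pstep_succ]
    simp only [pstep, mul_ite, mul_one, mul_zero, ite_mul, one_mul, zero_mul]
    rw [Finset.sum_ite_eq' (M.nbr x) y, Finset.sum_ite_eq (M.nbr y) x]
    by_cases h : M.lam x y = 0
    · simp [p, h]
    · rw [if_pos (M.mem_nbr.2 h), if_pos (M.mem_nbr.2 (by rwa [M.lam_symm]))]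
  | succ n ih =>
    rw [pstep_succ]
    simp_rw [ih, Finset.mul_sum]
    rw [Finset.sum_comm]
    refine Finset.sum_congr rfl fun z _ => ?_
    rw [pstep_succ, Finset.sum_mul]
    exact Finset.sum_congr rfl fun w _ => by ring

variable {M}

lemma p_mul (hpos : ∀ x, 0 < M.lamTot x) (x y : M.V) : M.lamTot x * M.p x y = M.lam x y := by
  rw [p, mul_div_cancel₀ _ (hpos x).ne']

lemma sum_p (hpos : ∀ x, 0 < M.lamTot x) (x : M.V) : ∑ z ∈ M.nbr x, M.p x z = 1 := by
  simp only [p]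
  rw [← Finset.sum_div, ← lamTot_eq_sum, div_self (hpos x).ne']

lemma pstep_symm (hpos : ∀ x, 0 < M.lamTot x) (n : ℕ) (x y : M.V) :
    M.lamTot x * M.pstep n x y = M.lamTot y * M.pstep n y x := by
  induction n generalizing x y with
  | zero =>
    rw [pstep, pstep]
    by_cases h : x = y
    · subst h; rfl
    · rw [if_neg h, if_neg (Ne.symm h)]; simp
  | succ n ih =>
    rw [pstep_succ, pstep_succ' M n y x, Finset.mul_sum, Finset.mul_sum]
    refine Finset.sum_congr rfl fun z _ => ?_
    rw [← mul_assoc, p_mul hpos, M.lam_symm, ← p_mul hpos, mul_right_comm, ih]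
    ring

lemma Standing.lamTot_pos (hS : M.Standing) (x : M.V) : 0 < M.lamTot x := by
  obtain ⟨-, -, c, hc, C, hC, h1, -⟩ := hS
  refine lt_of_le_of_ne (M.lamTot_nonneg x) fun h => ?_
  have := (h1 x).1
  rw [green, ← h, div_zero] at this
  linarith

lemma Standing.green_pos (hS : M.Standing) (x y : M.V) : 0 < M.green x y := by
  obtain ⟨-, -, c, hc, C, hC, h1, h2⟩ := hS
  by_cases h : x = y
  · subst h; exact hc.trans_le (h1 x).1
  · exact (mul_pos hc (rpow_pos_of_pos (M.d_pos x y h) _)).trans_le (h2 x y h).1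

lemma Standing.summable (hS : M.Standing) (x y : M.V) : Summable fun n => M.pstep n x y := by
  by_contra h
  have := hS.green_pos x y
  rw [green, tsum_eq_zero_of_not_summable h, zero_div] at this
  exact lt_irrefl _ this

lemma Standing.green_symm (hS : M.Standing) (x y : M.V) : M.green x y = M.green y x := by
  rw [green, green, ← tsum_div_const, ← tsum_div_const]
  refine tsum_congr fun n => ?_
  rw [div_eq_div_iff (hS.lamTot_pos y).ne' (hS.lamTot_pos x).ne', mul_comm,
    pstep_symm hS.lamTot_pos, mul_comm]

lemma Standing.sum_p_green (hS : M.Standing) (x y : M.V) :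
    ∑ z ∈ M.nbr x, M.p x z * M.green z y =
      M.green x y - if x = y then (M.lamTot y)⁻¹ else 0 := by
  have h1 : ∑' n, M.pstep n x y = (if x = y then 1 else 0) + ∑' n, M.pstep (n + 1) x y :=
    (hS.summable x y).tsum_eq_zero_add
  have h2 : ∑' n, M.pstep (n + 1) x y = ∑ z ∈ M.nbr x, M.p x z * ∑' n, M.pstep n z y := by
    simp_rw [pstep_succ, ← tsum_mul_left]
    exact Summable.tsum_finsetSum fun z _ => (hS.summable z y).mul_left _
  simp only [green]
  rw [h1, h2, add_div, Finset.sum_div]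
  simp_rw [mul_div_assoc]
  split_ifs <;> simp

/-- The (unnormalized, positive) graph Laplacian. -/
def lap (u : M.V → ℝ) (x : M.V) : ℝ := M.lamTot x * u x - ∑ z ∈ M.nbr x, M.lam x z * u z

lemma Standing.lap_green (hS : M.Standing) (x y : M.V) :
    lap (fun z => M.green z y) x = if x = y then 1 else 0 := by
  have h := hS.sum_p_green x y
  have h2 : ∑ z ∈ M.nbr x, M.lam x z * M.green z y =
      M.lamTot x * ∑ z ∈ M.nbr x, M.p x z * M.green z y := by
    rw [Finset.mul_sum]
    exact Finset.sum_congr rfl fun z _ => by rw [← p_mul hS.lamTot_pos x z]; ring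
  rw [lap, h2, h]
  split_ifs with hxy
  · subst hxy
    have := (hS.lamTot_pos x).ne'
    field_simp
    ring
  · ring

lemma lap_sum {ι : Type*} (s : Finset ι) (m : ι → ℝ) (f : ι → M.V → ℝ) (x : M.V) :
    lap (fun z => ∑ i ∈ s, f i z * m i) x = ∑ i ∈ s, lap (f i) x * m i := by
  simp only [lap, sub_mul, Finset.sum_sub_distrib, Finset.mul_sum, Finset.sum_mul]
  congr 1
  · exact Finset.sum_congr rfl fun i _ => by ring
  · rw [Finset.sum_comm]
    exact Finset.sum_congr rfl fun i _ => Finset.sum_congr rfl fun z _ => by ring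

/-- Minimum principle for functions which are harmonic off a set and whose negative part decays
at infinity. -/
lemma nonneg_of_harmonic (u : M.V → ℝ) (S : Set M.V)
    (hne : S.Nonempty) (hS : ∀ x ∈ S, 0 ≤ u x) (hh : ∀ x ∉ S, lap u x = 0)
    (hlim : ∀ c < 0, {z | u z ≤ c}.Finite) (x : M.V) : 0 ≤ u x := by
  by_contra! hx
  have hfin : {z | u z ≤ u x}.Finite := hlim _ hx
  obtain ⟨w, hw, hmin⟩ := Set.exists_min_image _ u hfin ⟨x, le_refl (u x)⟩
  have hmin' : ∀ z, u w ≤ u z := fun z => by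
    by_cases hz : u z ≤ u x
    · exact hmin z hz
    · exact (le_trans hw (not_le.1 hz).le)
  have hw0 : u w < 0 := lt_of_le_of_lt hw hx
  have hall : ∀ e, Relation.ReflTransGen (fun u v => 0 < M.lam u v) w e → u e = u w := by
    intro e hc
    induction hc with
    | refl => rfl
    | @tail b e _ hbe ih =>
      have hb : b ∉ S := fun hb => by have := hS b hb; linarith
      have h0 := hh b hb
      rw [lap, lamTot_eq_sum, Finset.sum_mul, ← Finset.sum_sub_distrib] at h0
      have h1 : ∑ z ∈ M.nbr b, M.lam b z * (u z - u b) = 0 := by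
        rw [← neg_eq_zero, ← h0, ← Finset.sum_neg_distrib]
        exact Finset.sum_congr rfl fun z _ => by ring
      rw [Finset.sum_eq_zero_iff_of_nonneg] at h1
      · have := h1 e (M.mem_nbr.2 hbe.ne')
        rcases mul_eq_zero.1 this with h | h
        · exact absurd h hbe.ne'
        · linarith
      · intro z _
        exact mul_nonneg (M.lam_nonneg _ _) (by have := hmin' z; linarith)
  obtain ⟨s, hs⟩ := hne
  have := hS s hs
  have := hall s (M.connectedG w s)
  linarith

lemma Standing.ball_finite (hS : M.Standing) (x : M.V) (r : ℝ) : (M.ball x r).Finite := by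
  obtain ⟨-, ⟨c, hc, C, hC, h⟩, -⟩ := id hS
  have h1 := (h x (max r 1) (le_max_right _ _)).1
  have hp : 0 < c * (max r 1) ^ M.α := mul_pos hc (rpow_pos_of_pos (by positivity) _)
  have hsub : M.ball x r ⊆ M.ball x (max r 1) := fun y hy =>
    show M.d x y ≤ max r 1 from le_trans (show M.d x y ≤ r from hy) (le_max_left _ _)
  refine Set.Finite.subset ?_ hsub
  by_contra hinf
  rw [finsum_mem_eq_zero_of_infinite] at h1
  · linarith
  · convert hinf using 1
    have : M.ball x (max r 1) ∩ Function.support M.lamTot = M.ball x (max r 1) :=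
      Set.inter_eq_left.2 fun y _ => (hS.lamTot_pos y).ne'
    rw [this]

/-- The ball as a finite set (empty if the ball is infinite). -/
def ballF (M : WGraph) (x : M.V) (r : ℝ) : Finset M.V :=
  if h : (M.ball x r).Finite then h.toFinset else ∅

lemma Standing.mem_ballF (hS : M.Standing) {x y : M.V} {r : ℝ} :
    y ∈ M.ballF x r ↔ M.d x y ≤ r := by
  rw [ballF, dif_pos (hS.ball_finite x r)]
  simp [ball]

/-- The standing assumptions with a single constant `K`. -/
structure Bd (M : WGraph) (K : ℝ) : Prop where
  std : M.Standing
  one_le : 1 ≤ K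
  green_le : ∀ x y, x ≠ y → M.green x y ≤ K * M.d x y ^ (-M.ν)
  le_green : ∀ x y, x ≠ y → M.d x y ^ (-M.ν) ≤ K * M.green x y
  green_self_le : ∀ x, M.green x x ≤ K
  le_green_self : ∀ x, 1 ≤ K * M.green x x
  vol_le : ∀ x r, 1 ≤ r → ∑ y ∈ M.ballF x r, M.lamTot y ≤ K * r ^ M.α
  le_vol : ∀ x r, 1 ≤ r → r ^ M.α ≤ K * ∑ y ∈ M.ballF x r, M.lamTot y
  lamTot_le : ∀ x, M.lamTot x ≤ K
  le_lamTot : ∀ x, 1 ≤ K * M.lamTot x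
  nbr_le : ∀ x y, 0 < M.lam x y → M.d x y ≤ K

lemma Standing.exists_bd (hS : M.Standing) (hν : 0 < M.ν) : ∃ K, M.Bd K := by
  obtain ⟨-, ⟨cv, hcv, Cv, hCv, hv⟩, cg, hcg, Cg, hCg, hg1, hg2⟩ := id hS
  obtain ⟨c0, hc0, hctrl⟩ := M.ctrl
  have hvol : ∀ x r, ∑ᶠ y ∈ M.ball x r, M.lamTot y = ∑ y ∈ M.ballF x r, M.lamTot y := by
    intro x r
    rw [finsum_mem_eq_finite_toFinset_sum _ (hS.ball_finite x r), ballF,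
      dif_pos (hS.ball_finite x r)]
  have hinv : ∀ x, (M.lamTot x)⁻¹ ≤ M.green x x := fun x => by
    have h := hS.sum_p_green x x
    rw [if_pos rfl] at h
    have : 0 ≤ ∑ z ∈ M.nbr x, M.p x z * M.green z x :=
      Finset.sum_nonneg fun z _ => mul_nonneg (M.p_nonneg x z) (hS.green_pos z x).le
    linarith
  have hnbr : ∀ x y, 0 < M.lam x y → M.d x y ≤ (Cg / (c0 * cg)) ^ (M.ν)⁻¹ := by
    intro x y hxy
    by_cases hne : x = y
    · subst hne; rw [M.d_self]; positivity
    have h := hS.sum_p_green x y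
    rw [if_neg hne, sub_zero] at h
    have h1 : M.p x y * M.green y y ≤ ∑ z ∈ M.nbr x, M.p x z * M.green z y :=
      Finset.single_le_sum (f := fun z => M.p x z * M.green z y)
        (fun z _ => mul_nonneg (M.p_nonneg x z) (hS.green_pos z y).le)
        (M.mem_nbr.2 hxy.ne')
    have h2 : c0 ≤ M.p x y := by
      rw [p, le_div_iff₀ (hS.lamTot_pos x)]
      exact hctrl x y hxy
    have h3 : c0 * cg ≤ Cg * M.d x y ^ (-M.ν) :=
      calc c0 * cg ≤ M.p x y * M.green y y :=
            mul_le_mul h2 (hg1 y).1 hcg.le (M.p_nonneg x y)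
        _ ≤ M.green x y := by rw [← h]; exact h1
        _ ≤ _ := (hg2 x y hne).2
    have hd := M.d_pos x y hne
    rw [rpow_neg hd.le, ← div_eq_mul_inv, le_div_iff₀ (by positivity)] at h3
    rw [Real.le_rpow_inv_iff_of_pos hd.le (by positivity) hν, le_div_iff₀ (by positivity)]
    linarith
  set K := max 1 (max Cg (max cg⁻¹ (max Cv (max cv⁻¹ ((Cg / (c0 * cg)) ^ (M.ν)⁻¹))))) with hK
  have k1 : 1 ≤ K := le_max_left _ _
  have k2 : Cg ≤ K := by simp [hK]
  have k3 : cg⁻¹ ≤ K := by simp [hK]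
  have k4 : Cv ≤ K := by simp [hK]
  have k5 : cv⁻¹ ≤ K := by simp [hK]
  have k6 : (Cg / (c0 * cg)) ^ (M.ν)⁻¹ ≤ K := by simp [hK]
  have k3' : 1 ≤ K * cg := by
    have := mul_le_mul_of_nonneg_right k3 hcg.le
    rwa [inv_mul_cancel₀ hcg.ne'] at this
  have k5' : 1 ≤ K * cv := by
    have := mul_le_mul_of_nonneg_right k5 hcv.le
    rwa [inv_mul_cancel₀ hcv.ne'] at this
  have hK0 : 0 < K := by linarith
  refine ⟨K, hS, k1, ?_, ?_, ?_, ?_, ?_, ?_, ?_, ?_, ?_⟩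
  · intro x y h
    exact (hg2 x y h).2.trans
      (mul_le_mul_of_nonneg_right k2 (rpow_nonneg (M.d_pos x y h).le _))
  · intro x y h
    have h1 := mul_le_mul_of_nonneg_left (hg2 x y h).1 hK0.le
    have h2 : 0 ≤ M.d x y ^ (-M.ν) := rpow_nonneg (M.d_pos x y h).le _
    nlinarith
  · exact fun x => (hg1 x).2.trans k2
  · intro x
    have := mul_le_mul_of_nonneg_left (hg1 x).1 hK0.le
    linarith
  · intro x r hr
    rw [← hvol]
    exact (hv x r hr).2.trans
      (mul_le_mul_of_nonneg_right k4 (rpow_nonneg (by linarith) _))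
  · intro x r hr
    rw [← hvol]
    have h1 := mul_le_mul_of_nonneg_left (hv x r hr).1 hK0.le
    have h2 : 0 ≤ r ^ M.α := rpow_nonneg (by linarith) _
    nlinarith
  · intro x
    have h1 := (hv x 1 le_rfl).2
    rw [hvol, one_rpow, mul_one] at h1
    refine le_trans ?_ (h1.trans k4)
    exact Finset.single_le_sum (f := fun y => M.lamTot y) (fun y _ => M.lamTot_nonneg y)
      (hS.mem_ballF.2 (by rw [M.d_self]; norm_num))
  · intro x
    have h1 := ((hinv x).trans (hg1 x).2).trans k2
    have h2 := mul_le_mul_of_nonneg_right h1 (hS.lamTot_pos x).le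
    rwa [inv_mul_cancel₀ (hS.lamTot_pos x).ne'] at h2
  · exact fun x y h => (hnbr x y h).trans k6

lemma Standing.tendsto_green (hS : M.Standing) (hν : 0 < M.ν) (y : M.V) :
    Tendsto (fun x => M.green x y) cofinite (𝓝 0) := by
  obtain ⟨K, hK⟩ := hS.exists_bd hν
  have hd : Tendsto (fun x => M.d x y) cofinite atTop := by
    rw [tendsto_atTop]
    intro b
    rw [Filter.eventually_cofinite]
    refine (hS.ball_finite y b).subset fun x hx => ?_
    simp only [Set.mem_ofPred_eq, not_le] at hx
    rw [ball, Set.mem_ofPred_eq, M.d_symm]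
    exact hx.le
  have h1 : Tendsto (fun x => K * M.d x y ^ (-M.ν)) cofinite (𝓝 (K * 0)) :=
    ((tendsto_rpow_neg_atTop hν).comp hd).const_mul K
  rw [mul_zero] at h1
  refine squeeze_zero' (Eventually.of_forall fun x => (hS.green_pos x y).le) ?_ h1
  have : ∀ᶠ x in cofinite, x ≠ y := by
    rw [Filter.eventually_cofinite]; simp
  filter_upwards [this] with x hx using hK.green_le x y hx

end WGraph

namespace WGraph

variable {M : WGraph}

/-- The Green's function restricted to a finite set, as a matrix. -/
def greenMat (M : WGraph) (U : Finset M.V) : Matrix U U ℝ :=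
  Matrix.of fun x y => M.green x.1 y.1

/-- The inverse of the restricted Green's function, i.e. the precision matrix of the field. -/
def prec (M : WGraph) (U : Finset M.V) : Matrix U U ℝ := (greenMat M U)⁻¹

/-- The potential of a charge distribution on a finite set. -/
def pot {U : Finset M.V} (m : U → ℝ) (z : M.V) : ℝ := ∑ i : U, M.green z i.1 * m i

lemma greenMat_mulVec {U : Finset M.V} (m : U → ℝ) (x : U) :
    (greenMat M U).mulVec m x = pot m x.1 := rfl

lemma Standing.lap_pot (hS : M.Standing) {U : Finset M.V} (m : U → ℝ) (x : M.V) :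
    lap (pot m) x = if h : x ∈ U then m ⟨x, h⟩ else 0 := by
  have : lap (pot m) x = ∑ i : U, lap (fun z => M.green z i.1) x * m i :=
    lap_sum Finset.univ m (fun (i : U) z => M.green z i.1) x
  rw [this]
  simp_rw [hS.lap_green]
  split_ifs with h
  · rw [Finset.sum_eq_single ⟨x, h⟩]
    · simp
    · intro i _ hi
      rw [if_neg (fun e => hi (Subtype.ext e.symm)), zero_mul]
    · simp
  · refine Finset.sum_eq_zero fun i _ => ?_
    rw [if_neg (fun e : x = i.1 => h (e ▸ i.2)), zero_mul]

lemma Standing.tendsto_pot (hS : M.Standing) (hν : 0 < M.ν) {U : Finset M.V} (m : U → ℝ) :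
    Tendsto (pot m) cofinite (𝓝 0) := by
  have : Tendsto (pot m) cofinite (𝓝 (∑ i : U, 0 * m i)) :=
    tendsto_finsetSum _ fun i _ => (hS.tendsto_green hν i.1).mul_const _
  simpa using this

lemma Standing.pot_nonneg (hS : M.Standing) (hν : 0 < M.ν) {U : Finset M.V} (hU : U.Nonempty)
    (m : U → ℝ) (h : ∀ x ∈ U, 0 ≤ pot m x) (z : M.V) : 0 ≤ pot m z := by
  refine nonneg_of_harmonic _ (U : Set M.V) hU h (fun x hx => ?_) (fun c hc => ?_) z
  · rw [hS.lap_pot, dif_neg (by simpa using hx)]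
  · have := (hS.tendsto_pot hν m).eventually (lt_mem_nhds hc)
    rw [Filter.eventually_cofinite] at this
    simpa using this

lemma Standing.pot_le_one (hS : M.Standing) (hν : 0 < M.ν) {U : Finset M.V} (hU : U.Nonempty)
    (m : U → ℝ) (h : ∀ x ∈ U, pot m x ≤ 1) (z : M.V) : pot m z ≤ 1 := by
  have : 0 ≤ (fun z => 1 - pot m z) z := by
    refine nonneg_of_harmonic (fun z => 1 - pot m z) (U : Set M.V) hU (fun x hx => ?_)
      (fun x hx => ?_) (fun c hc => ?_) z
    · have := h x hx
      linarith
    · have h1 := hS.lap_pot m x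
      rw [dif_neg (by simpa using hx)] at h1
      rw [lap] at h1 ⊢
      simp only [mul_sub, mul_one, Finset.sum_sub_distrib, ← lamTot_eq_sum]
      linarith
    · have := (hS.tendsto_pot hν m).eventually (gt_mem_nhds (show (0:ℝ) < 1 - c by linarith))
      rw [Filter.eventually_cofinite] at this
      refine this.subset fun y hy => ?_
      simp only [Set.mem_ofPred_eq] at hy ⊢
      linarith
  simp only at this
  linarith

lemma Standing.isUnit_greenMat (hS : M.Standing) (hν : 0 < M.ν) {U : Finset M.V}
    (hU : U.Nonempty) : IsUnit (greenMat M U) := by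
  rw [← Matrix.mulVec_injective_iff_isUnit]
  intro m₁ m₂ hm₁₂
  rw [← sub_eq_zero]
  have hm : (greenMat M U).mulVec (m₁ - m₂) = 0 := by
    rw [Matrix.mulVec_sub, sub_eq_zero]; exact hm₁₂
  generalize m₁ - m₂ = m at hm
  have h0 : ∀ x ∈ U, pot m x = 0 := fun x hx => by
    rw [← greenMat_mulVec m ⟨x, hx⟩, hm]; rfl
  have h1 := hS.pot_nonneg hν hU m fun x hx => (h0 x hx).ge
  have hneg : ∀ z, pot (-m) z = - pot m z := fun z => by simp [pot]
  have h2 := hS.pot_nonneg hν hU (-m) fun x hx => by rw [hneg, h0 x hx, neg_zero]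
  have h3 : pot m = 0 := funext fun z => le_antisymm (by have := h2 z; rw [hneg] at this; simpa using this) (h1 z)
  funext x
  have := hS.lap_pot m x.1
  rw [dif_pos x.2, h3] at this
  rw [← this]
  simp [lap]


lemma Standing.greenMat_mul_prec (hS : M.Standing) (hν : 0 < M.ν) {U : Finset M.V}
    (hU : U.Nonempty) : greenMat M U * prec M U = 1 :=
  Matrix.mul_nonsing_inv _ ((Matrix.isUnit_iff_isUnit_det _).1 (hS.isUnit_greenMat hν hU))

lemma Standing.prec_symm (hS : M.Standing) {U : Finset M.V} (x y : U) :
    prec M U x y = prec M U y x := by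
  have h : (greenMat M U).transpose = greenMat M U := by
    ext x y
    exact hS.green_symm y.1 x.1
  have h2 : (prec M U).transpose = prec M U := by rw [prec, Matrix.transpose_nonsing_inv, h]
  conv_rhs => rw [← h2]
  rfl

/-- The equilibrium potential of a vertex of `U`, vanishing on the rest of `U`. -/
lemma Standing.pot_prec (hS : M.Standing) (hν : 0 < M.ν) {U : Finset M.V} (hU : U.Nonempty)
    (x y : U) : pot (fun z => prec M U z y) x.1 = if x = y then 1 else 0 := by
  have := congrFun (congrFun (hS.greenMat_mul_prec hν hU) x) y
  rw [Matrix.one_apply] at this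
  exact this

lemma Standing.prec_eq_lap (hS : M.Standing) {U : Finset M.V} (x y : U) :
    prec M U x y = lap (pot fun z => prec M U z y) x.1 := by
  rw [hS.lap_pot, dif_pos x.2]

lemma Standing.prec_nonpos (hS : M.Standing) (hν : 0 < M.ν) {U : Finset M.V} (hU : U.Nonempty)
    {x y : U} (hxy : x ≠ y) : prec M U x y ≤ 0 := by
  rw [hS.prec_eq_lap, lap, hS.pot_prec hν hU, if_neg hxy, mul_zero, zero_sub, neg_nonpos]
  refine Finset.sum_nonneg fun z _ => mul_nonneg (M.lam_nonneg _ _)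
    (hS.pot_nonneg hν hU _ (fun w hw => ?_) z)
  rw [hS.pot_prec hν hU ⟨w, hw⟩ y]
  split_ifs <;> norm_num

/-- The killing measure of the trace network on `U`. -/
def kill (M : WGraph) (U : Finset M.V) (x : U) : ℝ := ∑ y, prec M U x y

lemma Standing.kill_nonneg (hS : M.Standing) (hν : 0 < M.ν) {U : Finset M.V} (hU : U.Nonempty)
    (x : U) : 0 ≤ kill M U x := by
  have hpot : ∀ w : U, pot (kill M U) w.1 = 1 := fun w => by
    have : pot (kill M U) w.1 = ∑ y, pot (fun z => prec M U z y) w.1 := by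
      simp only [pot, kill, Finset.mul_sum]
      exact Finset.sum_comm
    rw [this]
    simp_rw [hS.pot_prec hν hU]
    simp
  have h := hS.lap_pot (kill M U) x.1
  rw [dif_pos x.2] at h
  rw [← Subtype.coe_eta x x.2, ← h, lap, hpot x, lamTot_eq_sum, mul_one, ← Finset.sum_sub_distrib]
  refine Finset.sum_nonneg fun z _ => ?_
  have h1 := hS.pot_le_one hν hU (kill M U) (fun w hw => (hpot ⟨w, hw⟩).le) z
  have := mul_le_mul_of_nonneg_left h1 (M.lam_nonneg x z)
  linarith

lemma Standing.prec_interior (hS : M.Standing) (hν : 0 < M.ν) {U : Finset M.V} (hU : U.Nonempty)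
    (x y : U) (hx : M.nbr x ⊆ U) :
    prec M U x y = (if x = y then M.lamTot x else 0) - M.lam x y := by
  rw [hS.prec_eq_lap, lap, hS.pot_prec hν hU]
  congr 1
  · split_ifs <;> simp
  · have : ∀ z ∈ M.nbr x, M.lam x z * pot (fun z => prec M U z y) z =
        if z = y.1 then M.lam x z else 0 := fun z hz => by
      rw [hS.pot_prec hν hU ⟨z, hx hz⟩ y]
      simp [← Subtype.coe_inj]
    rw [Finset.sum_congr rfl this, Finset.sum_ite_eq']
    split_ifs with h
    · rfl
    · exact (M.lam_eq_zero h).symm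

lemma Standing.kill_interior (hS : M.Standing) (hν : 0 < M.ν) {U : Finset M.V} (hU : U.Nonempty)
    (x : U) (hx : M.nbr x ⊆ U) : kill M U x = 0 := by
  rw [kill]
  simp_rw [hS.prec_interior hν hU x _ hx]
  rw [Finset.sum_sub_distrib, Finset.sum_ite_eq, if_pos (Finset.mem_univ _), lamTot_eq_sum,
    sub_eq_zero, Finset.sum_coe_sort U fun y => M.lam x y]
  exact Finset.sum_subset hx fun z _ hz => M.lam_eq_zero hz

lemma Standing.sum_green_kill (hS : M.Standing) (hν : 0 < M.ν) {U : Finset M.V}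
    (hU : U.Nonempty) (x : U) : ∑ y : U, M.green x y * kill M U y = 1 := by
  simp only [kill, Finset.mul_sum]
  rw [Finset.sum_comm]
  have := fun y => hS.pot_prec hν hU x y
  simp only [pot] at this
  simp_rw [this]
  simp

lemma Standing.quad_prec (hS : M.Standing) {U : Finset M.V} (v : U → ℝ) :
    ∑ x, ∑ y, v x * prec M U x y * v y =
      ∑ x, kill M U x * v x ^ 2 + (1 / 2) * ∑ x, ∑ y, (- prec M U x y) * (v x - v y) ^ 2 := by
  have h1 : ∑ x, ∑ y, prec M U x y * v y ^ 2 = ∑ x, kill M U x * v x ^ 2 := by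
    rw [Finset.sum_comm]
    refine Finset.sum_congr rfl fun x _ => ?_
    rw [kill, Finset.sum_mul]
    exact Finset.sum_congr rfl fun y _ => by rw [hS.prec_symm]
  have h2 : ∑ x, ∑ y, prec M U x y * v x ^ 2 = ∑ x, kill M U x * v x ^ 2 :=
    Finset.sum_congr rfl fun x _ => by rw [kill, Finset.sum_mul]
  have h3 : ∑ x, ∑ y, (- prec M U x y) * (v x - v y) ^ 2 =
      2 * ∑ x, ∑ y, v x * prec M U x y * v y - ∑ x, ∑ y, prec M U x y * v y ^ 2
        - ∑ x, ∑ y, prec M U x y * v x ^ 2 := by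
    simp only [Finset.mul_sum, ← Finset.sum_sub_distrib]
    exact Finset.sum_congr rfl fun x _ => Finset.sum_congr rfl fun y _ => by ring
  rw [h3, h1, h2]
  ring

lemma Standing.posDef_prec (hS : M.Standing) (hν : 0 < M.ν) {U : Finset M.V}
    (hU : U.Nonempty) : (prec M U).PosDef := by
  have hsymm : (prec M U).IsHermitian := by
    ext x y
    simp only [Matrix.conjTranspose_apply, star_trivial]
    exact hS.prec_symm y x
  have hps : (prec M U).PosSemidef := by
    refine Matrix.PosSemidef.of_dotProduct_mulVec_nonneg hsymm fun v => ?_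
    have : dotProduct (star v) ((prec M U).mulVec v) = ∑ x, ∑ y, v x * prec M U x y * v y := by
      simp [dotProduct, Matrix.mulVec, Finset.mul_sum, mul_assoc]
    rw [this, hS.quad_prec]
    refine add_nonneg (Finset.sum_nonneg fun x _ => mul_nonneg (hS.kill_nonneg hν hU x)
      (sq_nonneg _)) (mul_nonneg (by norm_num) (Finset.sum_nonneg fun x _ =>
        Finset.sum_nonneg fun y _ => ?_))
    by_cases h : x = y
    · subst h; simp
    · exact mul_nonneg (by linarith [hS.prec_nonpos hν hU h]) (sq_nonneg _)
  refine (hps.posDef_iff_isUnit).2 ?_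
  rw [prec, Matrix.isUnit_nonsing_inv_iff]
  exact hS.isUnit_greenMat hν hU

lemma Standing.posDef_greenMat (hS : M.Standing) (hν : 0 < M.ν) {U : Finset M.V}
    (hU : U.Nonempty) : (greenMat M U).PosDef := by
  have := (hS.posDef_prec hν hU).inv
  rwa [prec, Matrix.nonsing_inv_nonsing_inv _
    ((Matrix.isUnit_iff_isUnit_det _).1 (hS.isUnit_greenMat hν hU))] at this

end WGraph

section GaussianLaw

variable {ι : Type*} [Fintype ι]

/-- The density of the standard Gaussian product measure. -/
lemma pi_gaussianReal_eq_withDensity :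
    Measure.pi (fun _ : ι => gaussianReal 0 1) =
      volume.withDensity fun w : ι → ℝ => ENNReal.ofReal (∏ i, gaussianPDFReal 0 1 (w i)) := by
  refine Measure.pi_eq fun s hs => ?_
  have hmeas : MeasurableSet (Set.univ.pi s) := MeasurableSet.univ_pi hs
  have hinteg : Integrable (fun w : ι → ℝ => ∏ i, gaussianPDFReal 0 1 (w i)) :=
    Integrable.fintype_prod fun i => integrable_gaussianPDFReal 0 1
  have hnn : ∀ w : ι → ℝ, 0 ≤ ∏ i, gaussianPDFReal 0 1 (w i) := fun w =>
    Finset.prod_nonneg fun i _ => gaussianPDFReal_nonneg _ _ _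
  rw [withDensity_apply _ hmeas, ← ofReal_integral_eq_lintegral_ofReal hinteg.integrableOn
    (ae_of_all _ hnn), ← integral_indicator hmeas]
  have h1 : ((Set.univ.pi s).indicator fun w : ι → ℝ => ∏ i, gaussianPDFReal 0 1 (w i)) =
      fun w => ∏ i, (s i).indicator (gaussianPDFReal 0 1) (w i) := by
    funext w
    by_cases hw : w ∈ Set.univ.pi s
    · rw [Set.indicator_of_mem hw]
      exact Finset.prod_congr rfl fun i _ => (Set.indicator_of_mem (hw i (Set.mem_univ i)) _).symm
    · rw [Set.indicator_of_notMem hw]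
      simp only [Set.mem_pi, Set.mem_univ, true_implies, not_forall] at hw
      obtain ⟨i, hi⟩ := hw
      exact (Finset.prod_eq_zero (Finset.mem_univ i) (Set.indicator_of_notMem hi _)).symm
  rw [h1, integral_fintype_prod_volume_eq_prod, ENNReal.ofReal_prod_of_nonneg]
  · refine Finset.prod_congr rfl fun i _ => ?_
    rw [gaussianReal_of_var_ne_zero 0 one_ne_zero, withDensity_apply _ (hs i),
      integral_indicator (hs i), ofReal_integral_eq_lintegral_ofReal
        (integrable_gaussianPDFReal 0 1).integrableOn (ae_of_all _ (gaussianPDFReal_nonneg 0 1))]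
    rfl
  · exact fun i _ => integral_nonneg fun t =>
      Set.indicator_nonneg (fun t _ => gaussianPDFReal_nonneg 0 1 t) t

/-- Two finite measures on `ℝ^ι` with the same one-dimensional projections agree. -/
lemma measure_ext_of_map_sum {μ₁ μ₂ : Measure (ι → ℝ)} [IsFiniteMeasure μ₁] [IsFiniteMeasure μ₂]
    (h : ∀ c : ι → ℝ, charFun (μ₁.map fun v => ∑ i, c i * v i) 1 =
      charFun (μ₂.map fun v => ∑ i, c i * v i) 1) : μ₁ = μ₂ := by
  refine Measure.ext_of_charFunDual (funext fun L => ?_)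
  rw [charFunDual_eq_charFun_map_one, charFunDual_eq_charFun_map_one]
  have hL : (L : (ι → ℝ) → ℝ) = fun v => ∑ i, L (Pi.single i 1) * v i := by
    funext v
    conv_lhs => rw [← Finset.univ_sum_single v, map_sum]
    refine Finset.sum_congr rfl fun i _ => ?_
    have : (Pi.single i (v i) : ι → ℝ) = v i • Pi.single i 1 := by
      rw [← Pi.single_smul, smul_eq_mul, mul_one]
    rw [this, map_smul, smul_eq_mul, mul_comm]
  rw [hL]
  exact h _

lemma charFun_map_pi_gaussianReal (d : ι → ℝ) :
    charFun ((Measure.pi fun _ : ι => gaussianReal 0 1).map fun w => ∑ i, d i * w i) 1 =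
      Complex.exp (-((∑ i, d i ^ 2 : ℝ) : ℂ) / 2) := by
  rw [charFun_apply_real, integral_map (Measurable.aemeasurable (by fun_prop))
    (Measurable.aestronglyMeasurable (by fun_prop))]
  have h1 : ∀ w : ι → ℝ, Complex.exp (((1:ℝ):ℂ) * ((∑ i, d i * w i : ℝ) : ℂ) * Complex.I) =
      ∏ i, Complex.exp ((d i : ℂ) * (w i : ℂ) * Complex.I) := fun w => by
    rw [← Complex.exp_sum]
    congr 1
    push_cast
    rw [one_mul, Finset.sum_mul]
  simp_rw [h1]
  rw [integral_fintype_prod_eq_prod (f := fun i (t : ℝ) =>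
    Complex.exp ((d i : ℂ) * (t : ℂ) * Complex.I))]
  simp_rw [← charFun_apply_real, charFun_gaussianReal]
  rw [← Complex.exp_sum]
  congr 1
  push_cast
  rw [neg_div, Finset.sum_div, ← Finset.sum_neg_distrib]
  exact Finset.sum_congr rfl fun i _ => by simp

open scoped MatrixOrder in
lemma Matrix.PosDef.exists_factor [DecidableEq ι] {S : Matrix ι ι ℝ} (hS : S.PosDef) :
    ∃ B : Matrix ι ι ℝ, S = B.transpose * B ∧ B.det ≠ 0 := by
  obtain ⟨B, hB⟩ := CStarAlgebra.nonneg_iff_eq_star_mul_self.mp hS.posSemidef.nonneg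
  refine ⟨B, by rw [hB]; rfl, fun h => ?_⟩
  have h1 := hS.det_pos
  rw [hB, Matrix.det_mul, h, mul_zero] at h1
  exact lt_irrefl _ h1

/-- A measure with centred Gaussian projections and invertible covariance has the usual Gaussian
density. -/
lemma exists_gaussian_density [DecidableEq ι] {S : Matrix ι ι ℝ} (hS : S.PosDef)
    (μ : Measure (ι → ℝ)) [IsProbabilityMeasure μ]
    (h : ∀ c : ι → ℝ, μ.map (fun v => ∑ i, c i * v i) =
      gaussianReal 0 (Real.toNNReal (∑ i, ∑ j, c i * c j * S i j))) :
    ∃ Z > 0, μ = volume.withDensity fun v : ι → ℝ =>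
      ENNReal.ofReal (Z * Real.exp (-(1/2) * ∑ i, ∑ j, v i * S⁻¹ i j * v j)) := by
  obtain ⟨B, hB, hdet⟩ := hS.exists_factor
  have hdetT : B.transpose.det ≠ 0 := by rwa [Matrix.det_transpose]
  set γ := Measure.pi fun _ : ι => gaussianReal 0 1 with hγ
  set T : (ι → ℝ) → ι → ℝ := ⇑(Matrix.toLin' B.transpose) with hT
  have hTv : ∀ w i, T w i = ∑ j, B j i * w j := fun w i => by
    simp [hT, Matrix.mulVec, dotProduct]
  have hTm : Measurable T := by
    rw [measurable_pi_iff]; intro i; simp_rw [hTv]; fun_prop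
  have hquad : ∀ c : ι → ℝ, ∑ i, ∑ j, c i * c j * S i j = ∑ k, (∑ i, c i * B k i) ^ 2 := by
    intro c
    simp_rw [hB, Matrix.mul_apply, Matrix.transpose_apply, Finset.mul_sum, sq,
      Finset.sum_mul_sum]
    rw [Finset.sum_comm_cycle]
    exact Finset.sum_congr rfl fun k _ => Finset.sum_congr rfl fun i _ =>
      Finset.sum_congr rfl fun j _ => by ring
  have hμ : μ = γ.map T := by
    have : IsProbabilityMeasure (γ.map T) := Measure.isProbabilityMeasure_map hTm.aemeasurable
    refine measure_ext_of_map_sum fun c => ?_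
    rw [h, Measure.map_map (by fun_prop) hTm, charFun_gaussianReal]
    have h2 : ((fun v : ι → ℝ => ∑ i, c i * v i) ∘ T) =
        fun w => ∑ j, (∑ i, c i * B j i) * w j := by
      funext w
      simp only [Function.comp, hTv, Finset.mul_sum, Finset.sum_mul]
      rw [Finset.sum_comm]
      exact Finset.sum_congr rfl fun i _ => Finset.sum_congr rfl fun j _ => by ring
    rw [h2, charFun_map_pi_gaussianReal, hquad,
      Real.coe_toNNReal _ (Finset.sum_nonneg fun _ _ => sq_nonneg _)]
    congr 1
    push_cast
    simp
    ring
  have hinv : ∀ w, ∑ i, ∑ j, T w i * S⁻¹ i j * T w j = ∑ i, w i ^ 2 := fun w => by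
    have e1 : ∑ i, ∑ j, T w i * S⁻¹ i j * T w j = dotProduct (T w) (S⁻¹.mulVec (T w)) := by
      simp [dotProduct, Matrix.mulVec, Finset.mul_sum, mul_assoc]
    have hu : IsUnit B.det := isUnit_iff_ne_zero.2 hdet
    have huT : IsUnit B.transpose.det := isUnit_iff_ne_zero.2 hdetT
    have e2 : S⁻¹.mulVec (T w) = B⁻¹.mulVec w := by
      simp only [hT, Matrix.toLin'_apply, Matrix.mulVec_mulVec]
      rw [hB, Matrix.mul_inv_rev, Matrix.mul_assoc, Matrix.nonsing_inv_mul _ huT, Matrix.mul_one]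
    rw [e1, e2]
    simp only [hT, Matrix.toLin'_apply]
    rw [Matrix.mulVec_transpose, ← Matrix.dotProduct_mulVec, Matrix.mulVec_mulVec,
      Matrix.mul_nonsing_inv _ hu, Matrix.one_mulVec]
    simp [dotProduct, sq]
  set Z₀ : ℝ := ((√(2 * π))⁻¹) ^ Fintype.card ι with hZ₀
  have hZ₀pos : 0 < Z₀ := by positivity
  set ρ : (ι → ℝ) → ℝ := fun v => Real.exp (-(1/2) * ∑ i, ∑ j, v i * S⁻¹ i j * v j) with hρ
  have hρm : Measurable ρ := by fun_prop
  have hpdf : ∀ w : ι → ℝ, ∏ i, gaussianPDFReal 0 1 (w i) = Z₀ * ρ (T w) := fun w => by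
    simp only [gaussianPDFReal, NNReal.coe_one, mul_one, sub_zero, hρ, hinv, Finset.prod_mul_distrib,
      Finset.prod_const, hZ₀, ← Real.exp_sum, Finset.card_univ]
    congr 2
    rw [Finset.mul_sum]
    exact Finset.sum_congr rfl fun i _ => by ring
  have hdpos : 0 < |B.transpose.det⁻¹| := by simpa using hdetT
  refine ⟨|B.transpose.det⁻¹| * Z₀, by positivity, ?_⟩
  rw [hμ]
  ext A hA
  rw [Measure.map_apply hTm hA, hγ, pi_gaussianReal_eq_withDensity,
    withDensity_apply _ (hTm hA), withDensity_apply _ hA]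
  simp_rw [hpdf]
  have hmap := Real.map_matrix_volume_pi_eq_smul_volume_pi hdetT
  have e3 : ∫⁻ w in T ⁻¹' A, ENNReal.ofReal (Z₀ * ρ (T w)) =
      ∫⁻ v in A, ENNReal.ofReal (Z₀ * ρ v) ∂(volume.map T) :=
    (setLIntegral_map (f := fun v => ENNReal.ofReal (Z₀ * ρ v)) hA (by fun_prop) hTm).symm
  rw [e3, hT, hmap, Measure.restrict_smul, lintegral_smul_measure, smul_eq_mul,
    ← lintegral_const_mul _ (by fun_prop)]
  refine lintegral_congr fun v => ?_
  rw [← ENNReal.ofReal_mul hdpos.le, mul_assoc]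

end GaussianLaw

namespace Model

variable (M : Model)

/-- The field, raised by `a`, on a finite set. -/
def field (U : Finset M.V) (a : ℝ) (ω : M.Ω) (x : U) : ℝ := M.φ ω x + a

lemma measurable_field (U : Finset M.V) (a : ℝ) : Measurable (M.field U a) :=
  measurable_pi_iff.2 fun x => (M.φ_meas x).add_const a

/-- The density of the field raised by `a`, up to normalization. -/
def gaussDens (U : Finset M.V) (a : ℝ) (v : U → ℝ) : ℝ :=
  Real.exp (-(1 / 2) * ∑ i, ∑ j, (v i - a) * M.toWGraph.prec U i j * (v j - a))

lemma gaussDens_meas (U : Finset M.V) (a : ℝ) : Measurable (M.gaussDens U a) := by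
  unfold gaussDens; fun_prop

lemma map_sum_field (U : Finset M.V) (c : U → ℝ) :
    M.P.map (fun ω => ∑ i, c i * M.φ ω i.1) =
      gaussianReal 0 (Real.toNNReal (∑ i, ∑ j, c i * c j * M.toWGraph.greenMat U i j)) := by
  have h := M.φ_gauss U fun x => if h : x ∈ U then c ⟨x, h⟩ else 0
  have e1 : ∀ ω, ∑ x ∈ U, (if h : x ∈ U then c ⟨x, h⟩ else 0) * M.φ ω x =
      ∑ i : U, c i * M.φ ω i.1 := fun ω => by
    rw [← Finset.sum_coe_sort]
    exact Finset.sum_congr rfl fun i _ => by rw [dif_pos i.2]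
  have e2 : ∑ x ∈ U, ∑ y ∈ U, (if h : x ∈ U then c ⟨x, h⟩ else 0) *
      (if h : y ∈ U then c ⟨y, h⟩ else 0) * M.toWGraph.green x y =
      ∑ i, ∑ j, c i * c j * M.toWGraph.greenMat U i j := by
    rw [← Finset.sum_coe_sort]
    refine Finset.sum_congr rfl fun i _ => ?_
    rw [← Finset.sum_coe_sort]
    exact Finset.sum_congr rfl fun j _ => by rw [dif_pos i.2, dif_pos j.2]; rfl
  simp_rw [e1, e2] at h
  exact h

lemma exists_field_density (hS : M.toWGraph.Standing) (hν : 0 < M.ν) {U : Finset M.V}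
    (hU : U.Nonempty) : ∃ Z > 0, ∀ a, M.P.map (M.field U a) =
      volume.withDensity fun v => ENNReal.ofReal (Z * M.gaussDens U a v) := by
  have := M.Pprob
  have hm0 : Measurable fun ω (x : U) => M.φ ω x := measurable_pi_iff.2 fun x => M.φ_meas x
  have : IsProbabilityMeasure (M.P.map fun ω (x : U) => M.φ ω x) :=
    Measure.isProbabilityMeasure_map hm0.aemeasurable
  obtain ⟨Z, hZ, h⟩ := exists_gaussian_density (hS.posDef_greenMat hν hU)
    (M.P.map fun ω (x : U) => M.φ ω x) fun c => by
      rw [Measure.map_map (by fun_prop) hm0, ← M.map_sum_field U c]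
      rfl
  refine ⟨Z, hZ, fun a => ?_⟩
  have hadd : Measurable fun v : U → ℝ => v + fun _ => a := measurable_add_const _
  have e : M.field U a = (fun v : U → ℝ => v + fun _ => a) ∘ fun ω (x : U) => M.φ ω x := rfl
  rw [e, ← Measure.map_map hadd hm0, h]
  ext A hA
  rw [Measure.map_apply hadd hA, withDensity_apply _ (hadd hA), withDensity_apply _ hA]
  have hmap : (volume : Measure (U → ℝ)).map (fun v => v + fun _ => a) = volume :=
    map_add_right_eq_self volume _
  have e3 := setLIntegral_map (μ := (volume : Measure (U → ℝ))) hA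
    (f := fun v => ENNReal.ofReal (Z * M.gaussDens U a v))
    (by have := M.gaussDens_meas U a; fun_prop) hadd
  rw [hmap] at e3
  rw [e3]
  simp only [gaussDens, Pi.add_apply, add_sub_cancel_right]
  rfl

end Model

/-! ### Weighted sums over edge configurations -/

section Bern

variable {E : Type*} [Fintype E] [DecidableEq E]

/-- The weighted sum of `F` over configurations, with weights `α` (open) and `β` (closed). -/
def bern (α β : E → ℝ) (F : Finset E → ℝ) : ℝ :=
  ∑ ω : Finset E, F ω * ∏ e, if e ∈ ω then α e else β e

lemma sum_finset_split (e : E) (f : Finset E → ℝ) :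
    ∑ ω : Finset E, f ω = ∑ ω ∈ Finset.univ.filter (fun ω => e ∉ ω), (f ω + f (insert e ω)) := by
  rw [← Finset.sum_filter_add_sum_filter_not Finset.univ (fun ω => e ∉ ω), Finset.sum_add_distrib]
  congr 1
  symm
  refine Finset.sum_bij' (fun ω _ => insert e ω) (fun ω _ => ω.erase e) ?_ ?_ ?_ ?_ ?_
  · intro ω _; simp
  · intro ω _; simp
  · intro ω h; exact Finset.erase_insert (by simpa using h)
  · intro ω h; exact Finset.insert_erase (by simpa using h)
  · intro ω _; rfl

lemma bern_update (α β α' β' : E → ℝ) (F : Finset E → ℝ) (e : E)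
    (hne : ∀ f, f ≠ e → α f = α' f ∧ β f = β' f)
    (h : ∀ ω, e ∉ ω → F ω * β e + F (insert e ω) * α e = F ω * β' e + F (insert e ω) * α' e) :
    bern α β F = bern α' β' F := by
  rw [bern, bern, sum_finset_split e, sum_finset_split e (fun ω => F ω * ∏ f, if f ∈ ω then α' f else β' f)]
  refine Finset.sum_congr rfl fun ω hω => ?_
  simp only [Finset.mem_filter, Finset.mem_univ, true_and] at hω
  have key : ∀ α β : E → ℝ, (F ω * ∏ f, if f ∈ ω then α f else β f) +
      F (insert e ω) * (∏ f, if f ∈ insert e ω then α f else β f) =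
      (F ω * β e + F (insert e ω) * α e) *
        ∏ f ∈ Finset.univ.erase e, if f ∈ ω then α f else β f := by
    intro α β
    rw [← Finset.mul_prod_erase _ _ (Finset.mem_univ e),
      ← Finset.mul_prod_erase _ (fun f => if f ∈ insert e ω then α f else β f) (Finset.mem_univ e),
      if_neg hω, if_pos (Finset.mem_insert_self _ _)]
    have : ∏ f ∈ Finset.univ.erase e, (if f ∈ insert e ω then α f else β f) =
        ∏ f ∈ Finset.univ.erase e, if f ∈ ω then α f else β f :=
      Finset.prod_congr rfl fun f hf => by simp [Finset.ne_of_mem_erase hf]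
    rw [this]
    ring
  rw [key, key, h ω hω]
  congr 1
  refine Finset.prod_congr rfl fun f hf => ?_
  obtain ⟨h1, h2⟩ := hne f (Finset.ne_of_mem_erase hf)
  rw [h1, h2]

/-- Weights may be changed edge by edge as long as the local sums agree. -/
lemma bern_congr (α β α' β' : E → ℝ) (F : Finset E → ℝ)
    (h : ∀ e ω, e ∉ ω →
      F ω * β e + F (insert e ω) * α e = F ω * β' e + F (insert e ω) * α' e) :
    bern α β F = bern α' β' F := by
  have : ∀ s : Finset E, bern α β F =
      bern (fun e => if e ∈ s then α' e else α e) (fun e => if e ∈ s then β' e else β e) F := by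
    intro s
    induction s using Finset.induction with
    | empty => simp
    | insert e s he ih =>
      rw [ih]
      refine bern_update _ _ _ _ F e (fun f hf => by simp [hf]) fun ω hω => ?_
      simpa [he] using h e ω hω
  simpa using this Finset.univ

lemma bern_zero (β : E → ℝ) (F : Finset E → ℝ) : bern 0 β F = F ∅ * ∏ e, β e := by
  rw [bern, Finset.sum_eq_single ∅]
  · simp
  · intro ω _ hω
    obtain ⟨e, he⟩ := Finset.nonempty_iff_ne_empty.2 hω
    rw [Finset.prod_eq_zero (Finset.mem_univ e) (by simp [he]), mul_zero]
  · simp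

lemma bern_one (α β : E → ℝ) : bern α β (fun _ => 1) = ∏ e, (α e + β e) := by
  rw [bern_congr α β 0 (fun e => α e + β e) _ (fun e ω _ => by simp; ring), bern_zero, one_mul]

lemma bern_smul (s α β : E → ℝ) (F : Finset E → ℝ) :
    bern (fun e => s e * α e) (fun e => s e * β e) F = (∏ e, s e) * bern α β F := by
  rw [bern, bern, Finset.mul_sum]
  refine Finset.sum_congr rfl fun ω _ => ?_
  have : ∏ e, (if e ∈ ω then s e * α e else s e * β e) =
      (∏ e, s e) * ∏ e, if e ∈ ω then α e else β e := by
    rw [← Finset.prod_mul_distrib]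
    exact Finset.prod_congr rfl fun e _ => by split_ifs <;> rfl
  rw [this]
  ring

end Bern

/-! ### A random cluster representation of a Gaussian vector -/

/-- Data of a finite Gaussian vector with a ghost vertex at which the field takes the value `a`.
Edges are pairs in `Option V`, the ghost being `none`. -/
structure FK (V : Type) [Fintype V] where
  c : Option V × Option V → ℝ
  c_nonneg : ∀ e, 0 ≤ c e
  c_diag : ∀ i, c (i, i) = 0
  D : V → ℝ
  D_pos : ∀ x, 0 < D x
  a : ℝ
  Z : ℝ
  Z_nonneg : 0 ≤ Z
  mass : ∫⁻ v : V → ℝ, ENNReal.ofReal (Z * (Real.exp (-(1 / 2) * ∑ x, D x * v x ^ 2) *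
    Real.exp (∑ e, c e * e.1.elim a v * e.2.elim a v))) = 1

namespace FK

variable {V : Type} [Fintype V] (A : FK V)

/-- The field extended by the value `a` at the ghost. -/
def ext (v : V → ℝ) (i : Option V) : ℝ := i.elim A.a v

/-- The interaction along an edge. -/
def th (v : V → ℝ) (e : Option V × Option V) : ℝ := A.c e * A.ext v e.1 * A.ext v e.2

/-- The prefactor of the weight. -/
def base (v : V → ℝ) : ℝ := A.Z * Real.exp (-(1 / 2) * ∑ x, A.D x * v x ^ 2)

/-- The weight of an open edge. -/
def op (v : V → ℝ) (e : Option V × Option V) : ℝ := Real.exp (A.th v e) - Real.exp (-|A.th v e|)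

/-- The weight of a closed edge. -/
def cl (v : V → ℝ) (e : Option V × Option V) : ℝ := Real.exp (-|A.th v e|)

/-- The joint weight of a field and a configuration. -/
def W (v : V → ℝ) (ω : Finset (Option V × Option V)) : ℝ :=
  A.base v * ∏ e, if e ∈ ω then A.op v e else A.cl v e

/-- The density of the field. -/
def dens (v : V → ℝ) : ℝ := A.base v * Real.exp (∑ e, A.th v e)

lemma base_nonneg (v : V → ℝ) : 0 ≤ A.base v := mul_nonneg A.Z_nonneg (Real.exp_pos _).le

lemma op_nonneg (v : V → ℝ) (e : Option V × Option V) : 0 ≤ A.op v e :=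
  sub_nonneg.2 (Real.exp_le_exp.2 (neg_abs_le _))

lemma W_nonneg (v : V → ℝ) (ω : Finset (Option V × Option V)) : 0 ≤ A.W v ω :=
  mul_nonneg (A.base_nonneg v) (Finset.prod_nonneg fun e _ => by
    split_ifs
    · exact A.op_nonneg v e
    · exact (Real.exp_pos _).le)

lemma sum_W_mul (v : V → ℝ) (F : Finset (Option V × Option V) → ℝ) :
    ∑ ω, F ω * A.W v ω = A.base v * bern (A.op v) (A.cl v) F := by
  rw [bern, Finset.mul_sum]
  refine Finset.sum_congr rfl fun ω _ => ?_
  rw [W, mul_left_comm]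

lemma sum_W (v : V → ℝ) : ∑ ω, A.W v ω = A.dens v := by
  have := A.sum_W_mul v fun _ => 1
  simp only [one_mul] at this
  rw [this, bern_one, dens, Real.exp_sum]
  congr 1
  exact Finset.prod_congr rfl fun e _ => by simp [op, cl]

lemma measurable_ext (i : Option V) : Measurable fun v => A.ext v i := by
  cases i with
  | none => exact measurable_const
  | some x => exact measurable_pi_apply x

lemma measurable_th (e : Option V × Option V) : Measurable fun v => A.th v e :=
  ((A.measurable_ext e.1).const_mul _).mul (A.measurable_ext e.2)

lemma measurable_base : Measurable A.base := by unfold base; fun_prop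

lemma measurable_W (ω : Finset (Option V × Option V)) : Measurable fun v => A.W v ω := by
  refine A.measurable_base.mul (Finset.measurable_fun_prod _ fun e _ => ?_)
  have := A.measurable_th e
  split_ifs
  · unfold op; fun_prop
  · unfold cl; fun_prop

lemma measurable_dens : Measurable A.dens := by
  have : A.dens = fun v => ∑ ω, A.W v ω := funext fun v => (A.sum_W v).symm
  rw [this]
  exact Finset.measurable_fun_sum _ fun ω _ => A.measurable_W ω

/-- The joint law of the field and the edge configuration. -/
def μ : Measure ((V → ℝ) × Finset (Option V × Option V)) :=
  ∑ ω, ((volume : Measure (V → ℝ)).withDensity fun v => ENNReal.ofReal (A.W v ω)).map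
    fun v => (v, ω)

lemma lintegral_μ {f : (V → ℝ) × Finset (Option V × Option V) → ℝ≥0∞} (hf : Measurable f) :
    ∫⁻ q, f q ∂A.μ = ∑ ω, ∫⁻ v, ENNReal.ofReal (A.W v ω) * f (v, ω) := by
  rw [μ, lintegral_finsetSum_measure]
  refine Finset.sum_congr rfl fun ω _ => ?_
  rw [lintegral_map hf (by fun_prop), lintegral_withDensity_eq_lintegral_mul _
    (A.measurable_W ω).ennreal_ofReal (by fun_prop)]
  rfl

lemma map_fst_μ : A.μ.map Prod.fst = volume.withDensity fun v => ENNReal.ofReal (A.dens v) := by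
  refine Measure.ext_of_lintegral _ fun f hf => ?_
  rw [lintegral_map hf measurable_fst, A.lintegral_μ (by fun_prop),
    lintegral_withDensity_eq_lintegral_mul _ A.measurable_dens.ennreal_ofReal hf]
  refine (lintegral_finsetSum Finset.univ fun ω _ =>
    ((A.measurable_W ω).ennreal_ofReal).mul hf).symm.trans (lintegral_congr fun v => ?_)
  simp only [Pi.mul_apply]
  rw [← Finset.sum_mul, ← ENNReal.ofReal_sum_of_nonneg fun ω _ => A.W_nonneg v ω, sum_W]

instance : IsProbabilityMeasure A.μ := by
  have h : A.μ Set.univ = A.μ.map Prod.fst Set.univ := by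
    rw [Measure.map_apply measurable_fst MeasurableSet.univ]; rfl
  refine ⟨?_⟩
  rw [h, map_fst_μ, withDensity_apply _ MeasurableSet.univ, Measure.restrict_univ, ← A.mass]
  refine lintegral_congr fun v => ?_
  rw [dens, base, mul_assoc]
  rfl

/-- Changing signs on a set of vertices. -/
def flip (s : Set V) (v : V → ℝ) (x : V) : ℝ := if x ∈ s then - v x else v x

lemma measurePreserving_flip (s : Set V) :
    MeasurePreserving (flip s) (volume : Measure (V → ℝ)) volume := by
  refine volume_preserving_pi (f := fun x t => if x ∈ s then - t else t) fun x => ?_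
  by_cases h : x ∈ s
  · simpa [h] using Measure.measurePreserving_neg (volume : Measure ℝ)
  · simp only [h, if_false]
    exact MeasurePreserving.id _

/-- No edge of the configuration leaves `s`. -/
def Closed (ω : Finset (Option V × Option V)) (s : Set V) : Prop :=
  ∀ e ∈ ω, (e.1 ∈ some '' s ↔ e.2 ∈ some '' s)

lemma ext_flip (s : Set V) (v : V → ℝ) (i : Option V) :
    A.ext (flip s v) i = if i ∈ some '' s then - A.ext v i else A.ext v i := by
  cases i with
  | none => simp [ext]
  | some x => simp [ext, flip]

lemma W_flip {ω : Finset (Option V × Option V)} {s : Set V} (h : Closed ω s) (v : V → ℝ) :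
    A.W (flip s v) ω = A.W v ω := by
  have habs : ∀ e, |A.th (flip s v) e| = |A.th v e| := fun e => by
    simp only [th, ext_flip, abs_mul]
    split_ifs <;> simp
  have hth : ∀ e ∈ ω, A.th (flip s v) e = A.th v e := fun e he => by
    have := h e he
    simp only [th, ext_flip]
    by_cases h1 : e.1 ∈ some '' s
    · rw [if_pos h1, if_pos (this.1 h1)]; ring
    · rw [if_neg h1, if_neg fun h2 => h1 (this.2 h2)]
  have hb : A.base (flip s v) = A.base v := by
    simp only [base, flip]
    congr 3
    exact Finset.sum_congr rfl fun x _ => by split_ifs <;> simp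
  rw [W, W, hb]
  congr 1
  refine Finset.prod_congr rfl fun e _ => ?_
  split_ifs with he
  · simp only [op, hth e he]
  · simp only [cl, habs]

/-- Flipping the signs of the field on unions of clusters preserves the joint law. -/
lemma measurePreserving_flip_μ (S : Finset (Option V × Option V) → Set V)
    (hS : ∀ ω, Closed ω (S ω)) :
    MeasurePreserving (fun q : (V → ℝ) × Finset (Option V × Option V) => (flip (S q.2) q.1, q.2))
      A.μ A.μ := by
  have hm : Measurable fun q : (V → ℝ) × Finset (Option V × Option V) =>
      (flip (S q.2) q.1, q.2) := by
    refine measurable_from_prod_countable_left fun ω => ?_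
    exact ((measurePreserving_flip (S ω)).measurable).prodMk measurable_const
  refine ⟨hm, Measure.ext_of_lintegral _ fun f hf => ?_⟩
  rw [lintegral_map hf hm]
  refine (A.lintegral_μ (f := fun q => f (flip (S q.2) q.1, q.2)) (hf.comp hm)).trans ?_
  rw [A.lintegral_μ hf]
  refine Finset.sum_congr rfl fun ω _ => ?_
  have h1 := (measurePreserving_flip (S ω)).lintegral_comp
    (f := fun v => ENNReal.ofReal (A.W v ω) * f (v, ω))
    ((A.measurable_W ω).ennreal_ofReal.mul (by fun_prop))
  rw [← h1]
  exact lintegral_congr fun v => by rw [A.W_flip (hS ω)]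

/-- Almost surely, open edges have positive interaction. -/
lemma ae_pos : ∀ᵐ q ∂A.μ, ∀ e ∈ q.2, 0 < A.th q.1 e := by
  rw [ae_all_iff]
  intro e
  have hm : MeasurableSet {q : (V → ℝ) × Finset (Option V × Option V) |
      e ∈ q.2 ∧ A.th q.1 e ≤ 0} :=
    (measurable_snd (measurableSet_mem_finset e)).inter
      (measurableSet_le ((A.measurable_th e).comp measurable_fst) measurable_const)
  have h0 : A.μ {q | e ∈ q.2 ∧ A.th q.1 e ≤ 0} = 0 := by
    rw [← lintegral_indicator_one hm, A.lintegral_μ (measurable_one.indicator hm)]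
    refine Finset.sum_eq_zero fun ω _ => ?_
    rw [← lintegral_zero (μ := (volume : Measure (V → ℝ)))]
    refine lintegral_congr fun v => ?_
    by_cases h : e ∈ ω ∧ A.th v e ≤ 0
    · have : A.W v ω = 0 := by
        rw [W, Finset.prod_eq_zero (Finset.mem_univ e), mul_zero]
        rw [if_pos h.1, op, abs_of_nonpos h.2, neg_neg, sub_self]
      rw [this, ENNReal.ofReal_zero, zero_mul]
    · rw [Set.indicator_of_notMem (by simpa using h), mul_zero]
  rw [measure_eq_zero_iff_ae_notMem] at h0
  filter_upwards [h0] with q hq he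
  exact not_le.1 fun h => hq ⟨he, h⟩

end FK

/-! ### A one dimensional integration by parts and a Fubini argument -/

lemma tendsto_exp_quadratic {P : ℝ} (hP : 0 < P) (b : ℝ) :
    Tendsto (fun t : ℝ => Real.exp (-(1 / 2) * P * t ^ 2 + b * t)) atTop (𝓝 0) := by
  refine Real.tendsto_exp_atBot.comp ?_
  have h1 : Tendsto (fun t : ℝ => b + -(1 / 2 * P) * t) atTop atBot :=
    tendsto_atBot_add_const_left _ _
      (tendsto_id.const_mul_atTop_of_neg (by linarith))
  refine (tendsto_id.atTop_mul_atBot₀ h1).congr fun t => ?_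
  simp only [id]; ring

lemma integral_sign_gaussian {P : ℝ} (hP : 0 < P) (b J : ℝ) :
    ∫ t : ℝ, (P * t - b + J * Real.sign t) *
      Real.exp (-(1 / 2) * P * t ^ 2 + b * t - J * |t|) = 0 := by
  by_cases hi : Integrable fun t : ℝ => (P * t - b + J * Real.sign t) *
      Real.exp (-(1 / 2) * P * t ^ 2 + b * t - J * |t|)
  swap
  · exact integral_undef hi
  rw [← integral_add_compl measurableSet_Ioi hi (s := Set.Ioi 0), Set.compl_Ioi,
    integral_Iic_eq_integral_Iio]
  have hd : ∀ b' t : ℝ, HasDerivAt (fun t => -Real.exp (-(1 / 2) * P * t ^ 2 + b' * t))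
      ((P * t - b') * Real.exp (-(1 / 2) * P * t ^ 2 + b' * t)) t := by
    intro b' t
    have h1 : HasDerivAt (fun t : ℝ => -(1 / 2) * P * t ^ 2 + b' * t)
        (-(1 / 2) * P * (2 * t) + b') t := by
      have h2 := (hasDerivAt_pow 2 t).const_mul (-(1 / 2) * P)
      have h3 := (hasDerivAt_id t).const_mul b'
      exact (h2.add h3).congr_deriv (by simp)
    exact h1.exp.neg.congr_deriv (by ring)
  have e1 : Set.EqOn (fun t : ℝ => (P * t - b + J * Real.sign t) *
      Real.exp (-(1 / 2) * P * t ^ 2 + b * t - J * |t|))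
      (fun t => (P * t - (b - J)) * Real.exp (-(1 / 2) * P * t ^ 2 + (b - J) * t)) (Set.Ioi 0) := by
    intro t ht
    have ht : 0 < t := ht
    simp only [Real.sign_of_pos ht, abs_of_pos ht]
    congr 1
    · ring
    · congr 1; ring
  have e2 : Set.EqOn (fun t : ℝ => (P * t - b + J * Real.sign t) *
      Real.exp (-(1 / 2) * P * t ^ 2 + b * t - J * |t|))
      (fun t => (P * t - (b + J)) * Real.exp (-(1 / 2) * P * t ^ 2 + (b + J) * t)) (Set.Iio 0) := by
    intro t ht
    have ht : t < 0 := ht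
    simp only [Real.sign_of_neg ht, abs_of_neg ht]
    congr 1
    · ring
    · congr 1; ring
  have i1 := (hi.integrableOn (s := Set.Ioi 0)).congr_fun e1 measurableSet_Ioi
  have i2 := (hi.integrableOn (s := Set.Iio 0)).congr_fun e2 measurableSet_Iio
  rw [setIntegral_congr_fun measurableSet_Ioi e1, setIntegral_congr_fun measurableSet_Iio e2,
    ← integral_Iic_eq_integral_Iio,
    integral_Ioi_of_hasDerivAt_of_tendsto' (fun t _ => hd _ t) i1
      (by simpa using (tendsto_exp_quadratic hP (b - J)).neg),
    integral_Iic_of_hasDerivAt_of_tendsto' (fun t _ => hd _ t) (m := 0)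
      (by rw [IntegrableOn, ← restrict_Iio_eq_restrict_Iic]; exact i2) ?_]
  · simp
  · have := ((tendsto_exp_quadratic hP (-(b + J))).comp tendsto_neg_atBot_atTop).neg
    refine (neg_zero (G := ℝ) ▸ this).congr fun t => ?_
    simp only [Function.comp]
    congr 2
    ring

/-- An integrable function all of whose integrals in one coordinate vanish has zero integral. -/
lemma integral_eq_zero_of_update {V : Type} [Fintype V] (x : V) {f : (V → ℝ) → ℝ}
    (hf : Integrable f) (h : ∀ v, ∫ t, f (Function.update v x t) = 0) : ∫ v, f v = 0 := by
  have e := volume_preserving_piEquivPiSubtypeProd (fun _ : V => ℝ) (fun i => i = x)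
  have e' := e.symm
  rw [← e'.integral_comp (MeasurableEquiv.measurableEmbedding _)]
  have hf' := (e'.integrable_comp_emb (MeasurableEquiv.measurableEmbedding _)).2 hf
  rw [Measure.volume_eq_prod] at hf' ⊢
  refine (integral_prod_symm _ hf').trans ?_
  refine integral_eq_zero_of_ae (Eventually.of_forall fun w => ?_)
  have u : MeasurePreserving (MeasurableEquiv.funUnique {i : V // i = x} ℝ).symm
      volume volume := by
    convert (volume_preserving_funUnique {i : V // i = x} ℝ).symm
  have key := u.integral_comp (MeasurableEquiv.measurableEmbedding _) fun z =>
    (f ∘ (MeasurableEquiv.piEquivPiSubtypeProd (fun _ : V => ℝ) fun i => i = x).symm) (z, w)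
  suffices hs : ∫ t : ℝ, (f ∘ (MeasurableEquiv.piEquivPiSubtypeProd (fun _ : V => ℝ)
      fun i => i = x).symm) ((MeasurableEquiv.funUnique {i : V // i = x} ℝ).symm t, w) = 0 by
    rw [hs] at key
    simp only [Pi.zero_apply]
    convert key.symm
  have := h fun i => if hi : i = x then 0 else w ⟨i, hi⟩
  rw [← this]
  refine integral_congr_ae (Eventually.of_forall fun t => ?_)
  simp only [Function.comp]
  congr 1
  funext i
  by_cases hi : i = x
  · subst hi
    simp [MeasurableEquiv.piEquivPiSubtypeProd, Equiv.piEquivPiSubtypeProd, MeasurableEquiv.funUnique]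
  · simp [MeasurableEquiv.piEquivPiSubtypeProd, Equiv.piEquivPiSubtypeProd, hi]

set_option linter.unusedSectionVars false

namespace FK

variable {V : Type} [Fintype V] {ω : Finset (Option V × Option V)} {i j k : Option V}

/-- Two vertices are joined by an open edge. -/
def Adj (ω : Finset (Option V × Option V)) (i j : Option V) : Prop := (i, j) ∈ ω ∨ (j, i) ∈ ω

/-- Two vertices are joined by a path of open edges. -/
def Cn (ω : Finset (Option V × Option V)) (i j : Option V) : Prop :=
  Relation.ReflTransGen (Adj ω) i j

lemma Adj.symm (h : Adj ω i j) : Adj ω j i := Or.symm h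

lemma Cn.symm (h : Cn ω i j) : Cn ω j i := by
  induction h with
  | refl => exact Relation.ReflTransGen.refl
  | tail _ hab ih => exact Relation.ReflTransGen.head hab.symm ih

lemma Cn.trans (h : Cn ω i j) (h' : Cn ω j k) : Cn ω i k := Relation.ReflTransGen.trans h h'

lemma Cn.refl : Cn ω i i := Relation.ReflTransGen.refl

lemma Cn.mono {ω' : Finset (Option V × Option V)} (hω : ω ⊆ ω') (h : Cn ω i j) : Cn ω' i j := by
  induction h with
  | refl => exact Relation.ReflTransGen.refl
  | tail _ hab ih => exact ih.tail (hab.imp (fun h => hω h) fun h => hω h)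

lemma Adj.cn (h : Adj ω i j) : Cn ω i j := Relation.ReflTransGen.single h

lemma closed_of {s : Set V} (h : ∀ i j, Adj ω i j → i ∈ some '' s → j ∈ some '' s) :
    Closed ω s := fun e he =>
  ⟨h e.1 e.2 (Or.inl he), h e.2 e.1 (Or.inr he)⟩

/-- The cluster of `x` if it does not contain the ghost, and the empty set otherwise. -/
def free (x : V) (ω : Finset (Option V × Option V)) : Set V :=
  {y | Cn ω (some x) (some y) ∧ ¬ Cn ω (some x) none}

lemma closed_free (x : V) (ω : Finset (Option V × Option V)) : Closed ω (free x ω) := by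
  refine closed_of fun i j hij hi => ?_
  obtain ⟨y, ⟨hy, hn⟩, rfl⟩ := hi
  have hj := hy.trans hij.cn
  cases j with
  | none => exact absurd hj hn
  | some z => exact ⟨z, ⟨hj, hn⟩, rfl⟩

/-- The vertices which are not connected to the ghost. -/
def allFree (ω : Finset (Option V × Option V)) : Set V := {y | ¬ Cn ω (some y) none}

lemma closed_allFree (ω : Finset (Option V × Option V)) : Closed ω (allFree ω) := by
  refine closed_of fun i j hij hi => ?_
  obtain ⟨y, hy, rfl⟩ := hi
  cases j with
  | none => exact absurd hij.cn hy
  | some z => exact ⟨z, fun h => hy (hij.cn.trans h), rfl⟩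

/-- No vertex of `s` is connected to the ghost. -/
def No (s : Finset V) (ω : Finset (Option V × Option V)) : Prop :=
  ∀ x ∈ s, ¬ Cn ω (some x) none

variable (A : FK V)

lemma ae_sign : ∀ᵐ q ∂A.μ, ∀ i j, Cn q.2 i j →
    Real.sign (A.ext q.1 i) = Real.sign (A.ext q.1 j) := by
  filter_upwards [A.ae_pos] with q hq i j h
  have key : ∀ e ∈ q.2, Real.sign (A.ext q.1 e.1) = Real.sign (A.ext q.1 e.2) := by
    intro e he
    have h1 := hq e he
    rw [th, mul_assoc] at h1
    have h2 : 0 < A.ext q.1 e.1 * A.ext q.1 e.2 :=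
      pos_of_mul_pos_right h1 (A.c_nonneg e)
    rcases pos_and_pos_or_neg_and_neg_of_mul_pos h2 with ⟨h3, h4⟩ | ⟨h3, h4⟩
    · rw [Real.sign_of_pos h3, Real.sign_of_pos h4]
    · rw [Real.sign_of_neg h3, Real.sign_of_neg h4]
  induction h with
  | refl => rfl
  | tail _ hab ih =>
    rw [ih]
    rcases hab with hab | hab
    · exact key _ hab
    · exact (key _ hab).symm

lemma measurable_sign : Measurable Real.sign :=
  Measurable.ite measurableSet_Iio measurable_const
    (Measurable.ite measurableSet_Ioi measurable_const measurable_const)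

lemma abs_sign_le (t : ℝ) : |Real.sign t| ≤ 1 := by
  rcases Real.sign_apply_eq t with h | h | h <;> rw [h] <;> norm_num

lemma measurableSet_snd (p : Finset (Option V × Option V) → Prop) :
    MeasurableSet {q : (V → ℝ) × Finset (Option V × Option V) | p q.2} :=
  measurable_snd (MeasurableSet.of_discrete (s := {ω | p ω}))

lemma measurable_eval (x : V) :
    Measurable fun q : (V → ℝ) × Finset (Option V × Option V) => q.1 x :=
  (measurable_pi_apply x).comp measurable_fst

lemma measurable_sign_eval (x : V) :
    Measurable fun q : (V → ℝ) × Finset (Option V × Option V) => Real.sign (q.1 x) :=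
  measurable_sign.comp (measurable_eval x)

lemma integral_odd {S : Finset (Option V × Option V) → Set V} (hS : ∀ ω, Closed ω (S ω))
    {f : (V → ℝ) × Finset (Option V × Option V) → ℝ} (hf : Measurable f)
    (h : ∀ q, f (flip (S q.2) q.1, q.2) = - f q) : ∫ q, f q ∂A.μ = 0 := by
  have hp := A.measurePreserving_flip_μ S hS
  have h1 : ∫ q, f q ∂A.μ = ∫ q, f (flip (S q.2) q.1, q.2) ∂A.μ := by
    conv_lhs => rw [← hp.map_eq]
    exact integral_map hp.measurable.aemeasurable hf.aestronglyMeasurable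
  simp_rw [h, integral_neg] at h1
  linarith

lemma flip_of_mem {s : Set V} {v : V → ℝ} {x : V} (h : x ∈ s) : flip s v x = - v x := if_pos h

lemma flip_of_notMem {s : Set V} {v : V → ℝ} {x : V} (h : x ∉ s) : flip s v x = v x := if_neg h

lemma mem_free_self {x : V} (h : ¬ Cn ω (some x) none) : x ∈ free x ω := ⟨Cn.refl, h⟩

/-- The probability of being connected to the ghost is the mean of the sign. -/
lemma real_cn (ha : 0 < A.a) (x : V) :
    A.μ.real {q | Cn q.2 (some x) none} = ∫ q, Real.sign (q.1 x) ∂A.μ := by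
  have hm := measurableSet_snd fun ω => Cn ω (some x) none
  have hi : Integrable (fun q : (V → ℝ) × Finset (Option V × Option V) => Real.sign (q.1 x)) A.μ :=
    Integrable.of_bound (measurable_sign_eval x).aestronglyMeasurable 1
      (Eventually.of_forall fun q => abs_sign_le _)
  rw [← integral_add_compl hm hi]
  have h1 : ∫ q in {q | Cn q.2 (some x) none}, Real.sign (q.1 x) ∂A.μ =
      ∫ q in {q | Cn q.2 (some x) none}, (1 : ℝ) ∂A.μ := by
    refine setIntegral_congr_ae hm ?_
    filter_upwards [A.ae_sign] with q hq h
    rw [show q.1 x = A.ext q.1 (some x) from rfl, hq _ _ h]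
    exact Real.sign_of_pos ha
  have h2 : ∫ q in {q | Cn q.2 (some x) none}ᶜ, Real.sign (q.1 x) ∂A.μ = 0 := by
    rw [← integral_indicator hm.compl]
    refine A.integral_odd (closed_free x) ((measurable_sign_eval x).indicator hm.compl)
      fun q => ?_
    by_cases h : Cn q.2 (some x) none
    · rw [Set.indicator_of_notMem (by simpa using h), Set.indicator_of_notMem (by simpa using h),
        neg_zero]
    · rw [Set.indicator_of_mem (by simpa using h), Set.indicator_of_mem (by simpa using h)]
      simp only [flip_of_mem (mem_free_self h), Real.sign_neg]
  rw [h1, h2, setIntegral_const, smul_eq_mul, mul_one, add_zero]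

/-- If a set avoids the cluster of the ghost, any nonnegative combination of the field on it is
nonpositive with conditional probability at least one half. -/
lemma measure_no_le (s : Finset V) (m : V → ℝ) (hm : ∀ x ∉ s, m x = 0) :
    A.μ.real {q | No s q.2} ≤ 2 * A.μ.real {q | ∑ x, m x * q.1 x ≤ 0} := by
  have hsum : Measurable fun q : (V → ℝ) × Finset (Option V × Option V) => ∑ x, m x * q.1 x :=
    Finset.measurable_fun_sum _ fun x _ => (measurable_eval x).const_mul _
  set N : Set ((V → ℝ) × Finset (Option V × Option V)) := {q | No s q.2}
  have hN : MeasurableSet N := measurableSet_snd fun ω => No s ω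
  set L : Set ((V → ℝ) × Finset (Option V × Option V)) := {q | ∑ x, m x * q.1 x ≤ 0}
  set L' : Set ((V → ℝ) × Finset (Option V × Option V)) := {q | 0 ≤ ∑ x, m x * q.1 x}
  have hL : MeasurableSet L := measurableSet_le hsum measurable_const
  have hp := A.measurePreserving_flip_μ _ closed_allFree
  have hflip : ∀ q ∈ N, ∑ x, m x * flip (allFree q.2) q.1 x = - ∑ x, m x * q.1 x := by
    intro q hq
    rw [← Finset.sum_neg_distrib]
    refine Finset.sum_congr rfl fun x _ => ?_
    by_cases hx : x ∈ s
    · rw [flip_of_mem (show x ∈ allFree q.2 from hq x hx)]; ring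
    · rw [hm x hx]; ring
  have h1 : A.μ.real (N ∩ L') = A.μ.real (N ∩ L) := by
    rw [measureReal_def, measureReal_def, ← hp.measure_preimage (hN.inter hL).nullMeasurableSet]
    congr 2
    ext q
    simp only [Set.mem_inter_iff, Set.mem_preimage]
    refine and_congr_right fun hq => ?_
    show 0 ≤ ∑ x, m x * q.1 x ↔ ∑ x, m x * flip (allFree q.2) q.1 x ≤ 0
    rw [hflip q hq, neg_nonpos]
  have h2 : A.μ.real N ≤ A.μ.real (N ∩ L) + A.μ.real (N ∩ L') := by
    refine (measureReal_mono fun q hq => ?_).trans (measureReal_union_le _ _)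
    rcases le_total (∑ x, m x * q.1 x) 0 with h | h
    · exact Or.inl ⟨hq, h⟩
    · exact Or.inr ⟨hq, h⟩
  have h3 : A.μ.real (N ∩ L) ≤ A.μ.real L := measureReal_mono Set.inter_subset_right
  linarith

/-- The mean of the field at `x` times the sign at `y`, on the event that no vertex of `s` is
connected to the ghost. -/
def G (s : Finset V) (x y : V) : ℝ :=
  ∫ q, (if No s q.2 then q.1 x * Real.sign (q.1 y) else 0) ∂A.μ

lemma measurable_ite_snd (p : Finset (Option V × Option V) → Prop) [DecidablePred p]
    {f : (V → ℝ) × Finset (Option V × Option V) → ℝ} (hf : Measurable f) :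
    Measurable fun q => if p q.2 then f q else 0 :=
  Measurable.ite (measurableSet_snd p) hf measurable_const

/-- The two-point function off the cluster of the ghost. -/
lemma integral_abs_cn (hinteg : ∀ x, Integrable (fun q => q.1 x) A.μ) (x y : V) :
    ∫ q, (if Cn q.2 (some x) (some y) ∧ ¬ Cn q.2 (some x) none then |q.1 x| else 0) ∂A.μ =
      A.G {x} x y := by
  have hmeas : Measurable fun q : (V → ℝ) × Finset (Option V × Option V) =>
    q.1 x * Real.sign (q.1 y) := (measurable_eval x).mul (measurable_sign_eval y)
  have hI : Integrable (fun q : (V → ℝ) × Finset (Option V × Option V) =>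
      q.1 x * Real.sign (q.1 y)) A.μ := by
    refine (hinteg x).mono hmeas.aestronglyMeasurable (Eventually.of_forall fun q => ?_)
    rw [Real.norm_eq_abs, Real.norm_eq_abs, abs_mul]
    exact mul_le_of_le_one_right (abs_nonneg _) (abs_sign_le _)
  have hI2 : ∀ (p : Finset (Option V × Option V) → Prop) [DecidablePred p], Integrable
      (fun q : (V → ℝ) × Finset (Option V × Option V) =>
        if p q.2 then q.1 x * Real.sign (q.1 y) else 0) A.μ := fun p _ => by
    refine hI.mono (measurable_ite_snd p hmeas).aestronglyMeasurable
      (Eventually.of_forall fun q => ?_)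
    split_ifs
    · exact le_rfl
    · rw [norm_zero]; exact norm_nonneg _
  have h1 : A.G {x} x y =
      ∫ q, (if Cn q.2 (some x) (some y) ∧ ¬ Cn q.2 (some x) none then
        q.1 x * Real.sign (q.1 y) else 0) ∂A.μ +
      ∫ q, (if ¬ Cn q.2 (some x) (some y) ∧ ¬ Cn q.2 (some x) none then
        q.1 x * Real.sign (q.1 y) else 0) ∂A.μ := by
    rw [← integral_add (hI2 fun ω => Cn ω (some x) (some y) ∧ ¬ Cn ω (some x) none)
      (hI2 fun ω => ¬ Cn ω (some x) (some y) ∧ ¬ Cn ω (some x) none), G]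
    refine integral_congr_ae (Eventually.of_forall fun q => ?_)
    have : No {x} q.2 ↔ ¬ Cn q.2 (some x) none := by simp [No]
    simp only [this]
    by_cases h1 : Cn q.2 (some x) none <;> by_cases h2 : Cn q.2 (some x) (some y) <;> simp [h1, h2]
  have h2 : ∫ q, (if ¬ Cn q.2 (some x) (some y) ∧ ¬ Cn q.2 (some x) none then
        q.1 x * Real.sign (q.1 y) else 0) ∂A.μ = 0 := by
    refine A.integral_odd (closed_free x) (measurable_ite_snd
      (fun ω => ¬ Cn ω (some x) (some y) ∧ ¬ Cn ω (some x) none) hmeas) fun q => ?_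
    by_cases h : ¬ Cn q.2 (some x) (some y) ∧ ¬ Cn q.2 (some x) none
    · simp only [if_pos h, flip_of_mem (mem_free_self h.2),
        flip_of_notMem (show y ∉ free x q.2 from fun h' => h.1 h'.1)]
      ring
    · simp only [if_neg h, neg_zero]
  rw [h1, h2, add_zero]
  refine integral_congr_ae ?_
  filter_upwards [A.ae_sign] with q hq
  by_cases h : Cn q.2 (some x) (some y) ∧ ¬ Cn q.2 (some x) none
  · rw [if_pos h, if_pos h, show q.1 y = A.ext q.1 (some y) from rfl, ← hq _ _ h.1]
    show |q.1 x| = q.1 x * Real.sign (q.1 x)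
    rcases lt_trichotomy (q.1 x) 0 with h | h | h
    · rw [Real.sign_of_neg h, abs_of_neg h]; ring
    · rw [h]; simp
    · rw [Real.sign_of_pos h, abs_of_pos h]; ring
  · rw [if_neg h, if_neg h]

end FK

namespace FK

variable {V : Type} [Fintype V] {ω : Finset (Option V × Option V)} {e : Option V × Option V}

/-- The cluster of the ghost. -/
def ghost (ω : Finset (Option V × Option V)) : Finset (Option V) :=
  Finset.univ.filter fun i => Cn ω none i

lemma mem_ghost {i : Option V} : i ∈ ghost ω ↔ Cn ω none i := by simp [ghost]

lemma ghost_mono {ω' : Finset (Option V × Option V)} (h : ω ⊆ ω') : ghost ω ⊆ ghost ω' :=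
  fun _ hi => mem_ghost.2 ((mem_ghost.1 hi).mono h)

lemma mem_ghost_iff (he : e ∈ ω) : e.1 ∈ ghost ω ↔ e.2 ∈ ghost ω := by
  have h : Adj ω e.1 e.2 := Or.inl he
  exact ⟨fun h1 => mem_ghost.2 ((mem_ghost.1 h1).trans h.cn),
    fun h1 => mem_ghost.2 ((mem_ghost.1 h1).trans h.symm.cn)⟩

lemma ghost_insert (h : e.1 ∉ ghost ω ∧ e.2 ∉ ghost ω) : ghost (insert e ω) = ghost ω := by
  refine Finset.Subset.antisymm (fun i hi => ?_) (ghost_mono (Finset.subset_insert _ _))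
  rw [mem_ghost] at hi ⊢
  induction hi with
  | refl => exact Cn.refl
  | @tail b c _ hbc ih =>
    have : Adj ω b c := by
      rcases hbc with hbc | hbc
      · rcases Finset.mem_insert.1 hbc with h1 | h1
        · exact absurd (mem_ghost.2 ih) (by rw [← h1] at h; exact h.1)
        · exact Or.inl h1
      · rcases Finset.mem_insert.1 hbc with h1 | h1
        · exact absurd (mem_ghost.2 ih) (by rw [← h1] at h; exact h.2)
        · exact Or.inr h1
    exact ih.tail this

lemma ghost_insert_eq_iff {K : Finset (Option V)} (h : e.1 ∉ K ∧ e.2 ∉ K) :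
    ghost (insert e ω) = K ↔ ghost ω = K := by
  constructor
  · intro h1
    have h2 := ghost_mono (Finset.subset_insert e ω)
    rw [← ghost_insert ⟨fun h3 => h.1 (h1 ▸ h2 h3), fun h3 => h.2 (h1 ▸ h2 h3)⟩, h1]
  · rintro rfl
    exact ghost_insert h

variable (A : FK V)

/-- The total conductance between `x` and a vertex. -/
def s (x : V) (i : Option V) : ℝ := A.c (some x, i) + A.c (i, some x)

lemma s_nonneg (x : V) (i : Option V) : 0 ≤ A.s x i := add_nonneg (A.c_nonneg _) (A.c_nonneg _)

/-- The drift of the field at `x` given that the cluster of the ghost is `K`. -/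
def drift (K : Finset (Option V)) (x : V) (v : V → ℝ) : ℝ :=
  ∑ i, if i ∈ K then 0 else A.s x i * A.ext v i

/-- The boundary term at `x` given that the cluster of the ghost is `K`. -/
def bdry (K : Finset (Option V)) (x : V) (v : V → ℝ) : ℝ :=
  ∑ i, if i ∈ K then A.s x i * |A.ext v i| else 0

/-- The coefficient of the field at `x` in the interaction along an edge. -/
def slope (x : V) (v : V → ℝ) (e : Option V × Option V) : ℝ :=
  A.c e * ((if e.1 = some x then A.ext v e.2 else 0) + (if e.2 = some x then A.ext v e.1 else 0))

/-- The part of the interaction along an edge not depending on the field at `x`. -/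
def rest (x : V) (v : V → ℝ) (e : Option V × Option V) : ℝ :=
  if e.1 = some x ∨ e.2 = some x then 0 else A.th v e

lemma ext_update_self (x : V) (v : V → ℝ) (t : ℝ) :
    A.ext (Function.update v x t) (some x) = t := by simp [ext]

lemma ext_update_of_ne {x : V} (v : V → ℝ) (t : ℝ) {i : Option V} (h : i ≠ some x) :
    A.ext (Function.update v x t) i = A.ext v i := by
  cases i with
  | none => rfl
  | some y =>
    have : y ≠ x := fun h' => h (by rw [h'])
    simp [ext, this]

lemma th_update (x : V) (v : V → ℝ) (t : ℝ) (e : Option V × Option V) :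
    A.th (Function.update v x t) e = t * A.slope x v e + A.rest x v e := by
  obtain ⟨i, j⟩ := e
  by_cases hi : i = some x <;> by_cases hj : j = some x
  · subst hi; subst hj
    simp [th, slope, rest, A.c_diag]
  · subst hi
    simp only [th, slope, rest, hj, A.ext_update_self, A.ext_update_of_ne v t hj, if_true, if_false,
      true_or]
    ring
  · subst hj
    simp only [th, slope, rest, hi, A.ext_update_self, A.ext_update_of_ne v t hi, if_true, if_false,
      or_true]
    ring
  · simp only [th, slope, rest, hi, hj, A.ext_update_of_ne v t hi, A.ext_update_of_ne v t hj,
      if_false, or_self]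
    ring

lemma abs_slope (x : V) (v : V → ℝ) (e : Option V × Option V) :
    |A.slope x v e| = A.c e * ((if e.1 = some x then |A.ext v e.2| else 0) +
      (if e.2 = some x then |A.ext v e.1| else 0)) := by
  obtain ⟨i, j⟩ := e
  simp only [slope, abs_mul, abs_of_nonneg (A.c_nonneg _)]
  by_cases hi : i = some x <;> by_cases hj : j = some x
  · subst hi; subst hj
    simp [A.c_diag]
  · simp [hi, hj]
  · simp [hi, hj]
  · simp [hi, hj]

lemma abs_th_update (x : V) (v : V → ℝ) (t : ℝ) (e : Option V × Option V) :
    |A.th (Function.update v x t) e| = |t| * |A.slope x v e| + |A.rest x v e| := by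
  rw [th_update]
  by_cases h : e.1 = some x ∨ e.2 = some x
  · simp [rest, h, abs_mul]
  · have : A.slope x v e = 0 := by
      rw [not_or] at h
      simp [slope, h.1, h.2]
    simp [this]

/-- The exponent contributed by an edge given that the cluster of the ghost is `K`. -/
def expo (K : Finset (Option V)) (v : V → ℝ) (e : Option V × Option V) : ℝ :=
  if e.1 ∈ K then if e.2 ∈ K then 0 else -|A.th v e| else if e.2 ∈ K then -|A.th v e| else A.th v e

/-- The weight inside the cluster of the ghost. -/
def inner (K : Finset (Option V)) (v : V → ℝ) : ℝ :=
  bern (fun e => if e.1 ∈ K ∧ e.2 ∈ K then A.op v e else 0)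
    (fun e => if e.1 ∈ K ∧ e.2 ∈ K then A.cl v e else 1) fun ω => if ghost ω = K then 1 else 0

lemma sum_ghost (K : Finset (Option V)) (v : V → ℝ) :
    ∑ ω, (if ghost ω = K then 1 else 0) * A.W v ω =
      A.base v * Real.exp (∑ e, A.expo K v e) * A.inner K v := by
  rw [sum_W_mul, mul_assoc, inner, Real.exp_sum, ← bern_smul]
  congr 1
  refine bern_congr _ _ _ _ _ fun e ω heω => ?_
  have hthe : Real.exp (A.th v e) = A.cl v e + A.op v e := by simp [op, cl]
  by_cases h1 : e.1 ∈ K <;> by_cases h2 : e.2 ∈ K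
  · simp [expo, h1, h2]
  · have : ghost (insert e ω) ≠ K := by
      intro h
      have := mem_ghost_iff (Finset.mem_insert_self e ω)
      rw [h] at this
      exact h2 (this.1 h1)
    simp [expo, h1, h2, this, cl]
  · have : ghost (insert e ω) ≠ K := by
      intro h
      have := mem_ghost_iff (Finset.mem_insert_self e ω)
      rw [h] at this
      exact h1 (this.2 h2)
    simp [expo, h1, h2, this, cl]
  · simp only [ghost_insert_eq_iff (ω := ω) ⟨h1, h2⟩, expo, h1, h2, if_false, and_self, hthe]
    ring

lemma inner_update {K : Finset (Option V)} {x : V} (hx : some x ∉ K) (v : V → ℝ) (t : ℝ) :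
    A.inner K (Function.update v x t) = A.inner K v := by
  have h : ∀ e : Option V × Option V, e.1 ∈ K ∧ e.2 ∈ K →
      A.th (Function.update v x t) e = A.th v e := fun e he => by
    rw [th, th, A.ext_update_of_ne v t (fun h => hx (h ▸ he.1)),
      A.ext_update_of_ne v t (fun h => hx (h ▸ he.2))]
  rw [inner, inner]
  congr 1
  · funext e
    split_ifs with he
    · rw [op, op, h e he]
    · rfl
  · funext e
    split_ifs with he
    · rw [cl, cl, h e he]
    · rfl

lemma sum_slope (K : Finset (Option V)) {x : V} (hx : some x ∉ K) (v : V → ℝ) :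
    (∑ e : Option V × Option V, if e.1 ∈ K ∨ e.2 ∈ K then 0 else A.slope x v e) =
      A.drift K x v := by
  have h : ∀ e : Option V × Option V, (if e.1 ∈ K ∨ e.2 ∈ K then 0 else A.slope x v e) =
      (if e.1 = some x then (if e.2 ∈ K then 0 else A.c (some x, e.2) * A.ext v e.2) else 0) +
      (if e.2 = some x then (if e.1 ∈ K then 0 else A.c (e.1, some x) * A.ext v e.1) else 0) := by
    rintro ⟨i, j⟩
    simp only [slope]
    by_cases hi : i = some x <;> by_cases hj : j = some x <;> by_cases hi' : i ∈ K <;>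
      by_cases hj' : j ∈ K <;> simp_all
    ring
  rw [Finset.sum_congr rfl fun e _ => h e, Finset.sum_add_distrib, Fintype.sum_prod_type,
    Fintype.sum_prod_type, Finset.sum_comm (f := fun i j => if (i, j).1 = some x then
      (if (i, j).2 ∈ K then 0 else A.c (some x, (i, j).2) * A.ext v (i, j).2) else 0)]
  simp only [Finset.sum_ite_eq', Finset.mem_univ, if_true, drift, s]
  rw [← Finset.sum_add_distrib]
  exact Finset.sum_congr rfl fun i _ => by split_ifs <;> ring

lemma sum_abs_slope (K : Finset (Option V)) {x : V} (hx : some x ∉ K) (v : V → ℝ) :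
    (∑ e : Option V × Option V, if e.1 ∈ K ∨ e.2 ∈ K then |A.slope x v e| else 0) =
      A.bdry K x v := by
  have h : ∀ e : Option V × Option V, (if e.1 ∈ K ∨ e.2 ∈ K then |A.slope x v e| else 0) =
      (if e.1 = some x then (if e.2 ∈ K then A.c (some x, e.2) * |A.ext v e.2| else 0) else 0) +
      (if e.2 = some x then (if e.1 ∈ K then A.c (e.1, some x) * |A.ext v e.1| else 0) else 0) := by
    rintro ⟨i, j⟩
    simp only [abs_slope]
    by_cases hi : i = some x <;> by_cases hj : j = some x <;> by_cases hi' : i ∈ K <;>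
      by_cases hj' : j ∈ K <;> simp_all
  rw [Finset.sum_congr rfl fun e _ => h e, Finset.sum_add_distrib, Fintype.sum_prod_type,
    Fintype.sum_prod_type, Finset.sum_comm (f := fun i j => if (i, j).1 = some x then
      (if (i, j).2 ∈ K then A.c (some x, (i, j).2) * |A.ext v (i, j).2| else 0) else 0)]
  simp only [Finset.sum_ite_eq', Finset.mem_univ, if_true, bdry, s]
  rw [← Finset.sum_add_distrib]
  exact Finset.sum_congr rfl fun i _ => by split_ifs <;> ring

lemma sum_expo_update {K : Finset (Option V)} {x : V} (hx : some x ∉ K) (v : V → ℝ) :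
    ∃ r, ∀ t, ∑ e, A.expo K (Function.update v x t) e =
      A.drift K x v * t - A.bdry K x v * |t| + r := by
  refine ⟨∑ e : Option V × Option V, if e.1 ∈ K then if e.2 ∈ K then 0 else -|A.rest x v e| else
    if e.2 ∈ K then -|A.rest x v e| else A.rest x v e, fun t => ?_⟩
  rw [← A.sum_slope K hx, ← A.sum_abs_slope K hx, Finset.sum_mul, Finset.sum_mul,
    ← Finset.sum_sub_distrib, ← Finset.sum_add_distrib]
  refine Finset.sum_congr rfl fun e _ => ?_
  simp only [expo, abs_th_update]
  rw [th_update]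
  by_cases h1 : e.1 ∈ K <;> by_cases h2 : e.2 ∈ K
  · have : A.slope x v e = 0 := by
      have h3 : e.1 ≠ some x := fun h => hx (h ▸ h1)
      have h4 : e.2 ≠ some x := fun h => hx (h ▸ h2)
      simp [slope, h3, h4]
    simp [h1, h2, this]
  · simp [h1, h2]; ring
  · simp [h1, h2]; ring
  · simp [h1, h2]; ring

lemma drift_update {K : Finset (Option V)} {x : V} (v : V → ℝ) (t : ℝ) :
    A.drift K x (Function.update v x t) = A.drift K x v := by
  refine Finset.sum_congr rfl fun i _ => ?_
  by_cases hi : i = some x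
  · subst hi; simp [s, A.c_diag]
  · rw [A.ext_update_of_ne v t hi]

lemma bdry_update {K : Finset (Option V)} {x : V} (v : V → ℝ) (t : ℝ) :
    A.bdry K x (Function.update v x t) = A.bdry K x v := by
  refine Finset.sum_congr rfl fun i _ => ?_
  by_cases hi : i = some x
  · subst hi; simp [s, A.c_diag]
  · rw [A.ext_update_of_ne v t hi]

lemma base_update {x : V} (v : V → ℝ) : ∃ r, ∀ t, A.base (Function.update v x t) =
    r * Real.exp (-(1 / 2) * A.D x * t ^ 2) := by
  refine ⟨A.Z * Real.exp (-(1 / 2) * ∑ z ∈ Finset.univ.erase x, A.D z * v z ^ 2), fun t => ?_⟩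
  rw [base, ← Finset.add_sum_erase _ _ (Finset.mem_univ x), Function.update_self, mul_assoc,
    ← Real.exp_add]
  congr 2
  rw [Finset.sum_congr rfl fun z hz => by rw [Function.update_of_ne (Finset.ne_of_mem_erase hz)]]
  ring

/-- The equation of motion at `x` given the cluster of the ghost. -/
def motion (K : Finset (Option V)) (x : V) (v : V → ℝ) : ℝ :=
  A.D x * v x - A.drift K x v + A.bdry K x v * Real.sign (v x)

lemma integral_update_motion {K : Finset (Option V)} {x y : V} (hxy : x ≠ y) (hx : some x ∉ K)
    (v : V → ℝ) :
    ∫ t, (fun v => A.motion K x v * Real.sign (v y) *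
      ∑ ω, (if ghost ω = K then 1 else 0) * A.W v ω) (Function.update v x t) = 0 := by
  obtain ⟨r, hr⟩ := A.base_update (x := x) v
  obtain ⟨r', hr'⟩ := A.sum_expo_update hx v
  have : ∀ t, (fun v => A.motion K x v * Real.sign (v y) *
      ∑ ω, (if ghost ω = K then 1 else 0) * A.W v ω) (Function.update v x t) =
      (Real.sign (v y) * r * Real.exp r' * A.inner K v) *
      ((A.D x * t - A.drift K x v + A.bdry K x v * Real.sign t) *
      Real.exp (-(1 / 2) * A.D x * t ^ 2 + A.drift K x v * t - A.bdry K x v * |t|)) := by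
    intro t
    simp only [sum_ghost, motion, A.inner_update hx, drift_update, bdry_update, hr, hr',
      Function.update_self, Function.update_of_ne hxy.symm]
    rw [show -(1 / 2) * A.D x * t ^ 2 + A.drift K x v * t - A.bdry K x v * |t| =
      -(1 / 2) * A.D x * t ^ 2 + (A.drift K x v * t - A.bdry K x v * |t|) by ring,
      Real.exp_add, Real.exp_add]
    ring
  simp_rw [this]
  rw [integral_const_mul, integral_sign_gaussian (A.D_pos x), mul_zero]

end FK

namespace FK

variable {V : Type} [Fintype V] (A : FK V)

lemma integral_μ {f : (V → ℝ) × Finset (Option V × Option V) → ℝ} (hf : Integrable f A.μ) :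
    (∀ ω, Integrable fun v => A.W v ω * f (v, ω)) ∧
      ∫ q, f q ∂A.μ = ∑ ω, ∫ v, A.W v ω * f (v, ω) := by
  have h1 : ∀ ω, Integrable f (((volume : Measure (V → ℝ)).withDensity
      fun v => ENNReal.ofReal (A.W v ω)).map fun v => (v, ω)) := fun ω =>
    hf.mono_measure (Finset.single_le_sum (f := fun ω => ((volume : Measure (V → ℝ)).withDensity
      fun v => ENNReal.ofReal (A.W v ω)).map fun v => (v, ω)) (fun _ _ => Measure.zero_le _)
      (Finset.mem_univ ω))
  have hm : ∀ ω : Finset (Option V × Option V), Measurable fun v : V → ℝ => (v, ω) :=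
    fun ω => by fun_prop
  refine ⟨fun ω => ?_, ?_⟩
  · have h2 := (integrable_map_measure (h1 ω).aestronglyMeasurable (hm ω).aemeasurable).1 (h1 ω)
    rw [integrable_withDensity_iff_integrable_smul' (A.measurable_W ω).ennreal_ofReal
      (Eventually.of_forall fun _ => ENNReal.ofReal_lt_top)] at h2
    simpa [Function.comp, ENNReal.toReal_ofReal (A.W_nonneg _ ω)] using h2
  · rw [μ, integral_finsetSum_measure fun ω _ => h1 ω]
    refine Finset.sum_congr rfl fun ω _ => ?_
    rw [integral_map (hm ω).aemeasurable (h1 ω).aestronglyMeasurable,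
      integral_withDensity_eq_integral_toReal_smul (A.measurable_W ω).ennreal_ofReal
        (Eventually.of_forall fun _ => ENNReal.ofReal_lt_top)]
    simp [ENNReal.toReal_ofReal (A.W_nonneg _ ω)]

lemma integral_motion {K : Finset (Option V)} {x y : V} (hxy : x ≠ y) (hx : some x ∉ K)
    (hi : Integrable (fun q : (V → ℝ) × Finset (Option V × Option V) =>
      if ghost q.2 = K then A.motion K x q.1 * Real.sign (q.1 y) else 0) A.μ) :
    ∫ q, (if ghost q.2 = K then A.motion K x q.1 * Real.sign (q.1 y) else 0) ∂A.μ = 0 := by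
  obtain ⟨h1, h2⟩ := A.integral_μ hi
  rw [h2, ← integral_finsetSum _ fun ω _ => h1 ω]
  have h3 : ∀ v, ∑ ω, A.W v ω *
      (if ghost ω = K then A.motion K x v * Real.sign (v y) else 0) =
      A.motion K x v * Real.sign (v y) * ∑ ω, (if ghost ω = K then 1 else 0) * A.W v ω := by
    intro v
    rw [Finset.mul_sum]
    exact Finset.sum_congr rfl fun ω _ => by split_ifs <;> ring
  have h4 := integrable_finsetSum Finset.univ fun ω _ => h1 ω
  simp only [h3] at h4 ⊢
  exact integral_eq_zero_of_update x h4 (A.integral_update_motion hxy hx)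

lemma integrable_ext (hinteg : ∀ x, Integrable (fun q => q.1 x) A.μ) (i : Option V) :
    Integrable (fun q => A.ext q.1 i) A.μ := by
  cases i with
  | none => exact integrable_const _
  | some x => exact hinteg x

lemma integrable_of_le (hinteg : ∀ x, Integrable (fun q => q.1 x) A.μ) (i : Option V)
    {f : (V → ℝ) × Finset (Option V × Option V) → ℝ} (hf : Measurable f)
    (h : ∀ q, |f q| ≤ |A.ext q.1 i|) : Integrable f A.μ :=
  (A.integrable_ext hinteg i).mono hf.aestronglyMeasurable (Eventually.of_forall h)

lemma abs_ite_le (p : Prop) [Decidable p] (t : ℝ) : |if p then t else 0| ≤ |t| := by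
  split_ifs
  · exact le_rfl
  · simp

lemma measurable_ext_fst (i : Option V) :
    Measurable fun q : (V → ℝ) × Finset (Option V × Option V) => A.ext q.1 i :=
  (A.measurable_ext i).comp measurable_fst

lemma integrable_ite (hinteg : ∀ x, Integrable (fun q => q.1 x) A.μ) (y : V) (i : Option V)
    (p : Finset (Option V × Option V) → Prop) [DecidablePred p] :
    Integrable (fun q => if p q.2 then A.ext q.1 i * Real.sign (q.1 y) else 0) A.μ := by
  refine A.integrable_of_le hinteg i (measurable_ite_snd p
    ((A.measurable_ext_fst i).mul (measurable_sign_eval y))) fun q => ?_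
  refine (abs_ite_le _ _).trans ?_
  rw [abs_mul]
  exact mul_le_of_le_one_right (abs_nonneg _) (abs_sign_le _)

lemma integrable_ite_abs (hinteg : ∀ x, Integrable (fun q => q.1 x) A.μ) (x y : V) (i : Option V)
    (p : Finset (Option V × Option V) → Prop) [DecidablePred p] :
    Integrable (fun q => if p q.2 then |A.ext q.1 i| * (Real.sign (q.1 x) * Real.sign (q.1 y))
      else 0) A.μ := by
  refine A.integrable_of_le hinteg i (measurable_ite_snd p
    ((A.measurable_ext_fst i).abs.mul ((measurable_sign_eval x).mul (measurable_sign_eval y))))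
    fun q => ?_
  refine (abs_ite_le _ _).trans ?_
  rw [abs_mul, abs_mul, abs_abs]
  exact mul_le_of_le_one_right (abs_nonneg _)
    (mul_le_one₀ (abs_sign_le _) (abs_nonneg _) (abs_sign_le _))

lemma some_mem_ghost {ω : Finset (Option V × Option V)} {z : V} :
    some z ∈ ghost ω ↔ Cn ω (some z) none :=
  mem_ghost.trans ⟨Cn.symm, Cn.symm⟩

lemma none_mem_ghost {ω : Finset (Option V × Option V)} : none ∈ ghost ω := mem_ghost.2 Cn.refl

/-- The sign correlation of the field off the cluster of the ghost is nonnegative. -/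
lemma integral_bdry_nonneg {s : Finset V} {x : V} (hx : x ∈ s) (y : V)
    {J : (V → ℝ) × Finset (Option V × Option V) → ℝ} (hJ : Measurable J) (hJ0 : ∀ q, 0 ≤ J q)
    (hflip : ∀ q (S : Set V), J (flip S q.1, q.2) = J q)
    (hi : ∀ (p : Finset (Option V × Option V) → Prop) [DecidablePred p], Integrable (fun q =>
      if p q.2 then J q * (Real.sign (q.1 x) * Real.sign (q.1 y)) else 0) A.μ) :
    0 ≤ ∫ q, (if No s q.2 then J q * (Real.sign (q.1 x) * Real.sign (q.1 y)) else 0) ∂A.μ := by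
  have hmeas : Measurable fun q : (V → ℝ) × Finset (Option V × Option V) =>
      J q * (Real.sign (q.1 x) * Real.sign (q.1 y)) :=
    hJ.mul ((measurable_sign_eval x).mul (measurable_sign_eval y))
  have h1 : ∫ q, (if No s q.2 then J q * (Real.sign (q.1 x) * Real.sign (q.1 y)) else 0) ∂A.μ =
      ∫ q, (if No s q.2 ∧ Cn q.2 (some x) (some y) then
        J q * (Real.sign (q.1 x) * Real.sign (q.1 y)) else 0) ∂A.μ +
      ∫ q, (if No s q.2 ∧ ¬ Cn q.2 (some x) (some y) then
        J q * (Real.sign (q.1 x) * Real.sign (q.1 y)) else 0) ∂A.μ := by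
    rw [← integral_add (hi fun ω => No s ω ∧ Cn ω (some x) (some y))
      (hi fun ω => No s ω ∧ ¬ Cn ω (some x) (some y))]
    refine integral_congr_ae (Eventually.of_forall fun q => ?_)
    by_cases h1 : No s q.2 <;> by_cases h2 : Cn q.2 (some x) (some y) <;> simp [h1, h2]
  have h2 : ∫ q, (if No s q.2 ∧ ¬ Cn q.2 (some x) (some y) then
        J q * (Real.sign (q.1 x) * Real.sign (q.1 y)) else 0) ∂A.μ = 0 := by
    refine A.integral_odd (closed_free x) (measurable_ite_snd
      (fun ω => No s ω ∧ ¬ Cn ω (some x) (some y)) hmeas) fun q => ?_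
    by_cases h : No s q.2 ∧ ¬ Cn q.2 (some x) (some y)
    · simp only [if_pos h, hflip, flip_of_mem (mem_free_self (h.1 x hx)), Real.sign_neg,
        flip_of_notMem (show y ∉ free x q.2 from fun h' => h.2 h'.1)]
      ring
    · simp only [if_neg h, neg_zero]
  rw [h1, h2, add_zero]
  refine integral_nonneg_of_ae ?_
  filter_upwards [A.ae_sign] with q hq
  by_cases h : No s q.2 ∧ Cn q.2 (some x) (some y)
  · rw [if_pos h, show q.1 y = A.ext q.1 (some y) from rfl, ← hq _ _ h.2]
    exact mul_nonneg (hJ0 q) (mul_self_nonneg _)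
  · rw [if_neg h]; rfl

lemma abs_ext_flip (S : Set V) (v : V → ℝ) (i : Option V) :
    |A.ext (flip S v) i| = |A.ext v i| := by
  rw [ext_flip]
  split_ifs
  · exact abs_neg _
  · rfl

/-- The two-point function off the cluster of the ghost is subharmonic. -/
lemma D_mul_G_le (hinteg : ∀ x, Integrable (fun q => q.1 x) A.μ) {s : Finset V} {x y : V}
    (hx : x ∈ s) (hxy : x ≠ y) :
    A.D x * A.G s x y ≤ ∑ z, A.s x (some z) * A.G (insert z s) z y := by
  have hmot : ∀ (v : V → ℝ) (ω : Finset (Option V × Option V)),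
      A.motion (ghost ω) x v * Real.sign (v y) = A.D x * (v x * Real.sign (v y)) -
      (∑ z, if Cn ω (some z) none then 0 else A.s x (some z) * (v z * Real.sign (v y))) +
      ∑ i, (if i ∈ ghost ω then A.s x i * (|A.ext v i| * (Real.sign (v x) * Real.sign (v y)))
        else 0) := by
    intro v ω
    have e1 : A.drift (ghost ω) x v =
        ∑ z, if Cn ω (some z) none then 0 else A.s x (some z) * v z := by
      rw [drift, Fintype.sum_option, if_pos none_mem_ghost, zero_add]
      exact Finset.sum_congr rfl fun z _ => by simp only [some_mem_ghost]; rfl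
    rw [motion, e1, bdry, add_mul, sub_mul, Finset.sum_mul, mul_assoc, mul_assoc, Finset.sum_mul]
    congr 1
    · congr 1
      exact Finset.sum_congr rfl fun z _ => by split_ifs <;> ring
    · exact Finset.sum_congr rfl fun z _ => by split_ifs <;> ring
  have i1 : ∀ (z : V) (p : Finset (Option V × Option V) → Prop) [DecidablePred p],
      Integrable (fun q => if p q.2 then q.1 z * Real.sign (q.1 y) else 0) A.μ :=
    fun z p _ => A.integrable_ite hinteg y (some z) p
  -- integrability of the full expression
  have hdec : ∀ (p : Finset (Option V × Option V) → Prop) [DecidablePred p]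
      (q : (V → ℝ) × Finset (Option V × Option V)),
      (if p q.2 then A.motion (ghost q.2) x q.1 * Real.sign (q.1 y) else 0) =
      A.D x * (if p q.2 then q.1 x * Real.sign (q.1 y) else 0) -
      (∑ z, A.s x (some z) * (if p q.2 ∧ ¬ Cn q.2 (some z) none then
        q.1 z * Real.sign (q.1 y) else 0)) +
      ∑ i, A.s x i * (if p q.2 ∧ i ∈ ghost q.2 then
        |A.ext q.1 i| * (Real.sign (q.1 x) * Real.sign (q.1 y)) else 0) := by
    intro p _ q
    by_cases h : p q.2
    · simp only [h, if_true, true_and, hmot]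
      congr 1
      · congr 1
        refine Finset.sum_congr rfl fun z _ => ?_
        by_cases h' : Cn q.2 (some z) none <;> simp [h']
      · refine Finset.sum_congr rfl fun i _ => ?_
        by_cases h' : i ∈ ghost q.2 <;> simp [h']
    · simp [h]
  have j1 : ∀ (p : Finset (Option V × Option V) → Prop) [DecidablePred p], Integrable
      (fun q => A.D x * (if p q.2 then q.1 x * Real.sign (q.1 y) else 0)) A.μ :=
    fun p _ => (i1 x p).const_mul _
  have j2 : ∀ (p : Finset (Option V × Option V) → Prop) [DecidablePred p] (z : V), Integrable
      (fun q => A.s x (some z) * (if p q.2 ∧ ¬ Cn q.2 (some z) none then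
        q.1 z * Real.sign (q.1 y) else 0)) A.μ :=
    fun p _ z => (i1 z fun ω => p ω ∧ ¬ Cn ω (some z) none).const_mul _
  have j3 : ∀ (p : Finset (Option V × Option V) → Prop) [DecidablePred p] (i : Option V), Integrable
      (fun q => A.s x i * (if p q.2 ∧ i ∈ ghost q.2 then
        |A.ext q.1 i| * (Real.sign (q.1 x) * Real.sign (q.1 y)) else 0)) A.μ :=
    fun p _ i => (A.integrable_ite_abs hinteg x y i fun ω => p ω ∧ i ∈ ghost ω).const_mul _
  have hint_mot : ∀ (p : Finset (Option V × Option V) → Prop) [DecidablePred p], Integrable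
      (fun q => if p q.2 then A.motion (ghost q.2) x q.1 * Real.sign (q.1 y) else 0) A.μ := by
    intro p _
    simp only [hdec p]
    exact ((j1 p).sub (integrable_finsetSum _ fun z _ => j2 p z)).add
      (integrable_finsetSum _ fun i _ => j3 p i)
  -- the full expression has zero integral
  have hzero : ∫ q, (if No s q.2 then A.motion (ghost q.2) x q.1 * Real.sign (q.1 y) else 0) ∂A.μ
      = 0 := by
    have e : ∀ q : (V → ℝ) × Finset (Option V × Option V),
        (if No s q.2 then A.motion (ghost q.2) x q.1 * Real.sign (q.1 y) else 0) =
        ∑ K ∈ Finset.univ.filter (fun K : Finset (Option V) => ∀ z ∈ s, some z ∉ K),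
          if ghost q.2 = K then A.motion (ghost q.2) x q.1 * Real.sign (q.1 y) else 0 := by
      intro q
      rw [Finset.sum_ite_eq]
      by_cases h : No s q.2
      · rw [if_pos h, if_pos (by simpa [No, some_mem_ghost] using h)]
      · rw [if_neg h, if_neg (by simpa [No, some_mem_ghost] using h)]
    simp only [e]
    rw [integral_finsetSum _ fun K _ => hint_mot fun ω => ghost ω = K]
    refine Finset.sum_eq_zero fun K hK => ?_
    have hK : ∀ z ∈ s, some z ∉ K := by simpa using hK
    have e' : ∀ q : (V → ℝ) × Finset (Option V × Option V),
        (if ghost q.2 = K then A.motion (ghost q.2) x q.1 * Real.sign (q.1 y) else 0) =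
        if ghost q.2 = K then A.motion K x q.1 * Real.sign (q.1 y) else 0 := by
      intro q
      split_ifs with h
      · rw [h]
      · rfl
    have hi := hint_mot fun ω => ghost ω = K
    simp only [e'] at hi ⊢
    exact A.integral_motion hxy (hK x hx) hi
  simp only [hdec (No s)] at hzero
  replace hzero := (integral_add ((j1 (No s)).sub (integrable_finsetSum Finset.univ
    fun z _ => j2 (No s) z)) (integrable_finsetSum Finset.univ fun i _ => j3 (No s) i)).symm.trans hzero
  rw [integral_sub' (j1 (No s)) (integrable_finsetSum _ fun z _ => j2 (No s) z),
    integral_finsetSum _ fun z _ => j2 (No s) z, integral_finsetSum _ fun i _ => j3 (No s) i] at hzero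
  simp only [integral_const_mul] at hzero
  have h3 : ∀ i : Option V, 0 ≤ ∫ q, (if No s q.2 ∧ i ∈ ghost q.2 then
        |A.ext q.1 i| * (Real.sign (q.1 x) * Real.sign (q.1 y)) else 0) ∂A.μ := by
    intro i
    have := A.integral_bdry_nonneg hx y
      (J := fun q => if i ∈ ghost q.2 then |A.ext q.1 i| else 0)
      (measurable_ite_snd (fun ω => i ∈ ghost ω) (A.measurable_ext_fst i).abs)
      (fun q => by split_ifs <;> positivity)
      (fun q S => by simp only [abs_ext_flip]) (fun p _ => by
        have := A.integrable_ite_abs hinteg x y i fun ω => p ω ∧ i ∈ ghost ω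
        refine this.congr (Eventually.of_forall fun q => ?_)
        by_cases h1 : p q.2 <;> by_cases h2 : i ∈ ghost q.2 <;> simp [h1, h2])
    refine this.trans_eq (integral_congr_ae (Eventually.of_forall fun q => ?_))
    by_cases h1 : No s q.2 <;> by_cases h2 : i ∈ ghost q.2 <;> simp [h1, h2]
  have h4 : ∀ z : V, ∫ q, (if No s q.2 ∧ ¬ Cn q.2 (some z) none then
        q.1 z * Real.sign (q.1 y) else 0) ∂A.μ = A.G (insert z s) z y := by
    intro z
    refine integral_congr_ae (Eventually.of_forall fun q => ?_)
    have : No (insert z s) q.2 ↔ No s q.2 ∧ ¬ Cn q.2 (some z) none := by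
      simp [No, and_comm]
    simp only [this]
  simp only [h4] at hzero
  have h5 := Finset.sum_nonneg fun i (_ : i ∈ Finset.univ) =>
    mul_nonneg (A.s_nonneg x i) (h3 i)
  change A.D x * A.G s x y - _ + _ = 0 at hzero
  linarith

end FK

namespace Model

variable (M : Model)

/-- The couplings of the random cluster representation of the field on a finite set. Each
unordered pair of vertices is given a single orientation, by means of an enumeration. -/
def coupling (U : Finset M.V) (enc : M.V → ℕ) : Option U × Option U → ℝ
  | (some x, some y) => if enc x < enc y then - M.toWGraph.prec U x y else 0
  | (none, some x) => M.toWGraph.kill U x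
  | (_, none) => 0

variable {M}

lemma sum_coupling (U : Finset M.V) (enc : M.V → ℕ) (a : ℝ) (v : U → ℝ) :
    ∑ e, M.coupling U enc e * e.1.elim a v * e.2.elim a v =
      a * ∑ x, M.toWGraph.kill U x * v x +
        ∑ x : U, ∑ y : U, (if enc x < enc y then - M.toWGraph.prec U x y else 0) * v x * v y := by
  rw [Fintype.sum_prod_type, Fintype.sum_option, Fintype.sum_option]
  simp only [Fintype.sum_option, coupling, Option.elim, zero_mul, zero_add, Finset.mul_sum]
  congr 1
  exact Finset.sum_congr rfl fun x _ => by ring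

lemma quad_coupling (hS : M.toWGraph.Standing) (U : Finset M.V) {enc : M.V → ℕ}
    (henc : Function.Injective enc) (a : ℝ) (v : U → ℝ) :
    -(1 / 2) * ∑ i, ∑ j, (v i - a) * M.toWGraph.prec U i j * (v j - a) =
      -(1 / 2) * a ^ 2 * (∑ x, M.toWGraph.kill U x) +
      (-(1 / 2) * ∑ x, M.toWGraph.prec U x x * v x ^ 2 +
        ∑ e, M.coupling U enc e * e.1.elim a v * e.2.elim a v) := by
  rw [sum_coupling]
  have hk : ∀ x, ∑ y, M.toWGraph.prec U x y = M.toWGraph.kill U x := fun _ => rfl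
  have hk' : ∀ y, ∑ x, M.toWGraph.prec U x y = M.toWGraph.kill U y := fun y => by
    rw [← hk]; exact Finset.sum_congr rfl fun x _ => hS.prec_symm x y
  have h1 : ∑ i, ∑ j, (v i - a) * M.toWGraph.prec U i j * (v j - a) =
      ∑ i, ∑ j, M.toWGraph.prec U i j * v i * v j - 2 * a * ∑ x, M.toWGraph.kill U x * v x +
        a ^ 2 * ∑ x, M.toWGraph.kill U x := by
    have e1 : ∀ i j, (v i - a) * M.toWGraph.prec U i j * (v j - a) =
        M.toWGraph.prec U i j * v i * v j - a * (M.toWGraph.prec U i j * v i)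
          - a * (M.toWGraph.prec U i j * v j) + a ^ 2 * M.toWGraph.prec U i j := fun i j => by ring
    simp_rw [e1, Finset.sum_add_distrib, Finset.sum_sub_distrib, ← Finset.mul_sum,
      ← Finset.sum_mul, hk]
    have e2 : ∑ i, ∑ j, M.toWGraph.prec U i j * v j = ∑ x, M.toWGraph.kill U x * v x := by
      rw [Finset.sum_comm]
      simp_rw [← Finset.sum_mul, hk']
    rw [e2]
    ring
  have h2 : ∑ i, ∑ j, M.toWGraph.prec U i j * v i * v j =
      ∑ x, M.toWGraph.prec U x x * v x ^ 2 - 2 * ∑ x : U, ∑ y : U,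
        (if enc x < enc y then - M.toWGraph.prec U x y else 0) * v x * v y := by
    have e1 : ∀ i j : U, M.toWGraph.prec U i j * v i * v j =
        (if i = j then M.toWGraph.prec U i j * v i * v j else 0) -
        (if enc i < enc j then - M.toWGraph.prec U i j else 0) * v i * v j -
        (if enc j < enc i then - M.toWGraph.prec U j i else 0) * v j * v i := fun i j => by
      rcases lt_trichotomy (enc i) (enc j) with h | h | h
      · have : i ≠ j := by rintro rfl; exact lt_irrefl _ h
        simp [this, h, h.not_gt]
      · have : i = j := Subtype.ext (henc h)
        subst this
        simp
      · have : i ≠ j := by rintro rfl; exact lt_irrefl _ h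
        simp only [this, if_false, h, h.not_gt, if_true, hS.prec_symm i j]
        ring
    have e3 : ∑ i : U, ∑ j : U, (if enc j < enc i then - M.toWGraph.prec U j i else 0) * v j * v i =
        ∑ i : U, ∑ j : U, (if enc i < enc j then - M.toWGraph.prec U i j else 0) * v i * v j :=
      Finset.sum_comm
    calc _ = ∑ i : U, ∑ j : U, ((if i = j then M.toWGraph.prec U i j * v i * v j else 0) -
        (if enc i < enc j then - M.toWGraph.prec U i j else 0) * v i * v j -
        (if enc j < enc i then - M.toWGraph.prec U j i else 0) * v j * v i) :=
          Finset.sum_congr rfl fun i _ => Finset.sum_congr rfl fun j _ => e1 i j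
      _ = _ := by
        simp_rw [Finset.sum_sub_distrib]
        rw [e3]
        simp only [Finset.sum_ite_eq, Finset.mem_univ, if_true]
        have : ∀ x, M.toWGraph.prec U x x * v x * v x = M.toWGraph.prec U x x * v x ^ 2 :=
          fun x => by ring
        simp_rw [this]
        ring
  rw [h1, h2]
  ring

lemma exists_fk (hS : M.toWGraph.Standing) (hν : 0 < M.ν) {U : Finset M.V} (hU : U.Nonempty)
    {enc : M.V → ℕ} (henc : Function.Injective enc) (a : ℝ) :
    ∃ A : FK U, A.a = a ∧ A.c = M.coupling U enc ∧ (∀ x, A.D x = M.toWGraph.prec U x x) ∧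
      A.μ.map Prod.fst = M.P.map (M.field U a) := by
  obtain ⟨Z, hZ, hd⟩ := M.exists_field_density hS hν hU
  have := M.Pprob
  have hdens : ∀ v : U → ℝ, Z * M.gaussDens U a v =
      (Z * Real.exp (-(1 / 2) * a ^ 2 * (∑ x, M.toWGraph.kill U x))) *
        (Real.exp (-(1 / 2) * ∑ x, M.toWGraph.prec U x x * v x ^ 2) *
        Real.exp (∑ e, M.coupling U enc e * e.1.elim a v * e.2.elim a v)) := fun v => by
    rw [gaussDens, quad_coupling hS U henc, Real.exp_add, Real.exp_add]
    ring
  refine ⟨⟨M.coupling U enc, ?_, ?_, fun x => M.toWGraph.prec U x x, ?_, a,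
    Z * Real.exp (-(1 / 2) * a ^ 2 * (∑ x, M.toWGraph.kill U x)), by positivity, ?_⟩,
    rfl, rfl, fun _ => rfl, ?_⟩
  · rintro ⟨i, j⟩
    rcases i with - | x <;> rcases j with - | y <;> simp only [coupling, le_refl]
    · exact hS.kill_nonneg hν hU y
    · split_ifs with h
      · exact neg_nonneg.2 (hS.prec_nonpos hν hU (by rintro rfl; exact lt_irrefl _ h))
      · exact le_rfl
  · rintro (- | x) <;> simp [coupling]
  · exact fun x => (hS.posDef_prec hν hU).diag_pos
  · have h1 : M.P.map (M.field U a) Set.univ = 1 := by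
      have := Measure.isProbabilityMeasure_map (μ := M.P) (M.measurable_field U a).aemeasurable
      exact measure_univ
    rw [hd, withDensity_apply _ MeasurableSet.univ, Measure.restrict_univ] at h1
    simpa only [hdens] using h1
  · refine (FK.map_fst_μ _).trans ((hd a).trans ?_).symm
    congr 1
    funext v
    rw [hdens, ← mul_assoc]
    rfl

end Model

section GaussianEstimates

variable {v : ℝ≥0} {K : ℝ}

lemma gaussianReal_real_eq (hv : v ≠ 0) {s : Set ℝ} (hs : MeasurableSet s) :
    (gaussianReal 0 v).real s = ∫ t in s, gaussianPDFReal 0 v t := by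
  rw [measureReal_def, gaussianReal_apply_eq_integral 0 hv s, ENNReal.toReal_ofReal]
  exact setIntegral_nonneg hs fun t _ => gaussianPDFReal_nonneg _ _ _

lemma ne_zero_of_one_le_mul (hv : 1 ≤ K * (v : ℝ)) : v ≠ 0 := by
  rintro rfl
  simp at hv
  linarith

lemma gaussianReal_Icc_le (hK : 1 ≤ K) (hv : 1 ≤ K * (v : ℝ)) (b : ℝ) {δ : ℝ} (hδ : 0 ≤ δ) :
    (gaussianReal 0 v).real {t | |t + b| ≤ δ} ≤ 2 * K * δ := by
  have hset : {t : ℝ | |t + b| ≤ δ} = Set.Icc (-b - δ) (-b + δ) := by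
    ext t
    rw [Set.mem_ofPred_eq, abs_le, Set.mem_Icc]
    constructor <;> intro h <;> constructor <;> linarith [h.1, h.2]
  have hv0 := ne_zero_of_one_le_mul hv
  rw [hset, gaussianReal_real_eq hv0 measurableSet_Icc]
  have hb : ∀ t, gaussianPDFReal 0 v t ≤ K := fun t => by
    rw [gaussianPDFReal]
    have h1 : Real.exp (-(t - 0) ^ 2 / (2 * v)) ≤ 1 :=
      Real.exp_le_one_iff.2 (div_nonpos_of_nonpos_of_nonneg (by nlinarith [sq_nonneg (t - 0)])
        (by positivity))
    have h2 : K⁻¹ ≤ √(2 * π * v) := by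
      refine Real.le_sqrt_of_sq_le ?_
      have hp := Real.pi_gt_three
      have h3 : K⁻¹ ≤ v := by rw [inv_le_iff_one_le_mul₀ (by linarith)]; linarith
      have h4 : K⁻¹ ≤ 1 := inv_le_one_of_one_le₀ hK
      have h5 : 0 < K⁻¹ := by positivity
      nlinarith [mul_nonneg (by linarith : (0:ℝ) ≤ 2 * π - 1) v.2]
    have h3 : (√(2 * π * v))⁻¹ ≤ K := by
      rw [← inv_inv K]
      exact inv_anti₀ (by positivity) h2
    calc _ ≤ (√(2 * π * v))⁻¹ * 1 := by gcongr
      _ ≤ K := by rwa [mul_one]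
  have := setIntegral_mono_on (μ := volume) (s := Set.Icc (-b - δ) (-b + δ))
    (integrable_gaussianPDFReal 0 v).integrableOn
    (integrableOn_const (C := K) (by simp)) measurableSet_Icc fun t _ => hb t
  refine this.trans (le_of_eq ?_)
  rw [setIntegral_const, measureReal_def, Real.volume_Icc, ENNReal.toReal_ofReal (by linarith),
    smul_eq_mul]
  ring

lemma le_gaussianReal_Ioo (hK : 1 ≤ K) (hv : 1 ≤ K * (v : ℝ)) (hvK : v ≤ K) {a : ℝ} (ha : 0 ≤ a)
    (ha1 : a ≤ 1) : (√(2 * π * K))⁻¹ * Real.exp (-K) * a ≤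
      (gaussianReal 0 v).real {t | |t| < a} := by
  have hset : {t : ℝ | |t| < a} = Set.Ioo (-a) a := by
    ext t; rw [Set.mem_ofPred_eq, abs_lt, Set.mem_Ioo]
  have hv0 := ne_zero_of_one_le_mul hv
  have hvpos : (0:ℝ) < v := by positivity
  rw [hset, gaussianReal_real_eq hv0 measurableSet_Ioo]
  have hb : ∀ t ∈ Set.Ioo (-a) a,
      (√(2 * π * K))⁻¹ * Real.exp (-K) ≤ gaussianPDFReal 0 v t := fun t ht => by
    rw [gaussianPDFReal]
    gcongr
    rw [sub_zero, le_div_iff₀ (by positivity)]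
    have : t ^ 2 ≤ 1 := by nlinarith [ht.1, ht.2]
    nlinarith
  have := setIntegral_mono_on (μ := volume) (s := Set.Ioo (-a) a)
    (integrableOn_const (C := (√(2 * π * K))⁻¹ * Real.exp (-K)) (by simp))
    (integrable_gaussianPDFReal 0 v).integrableOn measurableSet_Ioo hb
  refine le_trans ?_ this
  rw [setIntegral_const, measureReal_def, Real.volume_Ioo, ENNReal.toReal_ofReal (by linarith),
    smul_eq_mul]
  have : 0 ≤ (√(2 * π * K))⁻¹ * Real.exp (-K) := by positivity
  nlinarith

lemma gaussianReal_Iic_le (hv : v ≠ 0) {u : ℝ} (hu : 0 ≤ u) :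
    (gaussianReal 0 v).real {t | t ≤ -u} ≤ Real.exp (-(u ^ 2 / (2 * v))) := by
  have hvpos : (0:ℝ) < v := by positivity
  have h := measure_le_le_exp_mul_mgf (μ := gaussianReal 0 v) (X := id) (t := -(u / v)) (-u)
    (by have : 0 ≤ u / v := by positivity
        linarith) (integrable_exp_mul_gaussianReal _)
  rw [mgf_id_gaussianReal, ← Real.exp_add] at h
  refine h.trans (le_of_eq (congrArg _ ?_))
  field_simp
  ring

lemma integrable_sq_gaussianReal (b : ℝ) :
    Integrable (fun t => (t + b) ^ 2) (gaussianReal 0 v) :=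
  MemLp.integrable_sq (((memLp_id_gaussianReal 2).add (memLp_const b)))

lemma integral_sq_gaussianReal (b : ℝ) :
    ∫ t, (t + b) ^ 2 ∂gaussianReal 0 v = v + b ^ 2 := by
  have h0 : Integrable (fun t : ℝ => t) (gaussianReal 0 v) :=
    (memLp_id_gaussianReal 1).integrable le_rfl
  have h1 := variance_fun_id_gaussianReal (μ := 0) (v := v)
  rw [variance_of_integral_eq_zero (by fun_prop) (by simp)] at h1
  have hsq : Integrable (fun t : ℝ => t ^ 2) (gaussianReal 0 v) := by
    simpa using integrable_sq_gaussianReal (v := v) 0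
  have : ∀ t : ℝ, (t + b) ^ 2 = t ^ 2 + (2 * b * t + b ^ 2) := fun t => by ring
  simp_rw [this]
  have h2 : Integrable (fun t : ℝ => 2 * b * t) (gaussianReal 0 v) := h0.const_mul _
  have h3 : Integrable (fun t : ℝ => 2 * b * t + b ^ 2) (gaussianReal 0 v) :=
    h2.add (integrable_const _)
  rw [integral_add hsq h3, integral_add h2 (integrable_const _), integral_const_mul,
    integral_id_gaussianReal]
  simp [h1]

lemma integral_sign_gaussianReal {a : ℝ} (ha : 0 < a) :
    (gaussianReal 0 v).real {t | |t| < a} ≤ ∫ t, Real.sign (t + a) ∂gaussianReal 0 v ∧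
    ∫ t, Real.sign (t + a) ∂gaussianReal 0 v ≤ (gaussianReal 0 v).real {t | |t + 0| ≤ a} := by
  have hmeas : Measurable fun t : ℝ => Real.sign (t + a) :=
    FK.measurable_sign.comp (measurable_add_const a)
  have hi : Integrable (fun t : ℝ => Real.sign (t + a)) (gaussianReal 0 v) :=
    Integrable.of_bound hmeas.aestronglyMeasurable 1 (Eventually.of_forall fun t => FK.abs_sign_le _)
  have hneg : ∫ t, Real.sign (-t + a) ∂gaussianReal 0 v =
      ∫ t, Real.sign (t + a) ∂gaussianReal 0 v := by
    have := integral_map (μ := gaussianReal 0 v) (φ := fun x => -x) (by fun_prop)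
      (f := fun t : ℝ => Real.sign (t + a)) hmeas.aestronglyMeasurable
    rw [gaussianReal_map_neg, neg_zero] at this
    exact this.symm
  have hi' : Integrable (fun t : ℝ => Real.sign (-t + a)) (gaussianReal 0 v) :=
    Integrable.of_bound (hmeas.comp measurable_neg).aestronglyMeasurable 1
      (Eventually.of_forall fun t => FK.abs_sign_le _)
  have h2 : ∫ t, Real.sign (t + a) ∂gaussianReal 0 v =
      ∫ t, (1 / 2) * (Real.sign (t + a) + Real.sign (-t + a)) ∂gaussianReal 0 v := by
    rw [integral_const_mul, integral_add hi hi', hneg]; ring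
  have hI : Integrable (fun t : ℝ => (1 / 2) * (Real.sign (t + a) + Real.sign (-t + a)))
      (gaussianReal 0 v) := (hi.add hi').const_mul _
  have m1 : MeasurableSet {t : ℝ | |t| < a} := measurableSet_lt (by fun_prop) (by fun_prop)
  have m2 : MeasurableSet {t : ℝ | |t + 0| ≤ a} := measurableSet_le (by fun_prop) (by fun_prop)
  have hsgn : ∀ t : ℝ, (|t| < a → Real.sign (t + a) = 1 ∧ Real.sign (-t + a) = 1) ∧
      (a < |t| → Real.sign (t + a) + Real.sign (-t + a) = 0) := fun t => by
    refine ⟨fun h => ?_, fun h => ?_⟩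
    · rw [abs_lt] at h
      exact ⟨Real.sign_of_pos (by linarith), Real.sign_of_pos (by linarith)⟩
    · rcases lt_abs.1 h with h | h
      · rw [Real.sign_of_pos (by linarith), Real.sign_of_neg (by linarith)]; norm_num
      · rw [Real.sign_of_neg (by linarith), Real.sign_of_pos (by linarith)]; norm_num
  have hle : ∀ s : ℝ, Real.sign s ≤ 1 := fun s => (le_abs_self _).trans (FK.abs_sign_le s)
  have hnn : ∀ t : ℝ, |t| ≤ a → 0 ≤ Real.sign (t + a) ∧ 0 ≤ Real.sign (-t + a) := fun t ht => by
    rw [abs_le] at ht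
    have hs : ∀ s : ℝ, 0 ≤ s → 0 ≤ Real.sign s := fun s hs => by
      rcases hs.eq_or_lt with h | h
      · rw [← h, Real.sign_zero]
      · rw [Real.sign_of_pos h]; norm_num
    exact ⟨hs _ (by linarith), hs _ (by linarith)⟩
  rw [h2]
  constructor
  · rw [← integral_indicator_one m1]
    refine integral_mono ((integrable_const (1:ℝ)).indicator m1) hI fun t => ?_
    simp only [Set.indicator_apply, Set.mem_ofPred_eq, Pi.one_apply]
    split_ifs with h
    · rw [((hsgn t).1 h).1, ((hsgn t).1 h).2]; norm_num
    · rcases (not_lt.1 h).eq_or_lt with h | h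
      · have := hnn t h.symm.le; linarith
      · rw [(hsgn t).2 h]; norm_num
  · rw [← integral_indicator_one m2]
    refine integral_mono hI ((integrable_const (1:ℝ)).indicator m2) fun t => ?_
    simp only [Set.indicator_apply, Set.mem_ofPred_eq, Pi.one_apply, add_zero]
    split_ifs with h
    · linarith [hle (t + a), hle (-t + a)]
    · rw [(hsgn t).2 (not_le.1 h)]; norm_num

end GaussianEstimates

namespace Model

variable {M : Model} {U : Finset M.V} {a K : ℝ} {A : FK U}

lemma map_fk_sum (hA : A.μ.map Prod.fst = M.P.map (M.field U a)) (m : U → ℝ) :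
    A.μ.map (fun q => ∑ x, m x * q.1 x) =
      (gaussianReal 0 (Real.toNNReal (∑ i, ∑ j, m i * m j * M.toWGraph.green i j))).map
        (fun t => t + a * ∑ x, m x) := by
  have hm : Measurable fun w : U → ℝ => ∑ x, m x * w x := by fun_prop
  have h1 : A.μ.map (fun q => ∑ x, m x * q.1 x) =
      (A.μ.map Prod.fst).map fun w : U → ℝ => ∑ x, m x * w x := by
    rw [Measure.map_map hm measurable_fst]; rfl
  have h2 := M.map_sum_field U m
  rw [h1, hA, Measure.map_map hm (M.measurable_field U a)]
  change _ = (gaussianReal 0 (Real.toNNReal (∑ i, ∑ j, m i * m j * M.toWGraph.greenMat U i j))).map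
        (fun t => t + a * ∑ x, m x)
  rw [← h2, Measure.map_map (by fun_prop) (f := fun ω => ∑ i, m i * M.φ ω i.1)
    (Finset.measurable_fun_sum _ fun x _ => (M.φ_meas x).const_mul _)]
  congr 1
  funext ω
  simp only [Function.comp_apply, field, mul_add, Finset.sum_add_distrib, Finset.mul_sum]
  congr 1
  exact Finset.sum_congr rfl fun x _ => mul_comm _ _

lemma map_fk_eval (hA : A.μ.map Prod.fst = M.P.map (M.field U a)) (x : U) :
    A.μ.map (fun q => q.1 x) =
      (gaussianReal 0 (Real.toNNReal (M.toWGraph.green x x))).map (fun t => t + a) := by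
  have h := map_fk_sum hA (Pi.single x 1)
  simp only [Pi.single_apply, ite_mul, one_mul, zero_mul, mul_ite, mul_zero,
    Finset.sum_ite_eq', Finset.mem_univ, if_true, mul_one] at h
  exact h

lemma fk_sum_le (hA : A.μ.map Prod.fst = M.P.map (M.field U a)) (ha : 0 ≤ a) {m : U → ℝ}
    (hm : 0 ≤ ∑ x, m x) (hE : 0 < ∑ i, ∑ j, m i * m j * M.toWGraph.green i j) :
    A.μ.real {q | ∑ x, m x * q.1 x ≤ 0} ≤ Real.exp (-((a * ∑ x, m x) ^ 2 /
      (2 * ∑ i, ∑ j, m i * m j * M.toWGraph.green i j))) := by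
  have hf : Measurable fun q : (U → ℝ) × Finset (Option U × Option U) => ∑ x, m x * q.1 x :=
    Finset.measurable_fun_sum _ fun x _ => (FK.measurable_eval x).const_mul _
  have h1 : A.μ.real {q | ∑ x, m x * q.1 x ≤ 0} =
      (A.μ.map (fun q => ∑ x, m x * q.1 x)).real (Set.Iic 0) := by
    rw [map_measureReal_apply hf measurableSet_Iic]; rfl
  rw [h1, map_fk_sum hA, map_measureReal_apply (by fun_prop) measurableSet_Iic]
  have h2 := gaussianReal_Iic_le (v := Real.toNNReal (∑ i, ∑ j, m i * m j * M.toWGraph.green i j))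
    (by simpa using hE) (mul_nonneg ha hm)
  rw [Real.coe_toNNReal _ hE.le] at h2
  refine le_trans (le_of_eq (congrArg _ ?_)) h2
  ext t
  simp only [Set.mem_preimage, Set.mem_Iic, Set.mem_ofPred_eq]
  constructor <;> intro h <;> linarith

lemma fk_small (hK : M.toWGraph.Bd K) (hA : A.μ.map Prod.fst = M.P.map (M.field U a))
    (x : U) {δ : ℝ} (hδ : 0 ≤ δ) : A.μ.real {q | |q.1 x| ≤ δ} ≤ 2 * K * δ := by
  have ms : MeasurableSet {t : ℝ | |t| ≤ δ} := measurableSet_le (by fun_prop) (by fun_prop)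
  have h1 : A.μ.real {q | |q.1 x| ≤ δ} = (A.μ.map (fun q => q.1 x)).real {t | |t| ≤ δ} := by
    rw [map_measureReal_apply (FK.measurable_eval x) ms]; rfl
  rw [h1, map_fk_eval hA, map_measureReal_apply (by fun_prop) ms]
  refine gaussianReal_Icc_le hK.one_le ?_ a hδ
  rw [Real.coe_toNNReal _ (hK.std.green_pos _ _).le]
  exact hK.le_green_self x

lemma fk_integrable_sq (hA : A.μ.map Prod.fst = M.P.map (M.field U a))
    (x : U) : Integrable (fun q => q.1 x ^ 2) A.μ := by
  have h : Integrable (fun t : ℝ => t ^ 2) (A.μ.map (fun q => q.1 x)) := by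
    rw [map_fk_eval hA]
    exact (integrable_map_measure (by fun_prop) (by fun_prop)).2 (integrable_sq_gaussianReal a)
  exact (integrable_map_measure (μ := A.μ) (f := fun q => q.1 x)
    (g := fun t : ℝ => t ^ 2)
    (by fun_prop) (FK.measurable_eval x).aemeasurable).1 h

lemma fk_integrable (hA : A.μ.map Prod.fst = M.P.map (M.field U a))
    (x : U) : Integrable (fun q => q.1 x) A.μ :=
  ((memLp_two_iff_integrable_sq (FK.measurable_eval x).aestronglyMeasurable).2
    (fk_integrable_sq hA x)).integrable one_le_two

lemma fk_integral_sq_le (hK : M.toWGraph.Bd K) (hA : A.μ.map Prod.fst = M.P.map (M.field U a))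
    (ha : 0 ≤ a) (ha1 : a ≤ 1) (x : U) : ∫ q, q.1 x ^ 2 ∂A.μ ≤ K + 1 := by
  have h : ∫ q, q.1 x ^ 2 ∂A.μ = ∫ t, t ^ 2 ∂(A.μ.map (fun q => q.1 x)) :=
    (integral_map (f := fun t : ℝ => t ^ 2) (FK.measurable_eval x).aemeasurable
      (by fun_prop)).symm
  rw [h, map_fk_eval hA, integral_map (by fun_prop) (by fun_prop), integral_sq_gaussianReal,
    Real.coe_toNNReal _ (hK.std.green_pos _ _).le]
  have := hK.green_self_le x
  nlinarith

lemma fk_ghost (hK : M.toWGraph.Bd K) (hA : A.μ.map Prod.fst = M.P.map (M.field U a))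
    (ha : 0 < a) (hAa : A.a = a) (x : U) :
    (gaussianReal 0 (Real.toNNReal (M.toWGraph.green x x))).real {t | |t| < a} ≤
        A.μ.real {q | FK.Cn q.2 (some x) none} ∧
      A.μ.real {q | FK.Cn q.2 (some x) none} ≤ 2 * K * a := by
  have h := A.real_cn (hAa ▸ ha) x
  have h1 : ∫ q, Real.sign (q.1 x) ∂A.μ = ∫ t, Real.sign t ∂(A.μ.map (fun q => q.1 x)) :=
    (integral_map (FK.measurable_eval x).aemeasurable
      FK.measurable_sign.aestronglyMeasurable).symm
  rw [h1, map_fk_eval hA, integral_map (by fun_prop) FK.measurable_sign.aestronglyMeasurable] at h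
  obtain ⟨h2, h3⟩ := integral_sign_gaussianReal
    (v := Real.toNNReal (M.toWGraph.green x x)) ha
  rw [h]
  refine ⟨h2, h3.trans (gaussianReal_Icc_le hK.one_le ?_ 0 ha.le)⟩
  rw [Real.coe_toNNReal _ (hK.std.green_pos _ _).le]
  exact hK.le_green_self x

lemma fk_G_le_of_no (hK : M.toWGraph.Bd K) (hA : A.μ.map Prod.fst = M.P.map (M.field U a))
    (ha : 0 ≤ a) (ha1 : a ≤ 1) (s : Finset U) (x y : U) {ε : ℝ} (hε : 0 < ε)
    (hno : A.μ.real {q | FK.No s q.2} ≤ 2 * ε ^ 2) :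
    |A.G s x y| ≤ (K + 2) * ε := by
  have hsq := fk_integrable_sq hA x
  have hN : MeasurableSet {q : (U → ℝ) × Finset (Option U × Option U) | FK.No s q.2} :=
    FK.measurableSet_snd fun ω => FK.No s ω
  have h1 : |A.G s x y| ≤ ∫ q, ((ε / 2) * q.1 x ^ 2 +
      (1 / (2 * ε)) * {q | FK.No s q.2}.indicator (fun _ => (1:ℝ)) q) ∂A.μ := by
    refine (abs_integral_le_integral_abs).trans ?_
    refine integral_mono_of_nonneg (Eventually.of_forall fun q => abs_nonneg _)
      ((hsq.const_mul _).add (((integrable_const (1:ℝ)).indicator hN).const_mul _))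
      (Eventually.of_forall fun q => ?_)
    simp only [Set.indicator_apply, Set.mem_ofPred_eq]
    by_cases h : FK.No s q.2
    · rw [if_pos h, if_pos h, abs_mul]
      have h2 : |q.1 x| * |Real.sign (q.1 y)| ≤ |q.1 x| :=
        mul_le_of_le_one_right (abs_nonneg _) (FK.abs_sign_le _)
      refine h2.trans ?_
      have h3 : (ε / 2) * q.1 x ^ 2 + (1 / (2 * ε)) * 1 - |q.1 x| =
          (1 / (2 * ε)) * (ε * |q.1 x| - 1) ^ 2 := by
        rw [← sq_abs (q.1 x)]
        field_simp
        ring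
      have : 0 ≤ (1 / (2 * ε)) * (ε * |q.1 x| - 1) ^ 2 := by positivity
      linarith
    · rw [if_neg h, if_neg h, abs_zero]
      positivity
  rw [integral_add (hsq.const_mul _) (((integrable_const (1:ℝ)).indicator hN).const_mul _),
    integral_const_mul, integral_const_mul] at h1
  have h4 : ∫ q, {q | FK.No s q.2}.indicator (fun _ => (1:ℝ)) q ∂A.μ =
      A.μ.real {q | FK.No s q.2} := integral_indicator_one hN
  rw [h4] at h1
  have h5 := fk_integral_sq_le hK hA ha ha1 x
  calc _ ≤ _ := h1
    _ ≤ ε / 2 * (K + 1) + 1 / (2 * ε) * (2 * ε ^ 2) := by gcongr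
    _ = (K + 3) / 2 * ε := by field_simp; ring
    _ ≤ _ := by have := hK.one_le; gcongr; linarith

lemma fk_G_le (hK : M.toWGraph.Bd K) (hA : A.μ.map Prod.fst = M.P.map (M.field U a))
    (ha : 0 ≤ a) (ha1 : a ≤ 1) (s : Finset U) (x y : U) : |A.G s x y| ≤ K + 2 := by
  have := fk_G_le_of_no hK hA ha ha1 s x y one_pos
    (measureReal_le_one.trans (by norm_num))
  rwa [mul_one] at this

lemma fk_G_le_exp (hK : M.toWGraph.Bd K) (hA : A.μ.map Prod.fst = M.P.map (M.field U a))
    (ha : 0 ≤ a) (ha1 : a ≤ 1) (s : Finset U) (x y : U) {m : U → ℝ} {t : ℝ}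
    (hms : ∀ z ∉ s, m z = 0) (hm : 0 ≤ ∑ x, m x)
    (hE : 0 < ∑ i, ∑ j, m i * m j * M.toWGraph.green i j)
    (hmt : t * ∑ i, ∑ j, m i * m j * M.toWGraph.green i j ≤ (∑ x, m x) ^ 2) :
    |A.G s x y| ≤ (K + 2) * Real.exp (-(a ^ 2 * t / 4)) := by
  refine fk_G_le_of_no hK hA ha ha1 s x y (Real.exp_pos _) ?_
  refine (A.measure_no_le s m hms).trans ?_
  gcongr
  refine (fk_sum_le hA ha hm hE).trans ?_
  rw [← Real.exp_nat_mul]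
  refine Real.exp_le_exp.2 ?_
  push_cast
  have : a ^ 2 * t / 2 ≤ (a * ∑ x, m x) ^ 2 / (2 * ∑ i, ∑ j, m i * m j * M.toWGraph.green i j) := by
    rw [le_div_iff₀ (by positivity), mul_pow]
    nlinarith [mul_le_mul_of_nonneg_left hmt (sq_nonneg a)]
  linarith

/-- The two-point function off the cluster of the ghost in terms of `G`. -/
lemma fk_two_point_le (hK : M.toWGraph.Bd K) (hA : A.μ.map Prod.fst = M.P.map (M.field U a))
    (x y : U) {δ : ℝ} (hδ : 0 < δ) :
    A.μ.real {q | FK.Cn q.2 (some x) (some y) ∧ ¬ FK.Cn q.2 (some x) none} ≤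
      A.G {x} x y / δ + 2 * K * δ := by
  have hinteg := fk_integrable hA
  set S : Set ((U → ℝ) × Finset (Option U × Option U)) :=
    {q | FK.Cn q.2 (some x) (some y) ∧ ¬ FK.Cn q.2 (some x) none}
  have hS : MeasurableSet S :=
    FK.measurableSet_snd fun ω => FK.Cn ω (some x) (some y) ∧ ¬ FK.Cn ω (some x) none
  have hT : MeasurableSet {q : (U → ℝ) × Finset (Option U × Option U) | |q.1 x| ≤ δ} :=
    measurableSet_le (continuous_abs.measurable.comp (FK.measurable_eval x)) measurable_const
  rw [← A.integral_abs_cn hinteg x y, ← integral_indicator_one hS]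
  have hi : Integrable (fun q : (U → ℝ) × Finset (Option U × Option U) =>
      if FK.Cn q.2 (some x) (some y) ∧ ¬ FK.Cn q.2 (some x) none then |q.1 x| else 0) A.μ := by
    refine ((hinteg x).abs.indicator hS).congr (Eventually.of_forall fun q => ?_)
    simp only [Set.indicator_apply, S, Set.mem_ofPred_eq]
  refine le_trans (b := ∫ q, ((if FK.Cn q.2 (some x) (some y) ∧ ¬ FK.Cn q.2 (some x) none
      then |q.1 x| else 0) / δ + {q | |q.1 x| ≤ δ}.indicator (fun _ => (1:ℝ)) q) ∂A.μ) ?_ ?_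
  · refine integral_mono ((integrable_const (1:ℝ)).indicator hS)
      ((hi.div_const δ).add ((integrable_const (1:ℝ)).indicator hT)) fun q => ?_
    simp only [Set.indicator_apply, S, Set.mem_ofPred_eq, Pi.one_apply]
    have h1 : 0 ≤ |q.1 x| / δ := by positivity
    split_ifs with h h' h'
    · linarith
    · rw [add_zero, le_div_iff₀ hδ]; linarith
    · simp
    · simp
  · rw [integral_add (hi.div_const δ) ((integrable_const (1:ℝ)).indicator hT), integral_div]
    gcongr
    exact (integral_indicator_one hT).le.trans (fk_small hK hA x hδ.le)

end Model

namespace WGraph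

/-- The set `s` carries, inside `B`, a charge distribution whose squared mass is at least `t` times
its energy. -/
def Charged (M : WGraph) (B : Finset M.V) (t : ℝ) (s : Finset M.V) : Prop :=
  ∃ m : M.V → ℝ, (∀ z, 0 ≤ m z) ∧ (∀ z, z ∉ s → m z = 0) ∧ (∀ z, z ∉ B → m z = 0) ∧
    0 < ∑ z ∈ B, m z ∧
    t * ∑ z ∈ B, ∑ w ∈ B, m z * m w * M.green z w ≤ (∑ z ∈ B, m z) ^ 2

end WGraph

namespace Model

variable {M : Model}

lemma coupling_symm_sum (hS : M.toWGraph.Standing) (hν : 0 < M.ν) {U : Finset M.V}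
    (hU : U.Nonempty) {enc : M.V → ℕ} (henc : Function.Injective enc) (x z : U)
    (hx : M.toWGraph.nbr x ⊆ U) :
    M.coupling U enc (some x, some z) + M.coupling U enc (some z, some x) =
      M.lam x z - if x = z then M.lam x x else 0 := by
  have hp := hS.prec_interior hν hU x z hx
  simp only [coupling]
  rw [hS.prec_symm z x, hp]
  by_cases hxz : x = z
  · subst hxz; simp
  · have : enc x ≠ enc z := fun h => hxz (Subtype.ext (henc h))
    rw [if_neg hxz, if_neg hxz]
    rcases lt_or_gt_of_ne this with h | h
    · rw [if_pos h, if_neg h.not_gt]; ring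
    · rw [if_neg (not_lt.2 h.le), if_pos h]; ring

/-- The two-point functional as a function on vertices of the graph. -/
def walkFun {U : Finset M.V} (A : FK U) (y : U) (s : Finset M.V) (z : M.V) : ℝ :=
  if h : z ∈ U then A.G (Finset.univ.filter fun i : U => i.1 ∈ s) ⟨z, h⟩ y else 0

lemma walkFun_le_sum (hS : M.toWGraph.Standing) (hν : 0 < M.ν) {U : Finset M.V}
    {enc : M.V → ℕ} (henc : Function.Injective enc) {A : FK U} {a : ℝ}
    (hc : A.c = M.coupling U enc) (hD : ∀ x, A.D x = M.toWGraph.prec U x x)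
    (hA : A.μ.map Prod.fst = M.P.map (M.field U a)) {y : U} {s : Finset M.V} {z : M.V}
    (hzs : z ∈ s) (hzU : z ∈ U) (hz : M.toWGraph.nbr z ⊆ U) (hzy : z ≠ y) :
    M.walkFun A y s z ≤
      ∑ w ∈ M.toWGraph.nbr z, M.toWGraph.p z w * M.walkFun A y (insert w s) w := by
  have hU : U.Nonempty := ⟨z, hzU⟩
  have hpos := hS.lamTot_pos z
  set x : U := ⟨z, hzU⟩
  set s' : Finset U := Finset.univ.filter fun i : U => i.1 ∈ s
  have hxs : x ∈ s' := Finset.mem_filter.2 ⟨Finset.mem_univ _, hzs⟩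
  have h : A.D x * A.G s' x y ≤ ∑ w, A.s x (some w) * A.G (insert w s') w y := by
    convert A.D_mul_G_le (fun x => fk_integrable hA x) hxs
      (fun h : x = y => hzy (congrArg Subtype.val h))
  have hins : ∀ w : U, (insert w s' : Finset U) =
      Finset.univ.filter fun i : U => i.1 ∈ insert w.1 s := fun w => Finset.ext fun i => by
    simp only [Finset.mem_insert, Finset.mem_filter, Finset.mem_univ, true_and, s']
    rw [Subtype.ext_iff]
  have hG : ∀ w : U, A.G (insert w s') w y = M.walkFun A y (insert w.1 s) w := fun w => by
    rw [walkFun, dif_pos w.2, hins]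
  have h2 : ∀ w : U, A.s x (some w) * A.G (insert w s') w y =
      M.lam z w * M.walkFun A y (insert w.1 s) w -
        if x = w then M.lam z z * M.walkFun A y s z else 0 := fun w => by
    have e1 : A.s x (some w) = M.lam z w - if x = w then M.lam z z else 0 := by
      rw [FK.s, hc]; exact coupling_symm_sum hS hν hU henc x w hz
    rw [e1, hG, sub_mul]
    congr 1
    split_ifs with hw
    · subst hw; rw [Finset.insert_eq_of_mem hzs]
    · rw [zero_mul]
  have h3 : A.G s' x y = M.walkFun A y s z := by rw [walkFun, dif_pos hzU]
  have h4 : A.D x = M.toWGraph.lamTot z - M.lam z z := by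
    rw [hD, hS.prec_interior hν hU x x hz, if_pos rfl]
  have h5 : ∑ w : U, A.s x (some w) * A.G (insert w s') w y =
      ∑ w ∈ M.toWGraph.nbr z, M.lam z w * M.walkFun A y (insert w s) w -
        M.lam z z * M.walkFun A y s z := by
    simp_rw [h2]
    rw [Finset.sum_sub_distrib, Finset.sum_ite_eq, if_pos (Finset.mem_univ _),
      Finset.sum_coe_sort U fun w => M.lam z w * M.walkFun A y (insert w s) w]
    congr 1
    exact (Finset.sum_subset hz fun w _ hw => by rw [M.toWGraph.lam_eq_zero hw, zero_mul]).symm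
  have h6 : M.toWGraph.lamTot z * M.walkFun A y s z ≤
      ∑ w ∈ M.toWGraph.nbr z, M.lam z w * M.walkFun A y (insert w s) w := by
    rw [h3, h4] at h
    have h7 := h.trans (le_of_eq h5)
    linarith
  refine le_of_mul_le_mul_left (h6.trans (le_of_eq ?_)) hpos
  rw [Finset.mul_sum]
  refine Finset.sum_congr rfl fun w _ => ?_
  rw [← mul_assoc, WGraph.p_mul hS.lamTot_pos]

lemma walkFun_le {U : Finset M.V} {K a : ℝ} {A : FK U} (hK : M.toWGraph.Bd K)
    (hA : A.μ.map Prod.fst = M.P.map (M.field U a)) (ha : 0 ≤ a) (ha1 : a ≤ 1) (y : U)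
    (s : Finset M.V) (z : M.V) : M.walkFun A y s z ≤ K + 2 := by
  rw [walkFun]
  split_ifs with h
  · exact (le_abs_self _).trans (fk_G_le hK hA ha ha1 _ _ _)
  · linarith [hK.one_le]

lemma walkFun_le_exp {U : Finset M.V} {K a : ℝ} {A : FK U} (hK : M.toWGraph.Bd K)
    (hA : A.μ.map Prod.fst = M.P.map (M.field U a)) (ha : 0 ≤ a) (ha1 : a ≤ 1) (y : U)
    {B : Finset M.V} (hB : B ⊆ U) {t : ℝ} {s : Finset M.V} (hs : M.toWGraph.Charged B t s)
    (z : M.V) : M.walkFun A y s z ≤ (K + 2) * Real.exp (-(a ^ 2 * t / 4)) := by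
  obtain ⟨m, hm0, hms, hmB, hmpos, hmt⟩ := hs
  have hK1 := hK.one_le
  rw [walkFun]
  split_ifs with h
  · have e1 : ∑ i : U, m i = ∑ z ∈ B, m z := by
      rw [Finset.sum_coe_sort U m]
      exact (Finset.sum_subset hB fun w _ hw => hmB w hw).symm
    have e2 : ∑ i : U, ∑ j : U, m i * m j * M.toWGraph.green i j =
        ∑ z ∈ B, ∑ w ∈ B, m z * m w * M.toWGraph.green z w := by
      have : ∀ i, ∑ j : U, m i * m j * M.toWGraph.green i j =
          ∑ w ∈ B, m i * m w * M.toWGraph.green i w := fun i => by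
        rw [Finset.sum_coe_sort U fun w => m i * m w * M.toWGraph.green i w]
        exact (Finset.sum_subset hB fun w _ hw => by rw [hmB w hw]; ring).symm
      simp_rw [this]
      rw [Finset.sum_coe_sort U fun z => ∑ w ∈ B, m z * m w * M.toWGraph.green z w]
      refine (Finset.sum_subset hB fun w _ hw => ?_).symm
      exact Finset.sum_eq_zero fun x _ => by rw [hmB w hw]; ring
    have hg := hK.std.green_pos
    have hE : 0 < ∑ z ∈ B, ∑ w ∈ B, m z * m w * M.toWGraph.green z w := by
      obtain ⟨z0, hz0, hz0'⟩ := (Finset.sum_pos_iff_of_nonneg fun z _ => hm0 z).1 hmpos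
      have hnn : ∀ z w, 0 ≤ m z * m w * M.toWGraph.green z w := fun z w =>
        mul_nonneg (mul_nonneg (hm0 _) (hm0 _)) (hg _ _).le
      refine Finset.sum_pos' (fun z _ => Finset.sum_nonneg fun w _ => hnn z w) ⟨z0, hz0, ?_⟩
      refine Finset.sum_pos' (fun w _ => hnn z0 w) ⟨z0, hz0, ?_⟩
      exact mul_pos (mul_pos hz0' hz0') (hg _ _)
    refine (le_abs_self _).trans (fk_G_le_exp hK hA ha ha1 _ _ _ (m := fun i : U => m i) (t := t)
      ?_ ?_ ?_ ?_)
    · intro i hi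
      refine hms _ fun hi' => hi (Finset.mem_filter.2 ⟨Finset.mem_univ _, hi'⟩)
    · rw [e1]; exact hmpos.le
    · rw [e2]; exact hE
    · rw [e1, e2]; exact hmt
  · positivity

end Model

section Bern

variable {E : Type*} [Fintype E] [DecidableEq E]

lemma bern_split (α β : E → ℝ) (F : Finset E → ℝ) (e : E) :
    bern α β F = ∑ ω ∈ Finset.univ.filter (fun ω => e ∉ ω),
      (F ω * β e + F (insert e ω) * α e) *
        ∏ f ∈ Finset.univ.erase e, if f ∈ ω then α f else β f := by
  rw [bern, sum_finset_split e]
  refine Finset.sum_congr rfl fun ω hω => ?_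
  have hω : e ∉ ω := by simpa using hω
  rw [← Finset.mul_prod_erase _ (fun f => if f ∈ ω then α f else β f) (Finset.mem_univ e),
    ← Finset.mul_prod_erase _ (fun f => if f ∈ insert e ω then α f else β f) (Finset.mem_univ e),
    if_neg hω, if_pos (Finset.mem_insert_self _ _)]
  have : (∏ f ∈ Finset.univ.erase e, if f ∈ insert e ω then α f else β f) =
      ∏ f ∈ Finset.univ.erase e, if f ∈ ω then α f else β f :=
    Finset.prod_congr rfl fun f hf => by simp [Finset.ne_of_mem_erase hf]
  rw [this]
  ring

/-- Bernoulli expectations of increasing functionals are monotone in the parameters. -/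
lemma bern_mono {p p' : E → ℝ} {F : Finset E → ℝ} (hF : Monotone F) (h0 : ∀ e, 0 ≤ p e)
    (hp : ∀ e, p e ≤ p' e) (h1 : ∀ e, p' e ≤ 1) :
    bern p (fun e => 1 - p e) F ≤ bern p' (fun e => 1 - p' e) F := by
  have key : ∀ s : Finset E, bern p (fun e => 1 - p e) F ≤
      bern (fun e => if e ∈ s then p' e else p e)
        (fun e => 1 - if e ∈ s then p' e else p e) F := by
    intro s
    induction s using Finset.induction with
    | empty => simp
    | insert e s he ih =>
      refine ih.trans ?_
      rw [bern_split _ _ F e, bern_split _ _ F e]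
      refine Finset.sum_le_sum fun ω hω => ?_
      have e1 : (∏ f ∈ Finset.univ.erase e, if f ∈ ω then (if f ∈ insert e s then p' f else p f)
            else 1 - if f ∈ insert e s then p' f else p f) =
          ∏ f ∈ Finset.univ.erase e, if f ∈ ω then (if f ∈ s then p' f else p f)
            else 1 - if f ∈ s then p' f else p f :=
        Finset.prod_congr rfl fun f hf => by simp [Finset.ne_of_mem_erase hf]
      rw [e1]
      refine mul_le_mul_of_nonneg_right ?_ (Finset.prod_nonneg fun f _ => ?_)
      · rw [if_neg he, if_pos (Finset.mem_insert_self _ _)]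
        have := hF (Finset.subset_insert e ω)
        nlinarith [hp e]
      · have a1 := h0 f
        have a2 := hp f
        have a3 := h1 f
        split_ifs <;> linarith
  have := key Finset.univ
  simpa using this

lemma bern_nonneg {p : E → ℝ} {F : Finset E → ℝ} (hF : ∀ ω, 0 ≤ F ω) (h0 : ∀ e, 0 ≤ p e)
    (h1 : ∀ e, p e ≤ 1) : 0 ≤ bern p (fun e => 1 - p e) F :=
  Finset.sum_nonneg fun ω _ => mul_nonneg (hF ω) (Finset.prod_nonneg fun e _ => by
    split_ifs
    · exact h0 e
    · exact sub_nonneg.2 (h1 e))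

lemma bern_le_one {p : E → ℝ} {F : Finset E → ℝ} (hF : ∀ ω, F ω ≤ 1) (h0 : ∀ e, 0 ≤ p e)
    (h1 : ∀ e, p e ≤ 1) : bern p (fun e => 1 - p e) F ≤ 1 := by
  calc bern p (fun e => 1 - p e) F ≤ bern p (fun e => 1 - p e) fun _ => 1 :=
        Finset.sum_le_sum fun ω _ => mul_le_mul_of_nonneg_right (hF ω)
          (Finset.prod_nonneg fun e _ => by
            split_ifs
            · exact h0 e
            · exact sub_nonneg.2 (h1 e))
    _ = 1 := by rw [bern_one]; simp

/-- Deleting the edges outside `S`. -/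
lemma bern_inter (p : E → ℝ) (F : Finset E → ℝ) (S : Finset E) :
    bern p (fun e => 1 - p e) (fun ω => F (ω ∩ S)) =
      bern (fun e => if e ∈ S then p e else 0) (fun e => 1 - if e ∈ S then p e else 0) F := by
  have h1 : bern p (fun e => 1 - p e) (fun ω => F (ω ∩ S)) =
      bern (fun e => if e ∈ S then p e else 0) (fun e => 1 - if e ∈ S then p e else 0)
        (fun ω => F (ω ∩ S)) := by
    refine bern_congr _ _ _ _ _ fun e ω _ => ?_
    by_cases he : e ∈ S
    · simp [he]
    · simp only [Finset.insert_inter_of_notMem he, if_neg he]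
      ring
  rw [h1]
  refine Finset.sum_congr rfl fun ω _ => ?_
  dsimp only
  by_cases hω : ω ⊆ S
  · rw [Finset.inter_eq_left.2 hω]
  · obtain ⟨e, he, heS⟩ := Finset.not_subset.1 hω
    rw [Finset.prod_eq_zero (Finset.mem_univ e) (by rw [if_pos he, if_neg heS]), mul_zero, mul_zero]

end Bern

namespace FK

variable {V : Type} [Fintype V] (A : FK V)

/-- The probability that an edge is open given the field. -/
def pr (v : V → ℝ) (e : Option V × Option V) : ℝ := 1 - Real.exp (-(2 * max (A.th v e) 0))

lemma pr_nonneg (v : V → ℝ) (e : Option V × Option V) : 0 ≤ A.pr v e :=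
  sub_nonneg.2 (Real.exp_le_one_iff.2 (by have := le_max_right (A.th v e) 0; linarith))

lemma pr_le_one (v : V → ℝ) (e : Option V × Option V) : A.pr v e ≤ 1 :=
  sub_le_self _ (Real.exp_pos _).le

lemma measurable_pr (e : Option V × Option V) : Measurable fun v => A.pr v e := by
  have := A.measurable_th e
  unfold pr
  fun_prop

lemma sum_mul_W (v : V → ℝ) (F : Finset (Option V × Option V) → ℝ) :
    ∑ ω, A.W v ω * F ω = A.dens v * bern (A.pr v) (fun e => 1 - A.pr v e) F := by
  simp_rw [mul_comm (A.W v _)]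
  rw [A.sum_W_mul, dens, Real.exp_sum, mul_assoc, ← bern_smul]
  have h : ∀ t : ℝ, Real.exp (-|t|) = Real.exp t * Real.exp (-(2 * max t 0)) := fun t => by
    rw [← Real.exp_add]
    congr 1
    rcases le_total t 0 with ht | ht
    · rw [abs_of_nonpos ht, max_eq_right ht]; ring
    · rw [abs_of_nonneg ht, max_eq_left ht]; ring
  congr 2
  · funext e
    rw [op, pr, h]; ring
  · funext e
    rw [cl, pr, h]; ring

lemma measurable_bern_pr {F : (V → ℝ) × Finset (Option V × Option V) → ℝ} (hF : Measurable F) :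
    Measurable fun v => bern (A.pr v) (fun e => 1 - A.pr v e) (fun ω => F (v, ω)) := by
  unfold bern
  refine Finset.measurable_fun_sum _ fun ω _ => (hF.comp (by fun_prop)).mul
    (Finset.measurable_fun_prod _ fun e _ => ?_)
  have := A.measurable_pr e
  split_ifs <;> fun_prop

/-- Given the field, the edges are independent. -/
lemma integral_eq_bern {F : (V → ℝ) × Finset (Option V × Option V) → ℝ} (hF : Measurable F)
    (h0 : ∀ q, 0 ≤ F q) (h1 : ∀ q, F q ≤ 1) :
    ∫ q, F q ∂A.μ =
      ∫ q, bern (A.pr q.1) (fun e => 1 - A.pr q.1 e) (fun ω => F (q.1, ω)) ∂A.μ := by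
  have hb0 : ∀ v, 0 ≤ bern (A.pr v) (fun e => 1 - A.pr v e) (fun ω => F (v, ω)) := fun v =>
    bern_nonneg (fun ω => h0 _) (A.pr_nonneg v) (A.pr_le_one v)
  have hb1 : ∀ v, bern (A.pr v) (fun e => 1 - A.pr v e) (fun ω => F (v, ω)) ≤ 1 := fun v =>
    bern_le_one (fun ω => h1 _) (A.pr_nonneg v) (A.pr_le_one v)
  have hi : Integrable F A.μ := Integrable.of_bound hF.aestronglyMeasurable 1
    (Eventually.of_forall fun q => by rw [Real.norm_of_nonneg (h0 q)]; exact h1 q)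
  have hi' : Integrable (fun q : (V → ℝ) × Finset (Option V × Option V) =>
      bern (A.pr q.1) (fun e => 1 - A.pr q.1 e) (fun ω => F (q.1, ω))) A.μ :=
    Integrable.of_bound ((A.measurable_bern_pr hF).comp measurable_fst).aestronglyMeasurable 1
      (Eventually.of_forall fun q => by rw [Real.norm_of_nonneg (hb0 _)]; exact hb1 _)
  obtain ⟨k1, k2⟩ := A.integral_μ hi
  obtain ⟨k3, k4⟩ := A.integral_μ hi'
  rw [k2, k4, ← integral_finsetSum _ fun ω _ => k1 ω, ← integral_finsetSum _ fun ω _ => k3 ω]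
  congr 1
  funext v
  dsimp only
  rw [A.sum_mul_W v fun ω => F (v, ω), ← Finset.sum_mul, A.sum_W]

/-- Given the field, the edges are independent, for an arbitrary decidability instance. -/
lemma integral_eq_bern_of_decidable [inst : DecidableEq (Option V × Option V)]
    {F : (V → ℝ) × Finset (Option V × Option V) → ℝ} (hF : Measurable F)
    (h0 : ∀ q, 0 ≤ F q) (h1 : ∀ q, F q ≤ 1) :
    Integrable (fun q => bern (A.pr q.1) (fun e => 1 - A.pr q.1 e) (fun ω => F (q.1, ω))) A.μ ∧
    ∫ q, F q ∂A.μ =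
      ∫ q, bern (A.pr q.1) (fun e => 1 - A.pr q.1 e) (fun ω => F (q.1, ω)) ∂A.μ := by
  have h : inst = fun a b => instDecidableEqProd a b := Subsingleton.elim _ _
  subst h
  refine ⟨Integrable.of_bound ((A.measurable_bern_pr hF).comp measurable_fst).aestronglyMeasurable 1
    (Eventually.of_forall fun q => ?_), A.integral_eq_bern hF h0 h1⟩
  have hb0 : 0 ≤ bern (A.pr q.1) (fun e => 1 - A.pr q.1 e) (fun ω => F (q.1, ω)) :=
    bern_nonneg (fun ω => h0 _) (A.pr_nonneg q.1) (A.pr_le_one q.1)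
  have hb1 : bern (A.pr q.1) (fun e => 1 - A.pr q.1 e) (fun ω => F (q.1, ω)) ≤ 1 :=
    bern_le_one (fun ω => h1 _) (A.pr_nonneg q.1) (A.pr_le_one q.1)
  exact (Real.norm_of_nonneg hb0).le.trans hb1

end FK

namespace Model

variable (M : Model)

/-- The edges of the graph with an endpoint in the ball of radius `R`, oriented. -/
def arcs (U : Finset M.V) (enc : M.V → ℕ) (o : M.V) (R : ℝ) : Finset (Option U × Option U) :=
  Finset.univ.filter fun e => ∃ u v : U, e = (some u, some v) ∧ enc u < enc v ∧
    (M.d o u ≤ R ∨ M.d o v ≤ R)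

variable {M}

lemma mem_arcs {U : Finset M.V} {enc : M.V → ℕ} {o : M.V} {R : ℝ} {e : Option U × Option U} :
    e ∈ M.arcs U enc o R ↔ ∃ u v : U, e = (some u, some v) ∧ enc u < enc v ∧
      (M.d o u ≤ R ∨ M.d o v ≤ R) := by simp [arcs]

variable (M)

/-- The underlying pair of vertices. -/
def under {U : Finset M.V} (o : M.V) (e : Option U × Option U) : M.V × M.V :=
  (e.1.elim o Subtype.val, e.2.elim o Subtype.val)

/-- The probability that an edge is open in the upper level set of the field. -/
def posPr (U : Finset M.V) (enc : M.V → ℕ) (o : M.V) (R : ℝ) (v : U → ℝ)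
    (e : Option U × Option U) : ℝ :=
  if e ∈ M.arcs U enc o R then 1 - Real.exp (-(2 * M.lam (M.under o e).1 (M.under o e).2 *
    max (e.1.elim 0 v) 0 * max (e.2.elim 0 v) 0)) else 0

/-- The indicator of an arm from `o` leaving the ball of radius `R`. -/
def armF (U : Finset M.V) (o : M.V) (R : ℝ) (ω : Finset (Option U × Option U)) : ℝ :=
  if ∃ x y : U, x.1 = o ∧ R < M.d o y ∧ FK.Cn ω (some x) (some y) then 1 else 0

/-- The probability of an arm given the field. -/
def armP (U : Finset M.V) (enc : M.V → ℕ) (o : M.V) (R : ℝ) (v : U → ℝ) : ℝ :=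
  bern (M.posPr U enc o R v) (fun e => 1 - M.posPr U enc o R v e) (M.armF U o R)

variable {M} {U : Finset M.V} {enc : M.V → ℕ} {o : M.V} {R a K : ℝ}

lemma armF_nonneg (ω : Finset (Option U × Option U)) : 0 ≤ M.armF U o R ω := by
  unfold armF; split_ifs <;> norm_num

lemma armF_le_one (ω : Finset (Option U × Option U)) : M.armF U o R ω ≤ 1 := by
  unfold armF; split_ifs <;> norm_num

lemma armF_mono : Monotone (M.armF U o R) := by
  intro ω ω' h
  unfold armF
  split_ifs with h1 h2
  · exact le_rfl
  · obtain ⟨x, y, hx, hy, hc⟩ := h1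
    exact absurd ⟨x, y, hx, hy, hc.mono h⟩ h2
  · norm_num
  · exact le_rfl

lemma posPr_nonneg (v : U → ℝ) (e : Option U × Option U) : 0 ≤ M.posPr U enc o R v e := by
  unfold posPr
  split_ifs
  · refine sub_nonneg.2 (Real.exp_le_one_iff.2 (neg_nonpos.2 ?_))
    have := M.lam_nonneg (M.under o e).1 (M.under o e).2
    positivity
  · exact le_rfl

lemma posPr_le_one (v : U → ℝ) (e : Option U × Option U) : M.posPr U enc o R v e ≤ 1 := by
  unfold posPr
  split_ifs
  · exact sub_le_self _ (Real.exp_pos _).le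
  · exact zero_le_one

lemma posPr_mono {v w : U → ℝ} (h : ∀ x, v x ≤ w x) (e : Option U × Option U) :
    M.posPr U enc o R v e ≤ M.posPr U enc o R w e := by
  unfold posPr
  have h' : ∀ i : Option U, max (i.elim 0 v) 0 ≤ max (i.elim 0 w) 0 := fun i => by
    cases i with
    | none => exact le_rfl
    | some x => exact max_le_max (h x) le_rfl
  have := M.lam_nonneg (M.under o e).1 (M.under o e).2
  have h1 := h' e.1
  have h2 := h' e.2
  split_ifs
  · gcongr
  · exact le_rfl

lemma measurable_posPr (e : Option U × Option U) :
    Measurable fun v => M.posPr U enc o R v e := by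
  have h' : ∀ i : Option U, Measurable fun v : U → ℝ => i.elim 0 v := fun i => by
    cases i with
    | none => exact measurable_const
    | some x => exact measurable_pi_apply x
  have h1 := h' e.1
  have h2 := h' e.2
  unfold posPr
  split_ifs <;> fun_prop

lemma measurable_armP : Measurable (M.armP U enc o R) := by
  unfold armP bern
  refine Finset.measurable_fun_sum _ fun ω _ => Measurable.const_mul
    (Finset.measurable_fun_prod _ fun e _ => ?_) _
  have := measurable_posPr (M := M) (U := U) (enc := enc) (o := o) (R := R) e
  split_ifs <;> fun_prop

lemma armP_nonneg (v : U → ℝ) : 0 ≤ M.armP U enc o R v :=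
  bern_nonneg armF_nonneg (posPr_nonneg v) (posPr_le_one v)

lemma armP_le_one (v : U → ℝ) : M.armP U enc o R v ≤ 1 :=
  bern_le_one armF_le_one (posPr_nonneg v) (posPr_le_one v)

lemma armP_mono {v w : U → ℝ} (h : ∀ x, v x ≤ w x) :
    M.armP U enc o R v ≤ M.armP U enc o R w :=
  bern_mono armF_mono (posPr_nonneg v) (posPr_mono h) (posPr_le_one w)

lemma under_injOn (o : M.V) : Set.InjOn (M.under o) (M.arcs U enc o R : Set (Option U × Option U)) := by
  intro e he f hf h
  obtain ⟨u, v, rfl, -⟩ := mem_arcs.1 he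
  obtain ⟨u', v', rfl, -⟩ := mem_arcs.1 hf
  simp only [under, Option.elim, Prod.mk.injEq] at h
  rw [Subtype.ext h.1, Subtype.ext h.2]

/-- The open edges, as a finite set. -/
def openArcs (M : Model) (U : Finset M.V) (enc : M.V → ℕ) (o : M.V) (R : ℝ) (ω : M.Ω) :
    Finset (Option U × Option U) :=
  (M.arcs U enc o R).filter fun e => M.opn 0 ω (M.under o e).1 (M.under o e).2

lemma openArcs_eq_iff {ζ : Finset (Option U × Option U)} (hζ : ζ ⊆ M.arcs U enc o R) (ω : M.Ω) :
    M.openArcs U enc o R ω = ζ ↔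
      (∀ e ∈ ζ.image (M.under o), M.opn 0 ω e.1 e.2) ∧
      ∀ e ∈ (M.arcs U enc o R \ ζ).image (M.under o), ¬ M.opn 0 ω e.1 e.2 := by
  simp only [Finset.forall_mem_image, Finset.mem_sdiff, and_imp]
  constructor
  · rintro rfl
    exact ⟨fun e he => (Finset.mem_filter.1 he).2, fun e he hn h => hn (Finset.mem_filter.2 ⟨he, h⟩)⟩
  · rintro ⟨h1, h2⟩
    ext e
    refine ⟨fun he => ?_, fun he => Finset.mem_filter.2 ⟨hζ he, h1 he⟩⟩
    by_contra hn
    exact h2 (Finset.mem_filter.1 he).1 hn (Finset.mem_filter.1 he).2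

lemma measurableSet_openArcs (ζ : Finset (Option U × Option U)) :
    MeasurableSet {ω | M.openArcs U enc o R ω = ζ} := by
  by_cases hζ : ζ ⊆ M.arcs U enc o R
  · simp_rw [openArcs_eq_iff hζ]
    have h : ∀ (s : Finset (M.V × M.V)), MeasurableSet {ω | ∀ e ∈ s, M.opn 0 ω e.1 e.2} := fun s => by
      have : {ω | ∀ e ∈ s, M.opn 0 ω e.1 e.2} = ⋂ e ∈ s, {ω | M.opn 0 ω e.1 e.2} := by ext; simp
      rw [this]
      exact Finset.measurableSet_biInter _ fun e _ => M.opn_meas 0 e.1 e.2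
    have h' : ∀ (s : Finset (M.V × M.V)), MeasurableSet {ω | ∀ e ∈ s, ¬ M.opn 0 ω e.1 e.2} := fun s => by
      have : {ω | ∀ e ∈ s, ¬ M.opn 0 ω e.1 e.2} = ⋂ e ∈ s, {ω | M.opn 0 ω e.1 e.2}ᶜ := by ext; simp
      rw [this]
      exact Finset.measurableSet_biInter _ fun e _ => (M.opn_meas 0 e.1 e.2).compl
    exact (h _).inter (h' _)
  · convert MeasurableSet.empty
    ext ω
    simp only [Set.mem_ofPred_eq, Set.mem_empty_iff_false, iff_false]
    rintro rfl
    exact hζ (Finset.filter_subset _ _)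

lemma measure_openArcs (ζ : Finset (Option U × Option U)) :
    M.P {ω | M.openArcs U enc o R ω = ζ} = ∫⁻ ω, ENNReal.ofReal (∏ e,
      if e ∈ ζ then M.posPr U enc o R (M.field U 0 ω) e
        else 1 - M.posPr U enc o R (M.field U 0 ω) e) ∂M.P := by
  by_cases hζ : ζ ⊆ M.arcs U enc o R
  · have hd : Disjoint (ζ.image (M.under o)) ((M.arcs U enc o R \ ζ).image (M.under o)) := by
      rw [Finset.disjoint_left]
      intro e he he'
      obtain ⟨f, hf, rfl⟩ := Finset.mem_image.1 he
      obtain ⟨f', hf', h⟩ := Finset.mem_image.1 he'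
      rw [Finset.mem_sdiff] at hf'
      have := under_injOn o hf'.1 (hζ hf) h
      exact hf'.2 (this ▸ hf)
    have hm : ∀ e ∈ ζ.image (M.under o) ∪ (M.arcs U enc o R \ ζ).image (M.under o),
        enc e.1 < enc e.2 := by
      intro e he
      rw [← Finset.image_union, Finset.union_sdiff_of_subset hζ] at he
      obtain ⟨f, hf, rfl⟩ := Finset.mem_image.1 he
      obtain ⟨u, v, rfl, huv, -⟩ := mem_arcs.1 hf
      exact huv
    have hl := M.opn_law 0 _ _ hd (fun e he f hf _ h => by
      have h1 := hm e he
      have h2 := hm f hf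
      rw [h] at h1
      exact lt_asymm h1 h2) Set.univ MeasurableSet.univ
    simp only [Set.mem_univ, Set.ofPred_true, Set.univ_inter, Measure.restrict_univ] at hl
    simp_rw [openArcs_eq_iff hζ]
    rw [hl]
    refine lintegral_congr fun ω => congrArg _ ?_
    rw [Finset.prod_image ((under_injOn o).mono hζ),
      Finset.prod_image ((under_injOn o).mono fun e he => (Finset.mem_sdiff.1 he).1)]
    have hval : ∀ e ∈ M.arcs U enc o R, M.posPr U enc o R (M.field U 0 ω) e =
        1 - Real.exp (-(2 * M.lam (M.under o e).1 (M.under o e).2 *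
          max (M.φ ω (M.under o e).1 - 0) 0 * max (M.φ ω (M.under o e).2 - 0) 0)) := by
      intro e he
      rw [posPr, if_pos he]
      obtain ⟨u, v, rfl, -⟩ := mem_arcs.1 he
      simp [field, under]
    rw [← Finset.prod_subset (Finset.subset_univ (M.arcs U enc o R)),
      ← Finset.prod_sdiff hζ, mul_comm]
    · congr 1
      · exact Finset.prod_congr rfl fun e he => by
          rw [if_neg (Finset.mem_sdiff.1 he).2, hval e (Finset.mem_sdiff.1 he).1, sub_sub_cancel]
      · exact Finset.prod_congr rfl fun e he => by rw [if_pos he, hval e (hζ he)]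
    · intro e _ he
      rw [if_neg fun h => he (hζ h), posPr, if_neg he, sub_zero]
  · have : {ω | M.openArcs U enc o R ω = ζ} = ∅ := by
      ext ω
      simp only [Set.mem_ofPred_eq, Set.mem_empty_iff_false, iff_false]
      rintro rfl
      exact hζ (Finset.filter_subset _ _)
    rw [this, measure_empty]
    obtain ⟨e, he, hn⟩ := Finset.not_subset.1 hζ
    symm
    rw [lintegral_eq_zero_iff']
    · refine Eventually.of_forall fun ω => ?_
      have : ∏ e, (if e ∈ ζ then M.posPr U enc o R (M.field U 0 ω) e
        else 1 - M.posPr U enc o R (M.field U 0 ω) e) = 0 :=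
        Finset.prod_eq_zero (Finset.mem_univ e) (by rw [if_pos he, posPr, if_neg hn])
      simp only [this, ENNReal.ofReal_zero, Pi.zero_apply]
    · refine (ENNReal.measurable_ofReal.comp (Finset.measurable_fun_prod _ fun e _ => ?_)).aemeasurable
      have := (measurable_posPr (M := M) (U := U) (enc := enc) (o := o) (R := R) e).comp
        (M.measurable_field U 0)
      simp only [Function.comp_def] at this
      split_ifs <;> fun_prop

/-- The law of a functional of the open edges. -/
lemma integral_openArcs (F : Finset (Option U × Option U) → ℝ) :
    ∫ ω, F (M.openArcs U enc o R ω) ∂M.P = ∫ ω, bern (M.posPr U enc o R (M.field U 0 ω))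
      (fun e => 1 - M.posPr U enc o R (M.field U 0 ω) e) F ∂M.P := by
  have := M.Pprob
  have h1 : ∀ ω, F (M.openArcs U enc o R ω) =
      ∑ ζ, {ω | M.openArcs U enc o R ω = ζ}.indicator (fun _ => F ζ) ω := fun ω => by
    simp [Set.indicator_apply]
  simp_rw [h1]
  rw [integral_finsetSum _ fun ζ _ => (integrable_const _).indicator (measurableSet_openArcs ζ)]
  unfold bern
  have hm : ∀ ζ : Finset (Option U × Option U), Measurable fun ω =>
      ∏ e, if e ∈ ζ then M.posPr U enc o R (M.field U 0 ω) e
        else 1 - M.posPr U enc o R (M.field U 0 ω) e := fun ζ => by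
    refine Finset.measurable_fun_prod _ fun e _ => ?_
    have := (measurable_posPr (M := M) (U := U) (enc := enc) (o := o) (R := R) e).comp
        (M.measurable_field U 0)
    simp only [Function.comp_def] at this
    split_ifs <;> fun_prop
  have h0 : ∀ (ζ : Finset (Option U × Option U)) ω, 0 ≤
      ∏ e, if e ∈ ζ then M.posPr U enc o R (M.field U 0 ω) e
        else 1 - M.posPr U enc o R (M.field U 0 ω) e := fun ζ ω =>
    Finset.prod_nonneg fun e _ => by
      split_ifs
      · exact posPr_nonneg _ _
      · exact sub_nonneg.2 (posPr_le_one _ _)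
  have hle : ∀ (ζ : Finset (Option U × Option U)) ω,
      (∏ e, if e ∈ ζ then M.posPr U enc o R (M.field U 0 ω) e
        else 1 - M.posPr U enc o R (M.field U 0 ω) e) ≤ 1 := fun ζ ω =>
    Finset.prod_le_one (fun e _ => by
      split_ifs
      · exact posPr_nonneg _ _
      · exact sub_nonneg.2 (posPr_le_one _ _)) fun e _ => by
      split_ifs
      · exact posPr_le_one _ _
      · exact sub_le_self _ (posPr_nonneg _ _)
  rw [integral_finsetSum _ fun ζ _ => Integrable.const_mul (Integrable.of_bound
    (hm ζ).aestronglyMeasurable 1 (Eventually.of_forall fun ω => by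
      rw [Real.norm_of_nonneg (h0 ζ ω)]; exact hle ζ ω)) _]
  refine Finset.sum_congr rfl fun ζ _ => ?_
  rw [integral_const_mul, integral_indicator_const _ (measurableSet_openArcs ζ), smul_eq_mul,
    mul_comm, integral_eq_lintegral_of_nonneg_ae (Eventually.of_forall (h0 ζ))
      (hm ζ).aestronglyMeasurable, ← measure_openArcs]
  rfl

end Model

namespace Model

variable {M : Model} {U : Finset M.V} {enc : M.V → ℕ} {o : M.V} {R a K : ℝ}

lemma armF_openArcs (henc : Function.Injective enc) (ho : o ∈ U) (hR : 0 ≤ R)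
    (hU : ∀ z, M.d o z ≤ R → M.toWGraph.nbr z ⊆ U) (ω : M.Ω) :
    M.armF U o R (M.openArcs U enc o R ω) = (M.armEvent o R).indicator (fun _ => 1) ω := by
  have hadj : ∀ u v : U, (some u, some v) ∈ M.openArcs U enc o R ω → M.opn 0 ω u v :=
    fun u v h => (Finset.mem_filter.1 h).2
  have key : (∃ x y : U, x.1 = o ∧ R < M.d o y ∧
      FK.Cn (M.openArcs U enc o R ω) (some x) (some y)) ↔ ω ∈ M.armEvent o R := by
    constructor
    · rintro ⟨x, y, rfl, hy, hc⟩
      refine ⟨y, hy, ?_⟩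
      have : ∀ i, FK.Cn (M.openArcs U enc x R ω) (some x) i → ∀ z, i = some z →
          M.conn 0 ω x z.1 := by
        intro i hi
        induction hi with
        | refl =>
          rintro z hz
          rw [Option.some.inj hz]
          exact Relation.ReflTransGen.refl
        | @tail i j _ hij ih =>
          rintro z rfl
          rcases hij with h | h
          · obtain ⟨u, v, huv, -⟩ := mem_arcs.1 (Finset.mem_filter.1 h).1
            rw [Prod.mk.injEq] at huv
            obtain ⟨rfl, hv⟩ := huv
            exact (ih u rfl).tail (hadj u z h)
          · obtain ⟨u, v, huv, -⟩ := mem_arcs.1 (Finset.mem_filter.1 h).1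
            rw [Prod.mk.injEq] at huv
            obtain ⟨-, rfl⟩ := huv
            exact (ih v rfl).tail (M.opn_symm _ _ _ _ (hadj z v h))
      exact this _ hc y rfl
    · rintro ⟨y, hy, hc⟩
      have : ∀ z, M.conn 0 ω o z →
          (∃ x y : U, x.1 = o ∧ R < M.d o y ∧
            FK.Cn (M.openArcs U enc o R ω) (some x) (some y)) ∨
          (M.d o z ≤ R ∧ ∃ x y : U, x.1 = o ∧ y.1 = z ∧
            FK.Cn (M.openArcs U enc o R ω) (some x) (some y)) := by
        intro z hz
        induction hz with
        | refl =>
          exact Or.inr ⟨by rw [M.d_self]; exact hR, ⟨o, ho⟩, ⟨o, ho⟩, rfl, rfl, FK.Cn.refl⟩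
        | @tail z w _ hzw ih =>
          rcases ih with ih | ⟨hz, x, y, rfl, rfl, hc⟩
          · exact Or.inl ih
          · have hw : w ∈ U := hU _ hz (M.toWGraph.mem_nbr.2 (M.opn_edge _ _ _ _ hzw).ne')
            rcases eq_or_ne y.1 w with rfl | hne
            · exact Or.inr ⟨hz, x, y, rfl, rfl, hc⟩
            replace hne : enc y ≠ enc w := fun h => hne (henc h)
            have hc' : FK.Cn (M.openArcs U enc x R ω) (some x) (some ⟨w, hw⟩) := by
              refine hc.tail ?_
              rcases lt_or_gt_of_ne hne with h | h
              · exact Or.inl (Finset.mem_filter.2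
                  ⟨mem_arcs.2 ⟨y, ⟨w, hw⟩, rfl, h, Or.inl hz⟩, hzw⟩)
              · exact Or.inr (Finset.mem_filter.2
                  ⟨mem_arcs.2 ⟨⟨w, hw⟩, y, rfl, h, Or.inr hz⟩, M.opn_symm _ _ _ _ hzw⟩)
            by_cases hwR : M.d x w ≤ R
            · exact Or.inr ⟨hwR, x, ⟨w, hw⟩, rfl, rfl, hc'⟩
            · exact Or.inl ⟨x, ⟨w, hw⟩, rfl, not_le.1 hwR, hc'⟩
      rcases this y hc with h | ⟨h, -⟩
      · exact h
      · exact absurd hy (not_lt.2 h)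
  unfold armF
  rw [Set.indicator_apply]
  simp only [key]


lemma measurableSet_armEvent (henc : Function.Injective enc) (ho : o ∈ U) (hR : 0 ≤ R)
    (hU : ∀ z, M.d o z ≤ R → M.toWGraph.nbr z ⊆ U) : MeasurableSet (M.armEvent o R) := by
  have : M.armEvent o R = ⋃ ζ ∈ (Finset.univ.filter fun ζ => M.armF U o R ζ = 1),
      {ω | M.openArcs U enc o R ω = ζ} := by
    ext ω
    have h := armF_openArcs henc ho hR hU ω
    by_cases hω : ω ∈ M.armEvent o R
    · simpa [hω] using h
    · have h0 : M.armF U o R (M.openArcs U enc o R ω) = 0 := by simpa [hω] using h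
      simp [hω, h0]
  rw [this]
  exact Finset.measurableSet_biUnion _ fun ζ _ => measurableSet_openArcs ζ

lemma prob_armEvent (henc : Function.Injective enc) (ho : o ∈ U) (hR : 0 ≤ R)
    (hU : ∀ z, M.d o z ≤ R → M.toWGraph.nbr z ⊆ U) :
    M.prob (M.armEvent o R) = ∫ ω, M.armP U enc o R (M.field U 0 ω) ∂M.P := by
  unfold armP
  rw [← integral_openArcs]
  simp_rw [armF_openArcs henc ho hR hU]
  rw [integral_indicator_const _ (measurableSet_armEvent henc ho hR hU), smul_eq_mul, mul_one]
  rfl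

/-- The edges between positive vertices. -/
def posArcs (M : Model) (U : Finset M.V) (enc : M.V → ℕ) (o : M.V) (R : ℝ) (v : U → ℝ) :
    Finset (Option U × Option U) :=
  (M.arcs U enc o R).filter fun e => 0 < e.1.elim 0 v ∧ 0 < e.2.elim 0 v

lemma coupling_arcs (hS : M.toWGraph.Standing) (hν : 0 < M.ν)
    (hU : ∀ z, M.d o z ≤ R → M.toWGraph.nbr z ⊆ U) {u v : U} (huv : enc u < enc v)
    (h : M.d o u ≤ R ∨ M.d o v ≤ R) : M.coupling U enc (some u, some v) = M.lam u v := by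
  have hne : u ≠ v := by rintro rfl; exact lt_irrefl _ huv
  rw [coupling, if_pos huv]
  rcases h with h | h
  · rw [hS.prec_interior hν ⟨u, u.2⟩ u v (hU _ h), if_neg hne]; ring
  · rw [hS.prec_symm, hS.prec_interior hν ⟨u, u.2⟩ v u (hU _ h), if_neg hne.symm, M.lam_symm]
    ring

variable {A : FK U}

lemma posPr_eq (hS : M.toWGraph.Standing) (hν : 0 < M.ν)
    (hU : ∀ z, M.d o z ≤ R → M.toWGraph.nbr z ⊆ U) (hc : A.c = M.coupling U enc) (v : U → ℝ)
    (e : Option U × Option U) :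
    M.posPr U enc o R v e = if e ∈ M.posArcs U enc o R v then A.pr v e else 0 := by
  by_cases he : e ∈ M.arcs U enc o R
  · rw [posPr, if_pos he]
    obtain ⟨x, y, rfl, hxy, h⟩ := mem_arcs.1 he
    by_cases hp : 0 < v x ∧ 0 < v y
    · have : ((some x, some y) : Option U × Option U) ∈ M.posArcs U enc o R v :=
        Finset.mem_filter.2 ⟨he, hp⟩
      rw [if_pos this, FK.pr, FK.th, hc, coupling_arcs hS hν hU hxy h]
      have hl := M.lam_nonneg x y
      simp only [FK.ext, under, Option.elim]
      rw [max_eq_left hp.1.le, max_eq_left hp.2.le,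
        max_eq_left (mul_nonneg (mul_nonneg hl hp.1.le) hp.2.le)]
      ring_nf
    · have : ((some x, some y) : Option U × Option U) ∉ M.posArcs U enc o R v :=
        fun h => hp (Finset.mem_filter.1 h).2
      rw [if_neg this]
      simp only [under, Option.elim]
      rcases not_and_or.1 hp with h | h
      · rw [max_eq_right (not_lt.1 h)]; simp
      · rw [max_eq_right (not_lt.1 h)]; simp
  · have : e ∉ M.posArcs U enc o R v := fun h => he (Finset.mem_filter.1 h).1
    rw [posPr, if_neg he, if_neg this]

lemma integral_armP (hA : A.μ.map Prod.fst = M.P.map (M.field U a)) :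
    ∫ ω, M.armP U enc o R (M.field U a ω) ∂M.P = ∫ q, M.armP U enc o R q.1 ∂A.μ := by
  rw [← integral_map (f := M.armP U enc o R) (M.measurable_field U a).aemeasurable
    measurable_armP.aestronglyMeasurable, ← hA, integral_map measurable_fst.aemeasurable
    measurable_armP.aestronglyMeasurable]

lemma integrable_armP_fst : Integrable (fun q => M.armP U enc o R q.1) A.μ :=
  Integrable.of_bound (measurable_armP.comp measurable_fst).aestronglyMeasurable 1
    (Eventually.of_forall fun q => by
      rw [Real.norm_of_nonneg (armP_nonneg _)]; exact armP_le_one _)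

lemma integrable_armP_field (b : ℝ) :
    Integrable (fun ω => M.armP U enc o R (M.field U b ω)) M.P := by
  have := M.Pprob
  exact Integrable.of_bound (measurable_armP.comp (M.measurable_field U b)).aestronglyMeasurable 1
    (Eventually.of_forall fun q => by
      rw [Real.norm_of_nonneg (armP_nonneg _)]; exact armP_le_one _)

lemma integral_armP_le (hS : M.toWGraph.Standing) (hν : 0 < M.ν)
    (hU : ∀ z, M.d o z ≤ R → M.toWGraph.nbr z ⊆ U) (hc : A.c = M.coupling U enc)
    (hA : A.μ.map Prod.fst = M.P.map (M.field U a)) :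
    ∫ ω, M.armP U enc o R (M.field U a ω) ∂M.P ≤ ∫ q, M.armF U o R q.2 ∂A.μ := by
  have hmF : Measurable fun q : (U → ℝ) × Finset (Option U × Option U) => M.armF U o R q.2 :=
    (measurable_of_countable (M.armF U o R)).comp measurable_snd
  obtain ⟨h1, h2⟩ := A.integral_eq_bern_of_decidable hmF (fun q => armF_nonneg q.2)
    fun q => armF_le_one q.2
  rw [integral_armP hA, h2]
  refine integral_mono integrable_armP_fst h1 fun q => ?_
  refine bern_mono armF_mono (posPr_nonneg _) (fun e => ?_) (A.pr_le_one _)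
  rw [posPr_eq hS hν hU hc]
  split_ifs
  · exact le_rfl
  · exact A.pr_nonneg _ _

lemma measurable_posArcs : Measurable (M.posArcs U enc o R) := by
  have hp : ∀ e : Option U × Option U, MeasurableSet {v : U → ℝ | e ∈ M.posArcs U enc o R v} := by
    intro e
    have h' : ∀ i : Option U, Measurable fun v : U → ℝ => i.elim 0 v := fun i => by
      cases i with
      | none => exact measurable_const
      | some x => exact measurable_pi_apply x
    simp only [posArcs, Finset.mem_filter]
    exact (MeasurableSet.const _).inter ((measurableSet_lt measurable_const (h' _)).inter
      (measurableSet_lt measurable_const (h' _)))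
  refine measurable_to_countable' fun ζ => ?_
  have : M.posArcs U enc o R ⁻¹' {ζ} =
      ⋂ e, if e ∈ ζ then {v : U → ℝ | e ∈ M.posArcs U enc o R v} else
        {v : U → ℝ | e ∈ M.posArcs U enc o R v}ᶜ := by
    ext v
    simp only [Set.mem_preimage, Set.mem_singleton_iff, Set.mem_iInter, Finset.ext_iff]
    refine forall_congr' fun e => ?_
    by_cases he : e ∈ ζ <;> simp [he]
  rw [this]
  refine MeasurableSet.iInter fun e => ?_
  split_ifs
  · exact hp e
  · exact (hp e).compl

/-- A connection to the ghost produces an arm of positive vertices. -/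
lemma cn_none_le (hS : M.toWGraph.Standing) (hν : 0 < M.ν) (ho : o ∈ U) (hR : 0 ≤ R)
    (hU : ∀ z, M.d o z ≤ R → M.toWGraph.nbr z ⊆ U) (hc : A.c = M.coupling U enc) (hAa : A.a = a)
    (ha : 0 < a) (hA : A.μ.map Prod.fst = M.P.map (M.field U a)) :
    A.μ.real {q | FK.Cn q.2 (some ⟨o, ho⟩) none} ≤
      ∫ ω, M.armP U enc o R (M.field U a ω) ∂M.P := by
  have hmF : Measurable fun q : (U → ℝ) × Finset (Option U × Option U) =>
      M.armF U o R (q.2 ∩ M.posArcs U enc o R q.1) := by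
    refine Measurable.comp (g := fun p : Finset (Option U × Option U) ×
      Finset (Option U × Option U) => M.armF U o R (p.1 ∩ p.2))
      (f := fun q : (U → ℝ) × Finset (Option U × Option U) => (q.2, M.posArcs U enc o R q.1))
      (measurable_of_countable _) ?_
    exact measurable_snd.prodMk (measurable_posArcs.comp measurable_fst)
  rw [integral_armP hA]
  have e1 : ∫ q, M.armP U enc o R q.1 ∂A.μ =
      ∫ q, M.armF U o R (q.2 ∩ M.posArcs U enc o R q.1) ∂A.μ := by
    rw [(A.integral_eq_bern_of_decidable hmF (fun q => armF_nonneg _) fun q => armF_le_one _).2]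
    congr 1
    funext q
    have h := bern_inter (A.pr q.1) (M.armF U o R) (M.posArcs U enc o R q.1)
    refine Eq.trans ?_ h.symm
    unfold armP
    have : M.posPr U enc o R q.1 = fun e => if e ∈ M.posArcs U enc o R q.1 then A.pr q.1 e else 0 :=
      funext fun e => posPr_eq hS hν hU hc q.1 e
    rw [this]
  have hms : MeasurableSet {q : (U → ℝ) × Finset (Option U × Option U) |
      FK.Cn q.2 (some ⟨o, ho⟩) none} := FK.measurableSet_snd (V := U) fun ω => FK.Cn ω (some ⟨o, ho⟩) none
  rw [e1, ← integral_indicator_one hms]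
  have hle1 : ∀ q : (U → ℝ) × Finset (Option U × Option U),
      ‖M.armF U o R (q.2 ∩ M.posArcs U enc o R q.1)‖ ≤ 1 := fun q => by
    rw [Real.norm_of_nonneg (armF_nonneg _)]; exact armF_le_one _
  refine integral_mono_ae ((integrable_const 1).indicator hms)
    (Integrable.of_bound hmF.aestronglyMeasurable 1 (Eventually.of_forall hle1)) ?_
  filter_upwards [A.ae_pos, A.ae_sign] with q hpos hsign
  by_cases hq : q ∈ {q : (U → ℝ) × Finset (Option U × Option U) | FK.Cn q.2 (some ⟨o, ho⟩) none}
  swap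
  · rw [Set.indicator_of_notMem hq]; exact armF_nonneg _
  rw [Set.indicator_of_mem hq, Pi.one_apply]
  have hq : FK.Cn q.2 (some ⟨o, ho⟩) none := hq
  have hp : ∀ z : U, FK.Cn q.2 (some ⟨o, ho⟩) (some z) → 0 < q.1 z := by
    intro z hz
    have h := hsign (some z) none (hz.symm.trans hq)
    have : A.ext q.1 none = a := hAa
    rw [this, Real.sign_of_pos ha] at h
    by_contra hn
    rcases (not_lt.1 hn).lt_or_eq with h2 | h2
    · have h3 : Real.sign (A.ext q.1 (some z)) = -1 := Real.sign_of_neg h2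
      linarith
    · have h3 : A.ext q.1 (some z) = 0 := h2
      rw [h3, Real.sign_zero] at h
      linarith
  have key : ∀ i, FK.Cn q.2 (some ⟨o, ho⟩) i →
      (∃ x y : U, x.1 = o ∧ R < M.d o y ∧
        FK.Cn (q.2 ∩ M.posArcs U enc o R q.1) (some x) (some y)) ∨
      (∃ z : U, i = some z ∧ M.d o z ≤ R ∧
        FK.Cn (q.2 ∩ M.posArcs U enc o R q.1) (some ⟨o, ho⟩) (some z)) := by
    intro i hi
    induction hi with
    | refl => exact Or.inr ⟨⟨o, ho⟩, rfl, by rw [M.d_self]; exact hR, FK.Cn.refl⟩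
    | @tail i j hoi hij ih =>
      rcases ih with ih | ⟨z, rfl, hz, hcz⟩
      · exact Or.inl ih
      cases j with
      | none =>
        rcases hij with h | h
        · have := hpos _ h
          simp [FK.th, hc, coupling] at this
        · have := hpos _ h
          have hk := hS.kill_interior hν ⟨z, z.2⟩ z (hU _ hz)
          simp [FK.th, hc, coupling, hk] at this
      | some w =>
        have hpz := hp z hoi
        have hpw := hp w (Relation.ReflTransGen.tail hoi hij)
        have hcw : FK.Cn (q.2 ∩ M.posArcs U enc o R q.1) (some ⟨o, ho⟩) (some w) := by
          refine hcz.tail ?_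
          rcases hij with h | h
          · have hlt : enc z < enc w := by
              by_contra hn
              have := hpos _ h
              simp [FK.th, hc, coupling, hn] at this
            exact Or.inl (Finset.mem_inter.2 ⟨h, Finset.mem_filter.2
              ⟨mem_arcs.2 ⟨z, w, rfl, hlt, Or.inl hz⟩, hpz, hpw⟩⟩)
          · have hlt : enc w < enc z := by
              by_contra hn
              have := hpos _ h
              simp [FK.th, hc, coupling, hn] at this
            exact Or.inr (Finset.mem_inter.2 ⟨h, Finset.mem_filter.2
              ⟨mem_arcs.2 ⟨w, z, rfl, hlt, Or.inr hz⟩, hpw, hpz⟩⟩)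
        by_cases hwR : M.d o w ≤ R
        · exact Or.inr ⟨w, rfl, hwR, hcw⟩
        · exact Or.inl ⟨⟨o, ho⟩, w, rfl, not_le.1 hwR, hcw⟩
  rcases key none hq with h | ⟨z, hz, -⟩
  · unfold armF
    rw [if_pos h]
  · exact absurd hz (by simp)

end Model

namespace Model

variable {M : Model} {U : Finset M.V} {enc : M.V → ℕ} {o : M.V} {R a K : ℝ} {A : FK U}

lemma prob_armEvent_le (hK : M.toWGraph.Bd K) (hν : 0 < M.ν) (henc : Function.Injective enc)
    (ho : o ∈ U) (hR : 0 ≤ R) (hU : ∀ z, M.d o z ≤ R → M.toWGraph.nbr z ⊆ U)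
    (hc : A.c = M.coupling U enc) (hAa : A.a = a) (ha : 0 < a)
    (hA : A.μ.map Prod.fst = M.P.map (M.field U a)) {δ η : ℝ} (hδ : 0 < δ) (hη : 0 ≤ η)
    (hG : ∀ y : U, R < M.d o y → M.walkFun A y {o} o ≤ η) :
    M.prob (M.armEvent o R) ≤ 2 * K * a + U.card * (η / δ + 2 * K * δ) := by
  have hK1 := hK.one_le
  have h1 : M.prob (M.armEvent o R) ≤ ∫ q, M.armF U o R q.2 ∂A.μ := by
    rw [prob_armEvent henc ho hR hU]
    refine (integral_mono (integrable_armP_field 0) (integrable_armP_field a) fun ω =>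
      armP_mono fun x => ?_).trans (integral_armP_le hK.std hν hU hc hA)
    simp only [field]; linarith
  set S0 : Set ((U → ℝ) × Finset (Option U × Option U)) :=
    {q | FK.Cn q.2 (some ⟨o, ho⟩) none} with hS0
  set S : U → Set ((U → ℝ) × Finset (Option U × Option U)) := fun y =>
    {q | FK.Cn q.2 (some ⟨o, ho⟩) (some y) ∧ ¬ FK.Cn q.2 (some ⟨o, ho⟩) none} with hS
  set W : Finset U := Finset.univ.filter fun y => R < M.d o y with hW
  have hm0 : MeasurableSet S0 := FK.measurableSet_snd (V := U) fun ω => FK.Cn ω (some ⟨o, ho⟩) none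
  have hm : ∀ y, MeasurableSet (S y) := fun y => FK.measurableSet_snd (V := U)
    fun ω => FK.Cn ω (some ⟨o, ho⟩) (some y) ∧ ¬ FK.Cn ω (some ⟨o, ho⟩) none
  have hmF : Measurable fun q : (U → ℝ) × Finset (Option U × Option U) => M.armF U o R q.2 :=
    (measurable_of_countable (M.armF U o R)).comp measurable_snd
  have h2 : ∫ q, M.armF U o R q.2 ∂A.μ ≤ A.μ.real S0 + ∑ y ∈ W, A.μ.real (S y) := by
    rw [← integral_indicator_one hm0]
    simp_rw [← fun y => integral_indicator_one (μ := A.μ) (hm y)]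
    have hi : ∀ y, Integrable ((S y).indicator (1 : (U → ℝ) × Finset (Option U × Option U) → ℝ)) A.μ := fun y =>
      (integrable_const (1:ℝ)).indicator (hm y)
    have hi0 : Integrable (S0.indicator (1 : (U → ℝ) × Finset (Option U × Option U) → ℝ)) A.μ := (integrable_const (1:ℝ)).indicator hm0
    rw [← integral_finsetSum _ fun y _ => hi y, ← integral_add hi0 (integrable_finsetSum _ fun y _ => hi y)]
    refine integral_mono (Integrable.of_bound hmF.aestronglyMeasurable 1
      (Eventually.of_forall fun q => ?_)) (hi0.add (integrable_finsetSum _ fun y _ => hi y))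
      fun q => ?_
    · rw [Real.norm_of_nonneg (armF_nonneg _)]; exact armF_le_one _
    · simp only
      have n0 : 0 ≤ S0.indicator (1 : (U → ℝ) × Finset (Option U × Option U) → ℝ) q := Set.indicator_nonneg (fun _ _ => zero_le_one) _
      have n1 : ∀ y ∈ W, 0 ≤ (S y).indicator (1 : (U → ℝ) × Finset (Option U × Option U) → ℝ) q := fun y _ =>
        Set.indicator_nonneg (fun _ _ => zero_le_one) _
      unfold armF
      split_ifs with h
      · obtain ⟨x, y, hx, hy, hc⟩ := h
        have hx' : x = ⟨o, ho⟩ := Subtype.ext hx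
        subst hx'
        by_cases hq : q ∈ S0
        · rw [Set.indicator_of_mem hq]
          exact le_add_of_nonneg_right (Finset.sum_nonneg n1)
        · have hyW : y ∈ W := Finset.mem_filter.2 ⟨Finset.mem_univ _, hy⟩
          have h3 := Finset.single_le_sum n1 hyW
          rw [Set.indicator_of_mem (show q ∈ S y from ⟨hc, hq⟩)] at h3
          simp only [Pi.one_apply] at h3
          linarith
      · exact add_nonneg n0 (Finset.sum_nonneg n1)
  have h3 : A.μ.real S0 ≤ 2 * K * a := (fk_ghost hK hA ha hAa ⟨o, ho⟩).2
  have h4 : ∀ y ∈ W, A.μ.real (S y) ≤ η / δ + 2 * K * δ := by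
    intro y hy
    refine (fk_two_point_le hK hA ⟨o, ho⟩ y hδ).trans ?_
    have h5 := hG y (Finset.mem_filter.1 hy).2
    rw [walkFun, dif_pos ho] at h5
    have e : (Finset.univ.filter fun i : U => i.1 ∈ ({o} : Finset M.V)) = {⟨o, ho⟩} := by
      ext i
      simp [Subtype.ext_iff]
    rw [e] at h5
    gcongr
  have h6 : ∑ y ∈ W, A.μ.real (S y) ≤ U.card * (η / δ + 2 * K * δ) := by
    refine (Finset.sum_le_sum h4).trans ?_
    rw [Finset.sum_const, nsmul_eq_mul]
    have : (W.card : ℝ) ≤ U.card := by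
      have := Finset.card_le_univ W
      rw [Fintype.card_coe] at this
      exact_mod_cast this
    have hpos : 0 ≤ η / δ + 2 * K * δ := by positivity
    exact mul_le_mul_of_nonneg_right this hpos
  linarith

end Model

namespace WGraph

variable {M : WGraph}

/-- The Green potential of the function `k` restricted to `D`. -/
def gpot (M : WGraph) (D : Finset M.V) (k : M.V → ℝ) (z : M.V) : ℝ :=
  ∑ w ∈ D, M.green z w * M.lamTot w * k w

lemma gpot_nonneg (hS : M.Standing) {D : Finset M.V} {k : M.V → ℝ} (hk : ∀ w, 0 ≤ k w) (z : M.V) :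
    0 ≤ M.gpot D k z :=
  Finset.sum_nonneg fun w _ =>
    mul_nonneg (mul_nonneg (hS.green_pos z w).le (M.lamTot_nonneg w)) (hk w)

lemma Standing.sum_p_gpot (hS : M.Standing) (D : Finset M.V) (k : M.V → ℝ) (z : M.V) :
    ∑ w ∈ M.nbr z, M.p z w * M.gpot D k w = M.gpot D k z - if z ∈ D then k z else 0 := by
  simp only [gpot, Finset.mul_sum]
  rw [Finset.sum_comm]
  have h : ∀ y ∈ D, ∑ w ∈ M.nbr z, M.p z w * (M.green w y * M.lamTot y * k y) =
      M.green z y * M.lamTot y * k y - if z = y then k y else 0 := by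
    intro y _
    have h1 := hS.sum_p_green z y
    have h2 : ∑ w ∈ M.nbr z, M.p z w * (M.green w y * M.lamTot y * k y) =
        (∑ w ∈ M.nbr z, M.p z w * M.green w y) * (M.lamTot y * k y) := by
      rw [Finset.sum_mul]
      exact Finset.sum_congr rfl fun w _ => by ring
    rw [h2, h1, sub_mul, ← mul_assoc]
    congr 1
    split_ifs
    · rw [← mul_assoc, inv_mul_cancel₀ (hS.lamTot_pos y).ne', one_mul]
    · rw [zero_mul]
  rw [Finset.sum_congr rfl h, Finset.sum_sub_distrib, Finset.sum_ite_eq]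

/-- The conditional second moment, under the kernel `k`, of the total occupation of `D` by the walk
at `z` with current occupation `m`. -/
def occ (M : WGraph) (D : Finset M.V) (k : M.V → M.V → ℝ) (m : M.V → ℝ) (z : M.V) : ℝ :=
  ∑ w ∈ D, ∑ w' ∈ D, m w * m w' * k w w' + 2 * ∑ w ∈ D, m w * M.gpot D (k w) z +
    2 * M.gpot D (fun w => M.gpot D (k w) w) z

/-- The occupation `m` with one more visit at `z`. -/
def visit (m : M.V → ℝ) (z w : M.V) : ℝ := m w + if w = z then 1 else 0

lemma sum_visit (D : Finset M.V) (m : M.V → ℝ) (z : M.V) (f : M.V → ℝ) :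
    ∑ w ∈ D, visit m z w * f w = ∑ w ∈ D, m w * f w + if z ∈ D then f z else 0 := by
  simp only [visit, add_mul, Finset.sum_add_distrib, ite_mul, one_mul, zero_mul]
  rw [Finset.sum_ite_eq']

lemma Standing.sum_p_occ_le (hS : M.Standing) (D : Finset M.V) {k : M.V → M.V → ℝ}
    (hk : ∀ w w', k w w' = k w' w) (hk0 : ∀ w, 0 ≤ k w w) (m : M.V → ℝ) (z : M.V) :
    ∑ w ∈ M.nbr z, M.p z w * M.occ D k (visit m z) w ≤ M.occ D k m z := by
  have h1 : ∑ w ∈ D, ∑ w' ∈ D, visit m z w * visit m z w' * k w w' =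
      ∑ w ∈ D, ∑ w' ∈ D, m w * m w' * k w w' +
        if z ∈ D then 2 * ∑ w ∈ D, m w * k w z + k z z else 0 := by
    have e : ∀ w, ∑ w' ∈ D, visit m z w * visit m z w' * k w w' =
        visit m z w * (∑ w' ∈ D, m w' * k w w' + if z ∈ D then k w z else 0) := by
      intro w
      rw [← sum_visit, Finset.mul_sum]
      exact Finset.sum_congr rfl fun _ _ => by ring
    simp_rw [e, sum_visit]
    have e2 : ∑ w ∈ D, m w * (∑ w' ∈ D, m w' * k w w' + if z ∈ D then k w z else 0) =
        ∑ w ∈ D, ∑ w' ∈ D, m w * m w' * k w w' + if z ∈ D then ∑ w ∈ D, m w * k w z else 0 := by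
      simp only [mul_add, Finset.sum_add_distrib]
      congr 1
      · refine Finset.sum_congr rfl fun w _ => ?_
        rw [Finset.mul_sum]
        exact Finset.sum_congr rfl fun _ _ => by ring
      · split_ifs <;> simp
    rw [e2]
    split_ifs
    · have e3 : ∑ w ∈ D, m w * k z w = ∑ w ∈ D, m w * k w z :=
        Finset.sum_congr rfl fun w _ => by rw [hk]
      rw [e3]; ring
    · ring
  have h2 : ∑ w ∈ M.nbr z, M.p z w * M.occ D k (visit m z) w =
      ∑ w ∈ D, ∑ w' ∈ D, visit m z w * visit m z w' * k w w' +
      2 * ∑ w ∈ D, visit m z w * (M.gpot D (k w) z - if z ∈ D then k w z else 0) +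
      2 * (M.gpot D (fun w => M.gpot D (k w) w) z - if z ∈ D then M.gpot D (k z) z else 0) := by
    simp only [occ, mul_add, Finset.sum_add_distrib]
    rw [← Finset.sum_mul, sum_p hS.lamTot_pos, one_mul]
    congr 1
    · congr 1
      simp_rw [← hS.sum_p_gpot, Finset.mul_sum]
      rw [Finset.sum_comm]
      refine Finset.sum_congr rfl fun w _ => Finset.sum_congr rfl fun w' _ => by ring
    · rw [← hS.sum_p_gpot, Finset.mul_sum]
      exact Finset.sum_congr rfl fun w _ => by ring
  rw [h2, h1, sum_visit, occ]
  by_cases hz : z ∈ D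
  · simp only [if_pos hz, mul_sub, Finset.sum_sub_distrib]
    linarith [hk0 z]
  · simp only [if_neg hz, sub_zero]
    linarith

/-- A function of a walk carrying extra state which is bounded above, subharmonic while the walk is
in the finite set `B`, and nonpositive outside, is nonpositive. -/
lemma Standing.nonpos_of_subharmonic (hS : M.Standing) {σ : Type*} (pos : σ → M.V)
    (next : σ → M.V → σ) (valid : σ → Prop) (B : Finset M.V) (Φ : σ → ℝ) {C : ℝ}
    (hpos : ∀ s w, pos (next s w) = w)
    (hvalid : ∀ s, valid s → pos s ∈ B → ∀ w ∈ M.nbr (pos s), valid (next s w))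
    (hC : ∀ s, valid s → Φ s ≤ C) (hout : ∀ s, valid s → pos s ∉ B → Φ s ≤ 0)
    (hin : ∀ s, valid s → pos s ∈ B →
      Φ s ≤ ∑ w ∈ M.nbr (pos s), M.p (pos s) w * Φ (next s w)) (s : σ) (hs : valid s) :
    Φ s ≤ 0 := by
  set h : M.V → ℝ := fun z => M.gpot B (fun _ => 1) z + 1 with hh
  have hh1 : ∀ z, 1 ≤ h z := fun z => by
    have := gpot_nonneg hS (D := B) (fun _ => zero_le_one (α := ℝ)) z
    simp only [hh]; linarith
  have hP : ∀ z ∈ B, ∑ w ∈ M.nbr z, M.p z w * h w = h z - 1 := fun z hz => by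
    have := hS.sum_p_gpot B (fun _ => 1) z
    rw [if_pos hz] at this
    simp only [hh, mul_add, Finset.sum_add_distrib, this, mul_one, sum_p hS.lamTot_pos]
    ring
  obtain ⟨H, hH1, hH⟩ : ∃ H : ℝ, 1 ≤ H ∧ ∀ z ∈ B, h z ≤ H := by
    refine ⟨∑ z ∈ B, h z + 1, ?_, fun z hz => ?_⟩
    · have := Finset.sum_nonneg fun z (_ : z ∈ B) => zero_le_one.trans (hh1 z)
      linarith
    · have := Finset.single_le_sum (fun z _ => zero_le_one.trans (hh1 z)) hz
      linarith
  set D := max C 0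
  have hD : 0 ≤ D := le_max_right _ _
  have hρ0 : 0 ≤ 1 - 1 / H := by
    rw [sub_nonneg, div_le_one (by linarith)]; exact hH1
  have hρ1 : 1 - 1 / H < 1 := by
    have : 0 < 1 / H := by positivity
    linarith
  have key : ∀ n : ℕ, ∀ s, valid s → Φ s ≤ D * (1 - 1 / H) ^ n * h (pos s) := by
    intro n
    induction n with
    | zero =>
      intro s hs
      rw [pow_zero, mul_one]
      exact ((hC s hs).trans (le_max_left _ _)).trans (le_mul_of_one_le_right hD (hh1 _))
    | succ n ih =>
      intro s hs
      by_cases hB : pos s ∈ B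
      · calc Φ s ≤ ∑ w ∈ M.nbr (pos s), M.p (pos s) w * Φ (next s w) := hin s hs hB
          _ ≤ ∑ w ∈ M.nbr (pos s), M.p (pos s) w * (D * (1 - 1 / H) ^ n * h w) := by
            refine Finset.sum_le_sum fun w hw => mul_le_mul_of_nonneg_left ?_ (M.p_nonneg _ _)
            have := ih (next s w) (hvalid s hs hB w hw)
            rwa [hpos] at this
          _ = D * (1 - 1 / H) ^ n * (h (pos s) - 1) := by
            rw [← hP _ hB, Finset.mul_sum]
            exact Finset.sum_congr rfl fun w _ => by ring
          _ ≤ D * (1 - 1 / H) ^ n * ((1 - 1 / H) * h (pos s)) := by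
            refine mul_le_mul_of_nonneg_left ?_ (by positivity)
            have : h (pos s) / H ≤ 1 := (div_le_one (by linarith)).2 (hH _ hB)
            have e : (1 - 1 / H) * h (pos s) = h (pos s) - h (pos s) / H := by ring
            linarith
          _ = _ := by ring
      · exact (hout s hs hB).trans (by have := hh1 (pos s); positivity)
  have ht : Tendsto (fun n : ℕ => D * (1 - 1 / H) ^ n * h (pos s)) atTop (𝓝 0) := by
    simpa using ((tendsto_pow_atTop_nhds_zero_of_lt_one hρ0 hρ1).const_mul D).mul_const (h (pos s))
  exact ge_of_tendsto' ht fun n => key n s hs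

end WGraph

namespace WGraph

variable {M : WGraph}

lemma Standing.sq_sum_le_occ (hS : M.Standing) (D : Finset M.V) {m : M.V → ℝ} (hm : ∀ w, 0 ≤ m w)
    {k : M.V → M.V → ℝ} (hk : ∀ w w', 0 ≤ k w w') (z : M.V) :
    ∑ w ∈ D, ∑ w' ∈ D, m w * m w' * k w w' ≤ M.occ D k m z := by
  have h1 : 0 ≤ ∑ w ∈ D, m w * M.gpot D (k w) z :=
    Finset.sum_nonneg fun w _ => mul_nonneg (hm w) (gpot_nonneg hS (hk w) z)
  have h2 : 0 ≤ M.gpot D (fun w => M.gpot D (k w) w) z :=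
    gpot_nonneg hS (fun w => gpot_nonneg hS (hk w) w) z
  rw [occ]; linarith

lemma Standing.occ_zero_le (hS : M.Standing) {D : Finset M.V} {k : M.V → M.V → ℝ} {x : M.V}
    {F G : ℝ} (hG : 0 ≤ G) (hx : M.gpot D (fun _ => 1) x ≤ F)
    (hk : ∀ w ∈ D, M.gpot D (k w) w ≤ G) : M.occ D k (fun _ => 0) x ≤ 2 * F * G := by
  have h1 : M.gpot D (fun w => M.gpot D (k w) w) x ≤ G * M.gpot D (fun _ => 1) x := by
    rw [gpot, gpot, Finset.mul_sum]
    refine Finset.sum_le_sum fun w hw => ?_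
    have := mul_le_mul_of_nonneg_left (hk w hw)
      (mul_nonneg (hS.green_pos x w).le (M.lamTot_nonneg w))
    linarith
  have h2 := mul_le_mul_of_nonneg_left hx hG
  simp only [occ, zero_mul, Finset.sum_const_zero, mul_zero, zero_add]
  linarith

/-- One segment of the walk: crossing `B`, the walk has a chance to charge `D`. -/
lemma Standing.segment (hS : M.Standing) {B D : Finset M.V} {Γ : Finset M.V → M.V → ℝ}
    {x : M.V} {s₀ : Finset M.V} (hx : x ∈ s₀) (hxB : x ∈ B) {fo F G Δ C b e : ℝ} (hfo0 : 0 ≤ fo)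
    (hfo : ∀ z, z ∉ B → M.gpot D (fun _ => 1) z ≤ fo)
    (hΔ : 0 < Δ) (hfx : fo + Δ ≤ M.gpot D (fun _ => 1) x) (hxF : M.gpot D (fun _ => 1) x ≤ F)
    (hF : ∀ w ∈ D, M.gpot D (fun _ => 1) w ≤ F) (hG0 : 0 < G)
    (hG : ∀ w ∈ D, M.gpot D (M.green w) w ≤ G) (hb : 0 ≤ b) (he : 0 ≤ e)
    (hstep : ∀ s, ∀ z ∈ B, z ∈ s → Γ s z ≤ ∑ w ∈ M.nbr z, M.p z w * Γ (insert w s) w)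
    (hC : ∀ s z, Γ s z ≤ C)
    (hexit : ∀ s, ∀ z ∉ B, (∃ y ∈ B, z ∈ M.nbr y) → z ∈ s → Γ s z ≤ b)
    (hch : ∀ s z, M.Charged D (Δ ^ 2 * (Δ ^ 2 / (2 * F ^ 2)) / (128 * F * G)) s → Γ s z ≤ e) :
    Γ s₀ x ≤ (1 - Δ ^ 2 / (2 * F ^ 2) / 4) * b + e := by
  have hF0 : 0 < F := by linarith
  have hΔF : Δ ≤ F := by linarith
  set q := Δ ^ 2 / (2 * F ^ 2) with hq
  have hq0 : 0 < q := by positivity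
  have hq1 : q ≤ 1 / 2 := by
    rw [hq, div_le_iff₀ (by positivity)]
    have := pow_le_pow_left₀ hΔ.le hΔF 2
    linarith
  set s := Δ / (2 * F ^ 2) with hs
  have hs0 : 0 < s := by positivity
  have hsΔ : s * Δ = q := by rw [hs, hq]; ring
  have hsF : s ^ 2 * (2 * F * F) = q := by rw [hs, hq]; field_simp
  set r := q / (8 * F * G) with hr
  have hr0 : 0 < r := by positivity
  have hrF : r * (2 * F * G) = q / 4 := by rw [hr]; field_simp; norm_num
  set f : M.V → ℝ := M.gpot D (fun _ => 1) with hf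
  have hf0 : ∀ z, 0 ≤ f z := gpot_nonneg hS fun _ => zero_le_one
  have hg0 : ∀ w w', 0 ≤ M.green w w' := fun w w' => (hS.green_pos w w').le
  set Θ : (M.V → ℝ) → M.V → ℝ := fun m z =>
    1 - 2 * s * (∑ w ∈ D, m w + f z) + 2 * s * fo + s ^ 2 * M.occ D (fun _ _ => 1) m z +
      r * M.occ D M.green m z with hΘ
  set β := b / (1 - q / 2) with hβ
  have hβ0 : 0 ≤ β := div_nonneg hb (by linarith)
  have hβb : β * (1 - q / 2) = b := div_mul_cancel₀ _ (by linarith)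
  have hone : ∀ m : M.V → ℝ, ∑ w ∈ D, ∑ w' ∈ D, m w * m w' * (1 : ℝ) = (∑ w ∈ D, m w) ^ 2 := by
    intro m
    rw [sq, Finset.sum_mul_sum]
    simp
  have hlow : ∀ m : M.V → ℝ, (∀ w, 0 ≤ m w) → ∀ z,
      (1 - s * ∑ w ∈ D, m w) ^ 2 - 2 * s * f z + 2 * s * fo +
        r * ∑ w ∈ D, ∑ w' ∈ D, m w * m w' * M.green w w' ≤ Θ m z := by
    intro m hm z
    have h1 := hS.sq_sum_le_occ D hm (k := fun _ _ => 1) (fun _ _ => zero_le_one) z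
    have h2 := hS.sq_sum_le_occ D hm hg0 z
    rw [hone] at h1
    have h3 := mul_le_mul_of_nonneg_left h1 (sq_nonneg s)
    have h4 := mul_le_mul_of_nonneg_left h2 hr0.le
    simp only [hΘ]
    nlinarith
  have hmart : ∀ m z, ∑ w ∈ M.nbr z, M.p z w * Θ (visit m z) w ≤ Θ m z := by
    intro m z
    have h1 := hS.sum_p_occ_le D (k := fun _ _ => 1) (fun _ _ => rfl) (fun _ => zero_le_one) m z
    have h2 := hS.sum_p_occ_le D hS.green_symm (fun w => hg0 w w) m z
    have h3 := hS.sum_p_gpot D (fun _ => 1) z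
    have h4 := sum_visit D m z fun _ => 1
    simp only [mul_one] at h4
    have h5 := sum_p hS.lamTot_pos z
    have e1 : ∑ w ∈ M.nbr z, M.p z w * Θ (visit m z) w =
        (1 - 2 * s * ∑ w ∈ D, visit m z w + 2 * s * fo) * ∑ w ∈ M.nbr z, M.p z w -
        2 * s * ∑ w ∈ M.nbr z, M.p z w * f w +
        s ^ 2 * ∑ w ∈ M.nbr z, M.p z w * M.occ D (fun _ _ => 1) (visit m z) w +
        r * ∑ w ∈ M.nbr z, M.p z w * M.occ D M.green (visit m z) w := by
      simp only [Finset.mul_sum, ← Finset.sum_add_distrib, ← Finset.sum_sub_distrib]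
      refine Finset.sum_congr rfl fun w _ => ?_
      simp only [hΘ]
      rw [← Finset.mul_sum]
      ring
    rw [e1, h5, h3, h4]
    have h6 := mul_le_mul_of_nonneg_left h1 (sq_nonneg s)
    have h7 := mul_le_mul_of_nonneg_left h2 hr0.le
    simp only [hΘ, hf] at *
    linarith
  have hmain := hS.nonpos_of_subharmonic
    (σ := Finset M.V × (M.V → ℝ) × M.V) (fun st => st.2.2)
    (fun st w => (insert w st.1, visit st.2.1 st.2.2, w))
    (fun st => st.2.2 ∈ st.1 ∧ (∀ w, 0 ≤ st.2.1 w) ∧ (∀ w, w ∉ st.1 → st.2.1 w = 0) ∧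
      (st.2.2 ∈ B ∨ ∃ y ∈ B, st.2.2 ∈ M.nbr y)) B
    (fun st => Γ st.1 st.2.2 - (β * Θ st.2.1 st.2.2 + e))
    (C := C + β * (2 * s * (fo + ∑ z ∈ B, f z)))
    (fun _ _ => rfl) ?_ ?_ ?_ ?_ (s₀, fun _ => 0, x) ⟨hx, fun _ => le_rfl, fun _ _ => rfl, .inl hxB⟩
  · have h1 := hS.occ_zero_le (k := fun _ _ => 1) hF0.le hxF hF
    have h2 := hS.occ_zero_le hG0.le hxF hG
    have h3 := mul_le_mul_of_nonneg_left h1 (sq_nonneg s)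
    have h4 := mul_le_mul_of_nonneg_left h2 hr0.le
    have h5 : Θ (fun _ => 0) x ≤ 1 - 3 * q / 4 := by
      have h6 : s * (fo + Δ) ≤ s * f x := mul_le_mul_of_nonneg_left hfx hs0.le
      simp only [hΘ, Finset.sum_const_zero]
      linarith
    have h6 : β * Θ (fun _ => 0) x ≤ (1 - q / 4) * b := by
      rw [← hβb]
      have h7 := mul_le_mul_of_nonneg_left h5 hβ0
      nlinarith [mul_nonneg hβ0 (sq_nonneg q)]
    simp only at hmain
    linarith
  · rintro ⟨s1, m, z⟩ ⟨hz, hm, hms, -⟩ hzB w hw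
    refine ⟨Finset.mem_insert_self _ _, fun w' => ?_, fun w' hw' => ?_, .inr ⟨z, hzB, hw⟩⟩
    · have := hm w'
      simp only [visit] at this ⊢
      split_ifs <;> linarith
    · have h1 : w' ∉ s1 := fun h => hw' (Finset.mem_insert_of_mem h)
      have h2 : w' ≠ z := fun h => h1 (h ▸ hz)
      simp only [visit, if_neg h2, add_zero]
      exact hms w' h1
  · rintro ⟨s1, m, z⟩ ⟨hz, hm, hms, hreg⟩
    have h1 : f z ≤ fo + ∑ z ∈ B, f z := by
      by_cases hzB : z ∈ B
      · have := Finset.single_le_sum (fun z _ => hf0 z) hzB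
        linarith
      · have := Finset.sum_nonneg fun z (_ : z ∈ B) => hf0 z
        linarith [hfo z hzB]
    have h2 := hlow m hm z
    have h3 : 0 ≤ r * ∑ w ∈ D, ∑ w' ∈ D, m w * m w' * M.green w w' :=
      mul_nonneg hr0.le (Finset.sum_nonneg fun w _ => Finset.sum_nonneg fun w' _ =>
        mul_nonneg (mul_nonneg (hm w) (hm w')) (hg0 w w'))
    have h4 : -(2 * s * (fo + ∑ z ∈ B, f z)) ≤ Θ m z := by
      have h5 : s * f z ≤ s * (fo + ∑ z ∈ B, f z) := mul_le_mul_of_nonneg_left h1 hs0.le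
      have h6 : 0 ≤ s * fo := by positivity
      linarith [sq_nonneg (1 - s * ∑ w ∈ D, m w)]
    have h5 := mul_le_mul_of_nonneg_left h4 hβ0
    simp only
    linarith [hC s1 z]
  · rintro ⟨s1, m, z⟩ ⟨hz, hm, hms, hreg⟩ hzB
    simp only at hz hm hms hreg hzB ⊢
    have hreg' := hreg.resolve_left hzB
    have h2 := hlow m hm z
    set n := ∑ w ∈ D, m w with hn
    set Q := ∑ w ∈ D, ∑ w' ∈ D, m w * m w' * M.green w w' with hQ
    have hQ0 : 0 ≤ Q := Finset.sum_nonneg fun w _ => Finset.sum_nonneg fun w' _ =>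
        mul_nonneg (mul_nonneg (hm w) (hm w')) (hg0 w w')
    have h3 : (1 - s * n) ^ 2 + r * Q ≤ Θ m z := by
      have := mul_le_mul_of_nonneg_left (hfo z hzB) hs0.le
      linarith
    have h4 : 0 ≤ r * Q := by positivity
    by_cases hgood : Δ / 4 ≤ n ∧ r * Q ≤ 1
    · have hc : M.Charged D (Δ ^ 2 * q / (128 * F * G)) s1 := by
        refine ⟨fun w => if w ∈ D then m w else 0, fun w => ?_, fun w hw => ?_, fun w hw => ?_, ?_, ?_⟩
        · beta_reduce
          split_ifs
          exacts [hm w, le_rfl]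
        · simp [hms w hw]
        · exact if_neg hw
        · rw [Finset.sum_congr rfl fun w hw => if_pos hw]
          linarith [hgood.1]
        · rw [Finset.sum_congr rfl fun w hw => if_pos hw]
          have e1 : ∑ z ∈ D, ∑ w ∈ D, (if z ∈ D then m z else 0) * (if w ∈ D then m w else 0) *
              M.green z w = Q :=
            Finset.sum_congr rfl fun w hw => Finset.sum_congr rfl fun w' hw' => by
              rw [if_pos hw, if_pos hw']
          rw [e1]
          have e2 : Δ ^ 2 * q / (128 * F * G) * Q = Δ ^ 2 / 16 * (r * Q) := by
            rw [hr]; field_simp; ring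
          rw [e2]
          have h5 : Δ ^ 2 / 16 * (r * Q) ≤ Δ ^ 2 / 16 :=
            mul_le_of_le_one_right (by positivity) hgood.2
          have h6 := pow_le_pow_left₀ (by positivity) hgood.1 2
          linarith
      have := hch s1 z hc
      have h7 : 0 ≤ β * Θ m z := mul_nonneg hβ0 (by nlinarith [sq_nonneg (1 - s * n)])
      linarith
    · have h5 : 1 - q / 2 ≤ Θ m z := by
        by_cases h6 : Δ / 4 ≤ n
        · have h7 : 1 < r * Q := by
            by_contra! h8
            exact hgood ⟨h6, h8⟩
          linarith [sq_nonneg (1 - s * n)]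
        · push Not at h6
          have h7 : s * n ≤ q / 4 := by
            have := mul_le_mul_of_nonneg_left h6.le hs0.le
            linarith
          linarith [sq_nonneg (s * n)]
      have h6 := mul_le_mul_of_nonneg_left h5 hβ0
      have h7 := hexit s1 z hzB hreg' hz
      linarith
  · rintro ⟨s1, m, z⟩ ⟨hz, hm, hms, hreg⟩ hzB
    simp only at hz hm hms hreg hzB ⊢
    have h1 := hstep s1 z hzB hz
    have h2 := mul_le_mul_of_nonneg_left (hmart m z) hβ0
    have h5 := sum_p hS.lamTot_pos z
    have e1 : ∑ w ∈ M.nbr z, M.p z w * (Γ (insert w s1) w - (β * Θ (visit m z) w + e)) =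
        ∑ w ∈ M.nbr z, M.p z w * Γ (insert w s1) w -
          (β * ∑ w ∈ M.nbr z, M.p z w * Θ (visit m z) w + e * ∑ w ∈ M.nbr z, M.p z w) := by
      simp only [Finset.mul_sum, ← Finset.sum_add_distrib, ← Finset.sum_sub_distrib]
      exact Finset.sum_congr rfl fun w _ => by ring
    rw [e1, h5]
    linarith

end WGraph

namespace WGraph

variable {M : WGraph} {K : ℝ}

lemma Bd.green_le_const (hK : M.Bd K) (hν : 0 < M.ν) (x y : M.V) : M.green x y ≤ K := by
  by_cases hxy : x = y
  · subst hxy; exact hK.green_self_le x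
  have hpd := (hK.std.posDef_greenMat hν (U := {x, y}) ⟨x, by simp⟩).posSemidef
  have h := hpd.dotProduct_mulVec_nonneg fun i => if i.1 = x then 1 else -1
  have e : ∀ f : M.V → ℝ, ∑ i : ({x, y} : Finset M.V), f i = f x + f y := fun f => by
    rw [Finset.sum_coe_sort ({x, y} : Finset M.V) f, Finset.sum_pair hxy]
  have h2 : 0 ≤ M.green x x - M.green x y - M.green y x + M.green y y := by
    refine h.trans (le_of_eq ?_)
    simp only [dotProduct, Matrix.mulVec, greenMat, Matrix.of_apply, star_trivial]
    rw [e fun i => (if i = x then (1 : ℝ) else -1) *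
      ∑ j : ({x, y} : Finset M.V), M.green i j * if j.1 = x then 1 else -1]
    rw [e fun j => M.green x j * if j = x then 1 else -1,
      e fun j => M.green y j * if j = x then 1 else -1]
    simp only [if_true, if_neg (Ne.symm hxy)]
    ring
  rw [hK.std.green_symm y x] at h2
  linarith [hK.green_self_le x, hK.green_self_le y]

lemma Bd.sum_green_pow_le (hK : M.Bd K) (hν : 0 < M.ν) (s : ℕ) (hs : s * M.ν ≤ M.α) (z : M.V)
    (n : ℕ) :
    ∑ w ∈ M.ballF z (2 ^ n), M.green z w ^ s * M.lamTot w ≤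
      K ^ (s + 1) * 2 ^ M.α * (n + 1) * ((2 : ℝ) ^ n) ^ (M.α - s * M.ν) := by
  have hK1 := hK.one_le
  have hK0 : 0 < K := by linarith
  have hα : 0 ≤ M.α := le_trans (by positivity) hs
  have hg := hK.std.green_pos
  induction n with
  | zero =>
    calc ∑ w ∈ M.ballF z (2 ^ 0), M.green z w ^ s * M.lamTot w
        ≤ ∑ w ∈ M.ballF z (2 ^ 0), K ^ s * M.lamTot w := by
          refine Finset.sum_le_sum fun w _ => mul_le_mul_of_nonneg_right ?_ (M.lamTot_nonneg w)
          exact pow_le_pow_left₀ (hg z w).le (hK.green_le_const hν z w) s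
      _ ≤ K ^ s * (K * 1) := by
          rw [← Finset.mul_sum]
          refine mul_le_mul_of_nonneg_left ?_ (by positivity)
          simpa using hK.vol_le z 1 le_rfl
      _ ≤ _ := by
          have h2 : (1 : ℝ) ≤ 2 ^ M.α := Real.one_le_rpow (by norm_num) hα
          have h3 : K ^ s * (K * 1) = K ^ (s + 1) * 1 := by ring
          rw [h3]
          simp only [pow_zero, Real.one_rpow, Nat.cast_zero, zero_add, mul_one]
          exact le_mul_of_one_le_right (by positivity) h2
  | succ n ih =>
    set ρ : ℝ := 2 ^ n with hρ
    have hρ1 : 1 ≤ ρ := one_le_pow₀ (by norm_num)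
    have hρ0 : 0 < ρ := by linarith
    have hρ2 : (2 : ℝ) ^ (n + 1) = 2 * ρ := by rw [hρ]; ring
    rw [hρ2]
    have hsub : M.ballF z ρ ⊆ M.ballF z (2 * ρ) := fun w hw => by
      rw [hK.std.mem_ballF] at hw ⊢; linarith
    rw [← Finset.sum_sdiff hsub]
    have h1 : ∑ w ∈ M.ballF z (2 * ρ) \ M.ballF z ρ, M.green z w ^ s * M.lamTot w ≤
        K ^ (s + 1) * 2 ^ M.α * ρ ^ (M.α - s * M.ν) := by
      calc ∑ w ∈ M.ballF z (2 * ρ) \ M.ballF z ρ, M.green z w ^ s * M.lamTot w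
          ≤ ∑ w ∈ M.ballF z (2 * ρ) \ M.ballF z ρ, (K * ρ ^ (-M.ν)) ^ s * M.lamTot w := by
            refine Finset.sum_le_sum fun w hw => mul_le_mul_of_nonneg_right ?_ (M.lamTot_nonneg w)
            refine pow_le_pow_left₀ (hg z w).le ?_ s
            have hd : ρ < M.d z w := by
              have := (Finset.mem_sdiff.1 hw).2
              rwa [hK.std.mem_ballF, not_le] at this
            have hne : z ≠ w := by
              rintro rfl
              rw [M.d_self] at hd
              linarith
            refine (hK.green_le z w hne).trans (mul_le_mul_of_nonneg_left ?_ hK0.le)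
            exact Real.rpow_le_rpow_of_nonpos hρ0 hd.le (by linarith)
        _ ≤ (K * ρ ^ (-M.ν)) ^ s * (K * (2 * ρ) ^ M.α) := by
            rw [← Finset.mul_sum]
            refine mul_le_mul_of_nonneg_left ?_ (by positivity)
            refine (Finset.sum_le_sum_of_subset_of_nonneg Finset.sdiff_subset fun w _ _ =>
              M.lamTot_nonneg w).trans (hK.vol_le z _ (by linarith))
        _ = _ := by
            rw [Real.mul_rpow (by norm_num) hρ0.le, mul_pow, ← Real.rpow_mul_natCast hρ0.le,
              show M.α - s * M.ν = M.α + -M.ν * s by ring, Real.rpow_add hρ0]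
            ring
    have h2 : ρ ^ (M.α - s * M.ν) ≤ (2 * ρ) ^ (M.α - s * M.ν) :=
      Real.rpow_le_rpow hρ0.le (by linarith) (by linarith)
    calc _ ≤ K ^ (s + 1) * 2 ^ M.α * ρ ^ (M.α - s * M.ν) +
          K ^ (s + 1) * 2 ^ M.α * (n + 1) * ρ ^ (M.α - s * M.ν) := add_le_add h1 ih
      _ = K ^ (s + 1) * 2 ^ M.α * (n + 1 + 1) * ρ ^ (M.α - s * M.ν) := by ring
      _ ≤ _ := by
        push_cast
        exact mul_le_mul_of_nonneg_left h2 (by positivity)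

lemma Bd.sum_green_pow_ball_le (hK : M.Bd K) (hν : 0 < M.ν) (s : ℕ) (hs : s * M.ν ≤ M.α)
    (hs2 : s ≤ 2) {x w : M.V} (n : ℕ) (hw : w ∈ M.ballF x (2 ^ n)) :
    ∑ w' ∈ M.ballF x (2 ^ n), M.green w w' ^ s * M.lamTot w' ≤
      K ^ 3 * 4 ^ M.α * (n + 2) * ((2 : ℝ) ^ n) ^ (M.α - s * M.ν) := by
  have hK1 := hK.one_le
  have hν' : 0 ≤ s * M.ν := by positivity
  have hsub : M.ballF x (2 ^ n) ⊆ M.ballF w (2 ^ (n + 1)) := fun w' hw' => by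
    rw [hK.std.mem_ballF] at hw hw' ⊢
    have := M.d_triangle w x w'
    rw [M.d_symm w x] at this
    rw [pow_succ]
    linarith
  refine (Finset.sum_le_sum_of_subset_of_nonneg hsub fun w' _ _ => mul_nonneg
    (pow_nonneg (hK.std.green_pos _ _).le _) (M.lamTot_nonneg _)).trans ?_
  refine (hK.sum_green_pow_le hν s hs w (n + 1)).trans ?_
  have h1 : K ^ (s + 1) ≤ K ^ 3 := pow_le_pow_right₀ hK1 (by omega)
  have h2 : ((2 : ℝ) ^ (n + 1)) ^ (M.α - s * M.ν) ≤ 2 ^ M.α * ((2 : ℝ) ^ n) ^ (M.α - s * M.ν) := by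
    rw [pow_succ, mul_comm, Real.mul_rpow (by norm_num) (by positivity)]
    refine mul_le_mul_of_nonneg_right ?_ (by positivity)
    exact Real.rpow_le_rpow_of_exponent_le (by norm_num) (by linarith)
  have h4 : (4 : ℝ) ^ M.α = 2 ^ M.α * 2 ^ M.α := by
    rw [← Real.mul_rpow (by norm_num) (by norm_num)]; norm_num
  rw [h4]
  push_cast
  calc _ ≤ K ^ 3 * 2 ^ M.α * (n + 1 + 1) * (2 ^ M.α * ((2 : ℝ) ^ n) ^ (M.α - s * M.ν)) := by
        gcongr
    _ = _ := by ring

lemma Bd.crossing (hK : M.Bd K) (hν : 1 ≤ M.ν) (hνα : M.ν ≤ M.α / 2) (x : M.V) (n : ℕ)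
    {Γ : Finset M.V → M.V → ℝ} {s₀ : Finset M.V} (hx : x ∈ s₀) {C b e : ℝ} (hb : 0 ≤ b)
    (he : 0 ≤ e)
    (hstep : ∀ s z, M.d x z ≤ (1 + 2 * K ^ 4) * 2 ^ n → z ∈ s →
      Γ s z ≤ ∑ w ∈ M.nbr z, M.p z w * Γ (insert w s) w)
    (hC : ∀ s z, Γ s z ≤ C)
    (hexit : ∀ s z, M.d x z ≤ (1 + 2 * K ^ 4) * 2 ^ n + K → z ∈ s → Γ s z ≤ b)
    (hch : ∀ s z, M.Charged (M.ballF x (2 ^ n))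
      ((8 * K ^ 10 * 4 ^ (2 * M.α))⁻¹ / (512 * K ^ 10 * 4 ^ (2 * M.α)) / (n + 2) ^ 4 *
        ((2 : ℝ) ^ n) ^ M.ν) s → Γ s z ≤ e) :
    Γ s₀ x ≤ (1 - (8 * K ^ 10 * 4 ^ (2 * M.α))⁻¹ / (n + 2) ^ 2 / 4) * b + e := by
  have hK1 := hK.one_le
  have hK0 : 0 < K := by linarith
  have hν0 : 0 < M.ν := by linarith
  set ρ : ℝ := 2 ^ n with hρ
  have hρ1 : 1 ≤ ρ := one_le_pow₀ (by norm_num)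
  have hρ0 : 0 < ρ := by linarith
  have hS := hK.std
  set D := M.ballF x ρ with hD
  set Δ : ℝ := K⁻¹ ^ 2 / 2 * ρ ^ (M.α - M.ν) with hΔ
  set F : ℝ := K ^ 3 * 4 ^ M.α * (n + 2) * ρ ^ (M.α - M.ν) with hF
  set G : ℝ := K ^ 3 * 4 ^ M.α * (n + 2) * ρ ^ (M.α - 2 * M.ν) with hG
  have hΔ0 : 0 < Δ := by positivity
  have hG0 : 0 < G := by positivity
  have hF0 : 0 < F := by positivity
  have hxD : x ∈ D := by rw [hD, hS.mem_ballF, M.d_self]; exact hρ0.le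
  have h4 : (4 : ℝ) ^ (2 * M.α) = (4 ^ M.α) ^ 2 := by
    rw [← Real.rpow_mul_natCast (by norm_num), mul_comm]; norm_num
  have hq : Δ ^ 2 / (2 * F ^ 2) = (8 * K ^ 10 * 4 ^ (2 * M.α))⁻¹ / (n + 2) ^ 2 := by
    rw [h4, hΔ, hF]
    have := (Real.rpow_pos_of_pos hρ0 (M.α - M.ν)).ne'
    have := (Real.rpow_pos_of_pos (show (0 : ℝ) < 4 by norm_num) M.α).ne'
    field_simp
    norm_num
  have ht : Δ ^ 2 * (Δ ^ 2 / (2 * F ^ 2)) / (128 * F * G) =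
      (8 * K ^ 10 * 4 ^ (2 * M.α))⁻¹ / (512 * K ^ 10 * 4 ^ (2 * M.α)) / (n + 2) ^ 4 * ρ ^ M.ν := by
    rw [hq]
    have e1 : ρ ^ M.ν * (ρ ^ (M.α - M.ν) * ρ ^ (M.α - 2 * M.ν)) = (ρ ^ (M.α - M.ν)) ^ 2 := by
      rw [← Real.rpow_add hρ0, ← Real.rpow_add hρ0, ← Real.rpow_mul_natCast hρ0.le]
      congr 1
      push_cast
      ring
    have hp1 := (Real.rpow_pos_of_pos hρ0 (M.α - M.ν)).ne'
    have hp2 := (Real.rpow_pos_of_pos hρ0 (M.α - 2 * M.ν)).ne'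
    have hp3 := (Real.rpow_pos_of_pos (show (0 : ℝ) < 4 by norm_num) M.α).ne'
    rw [div_eq_iff (by positivity), hΔ, hF, hG, h4, mul_pow, ← e1]
    field_simp
    norm_num
  rw [← hq]
  rw [← ht] at hch
  have hgp : ∀ w, M.gpot D (fun _ => 1) w = ∑ w' ∈ D, M.green w w' ^ 1 * M.lamTot w' := fun w => by
    simp only [gpot, mul_one, pow_one]
  have hgp2 : ∀ w, M.gpot D (M.green w) w = ∑ w' ∈ D, M.green w w' ^ 2 * M.lamTot w' := fun w =>
    Finset.sum_congr rfl fun w' _ => by ring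
  have hFb : ∀ w ∈ D, M.gpot D (fun _ => 1) w ≤ F := fun w hw => by
    rw [hgp]
    refine (hK.sum_green_pow_ball_le hν0 1 (by push_cast; linarith) (by norm_num) n hw).trans
      (le_of_eq ?_)
    rw [hF]; push_cast; rw [one_mul]
  have hGb : ∀ w ∈ D, M.gpot D (M.green w) w ≤ G := fun w hw => by
    rw [hgp2]
    refine (hK.sum_green_pow_ball_le hν0 2 (by push_cast; linarith) le_rfl n hw).trans
      (le_of_eq ?_)
    rw [hG]; push_cast; rfl
  have hadd : ρ ^ (-M.ν) * ρ ^ M.α = ρ ^ (M.α - M.ν) := by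
    rw [← Real.rpow_add hρ0]; congr 1; ring
  have hinv : K⁻¹ * K = 1 := inv_mul_cancel₀ hK0.ne'
  refine hS.segment hx (B := M.ballF x ((1 + 2 * K ^ 4) * ρ)) ?_ hΔ0.le ?_ hΔ0 ?_ (hFb x hxD) hFb
    hG0 hGb hb he ?_ hC ?_ hch
  · rw [hS.mem_ballF, M.d_self]; positivity
  · intro z hz
    rw [hS.mem_ballF, not_le] at hz
    have h1 : ∀ w ∈ D, M.green z w ≤ K * (K⁻¹ ^ 4 / 2 * ρ ^ (-M.ν)) := by
      intro w hw
      rw [hD, hS.mem_ballF] at hw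
      have hd : 2 * K ^ 4 * ρ ≤ M.d z w := by
        have := M.d_triangle x w z
        rw [M.d_symm w z] at this
        linarith
      have hpos : 0 < 2 * K ^ 4 * ρ := by positivity
      have hne : z ≠ w := by
        rintro rfl
        rw [M.d_self] at hd
        linarith
      refine (hK.green_le z w hne).trans (mul_le_mul_of_nonneg_left ?_ hK0.le)
      refine (Real.rpow_le_rpow_of_nonpos hpos hd (by linarith)).trans ?_
      rw [Real.mul_rpow (by positivity) hρ0.le]
      refine mul_le_mul_of_nonneg_right ?_ (by positivity)
      have h2 : (1 : ℝ) ≤ 2 * K ^ 4 := by have := one_le_pow₀ (n := 4) hK1; linarith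
      calc (2 * K ^ 4) ^ (-M.ν) ≤ (2 * K ^ 4) ^ (-1 : ℝ) :=
            Real.rpow_le_rpow_of_exponent_le h2 (by linarith)
        _ = K⁻¹ ^ 4 / 2 := by rw [Real.rpow_neg_one, mul_inv, inv_pow]; ring
    rw [gpot]
    calc ∑ w ∈ D, M.green z w * M.lamTot w * 1
        ≤ ∑ w ∈ D, K * (K⁻¹ ^ 4 / 2 * ρ ^ (-M.ν)) * M.lamTot w := by
          refine Finset.sum_le_sum fun w hw => ?_
          rw [mul_one]
          exact mul_le_mul_of_nonneg_right (h1 w hw) (M.lamTot_nonneg w)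
      _ ≤ K * (K⁻¹ ^ 4 / 2 * ρ ^ (-M.ν)) * (K * ρ ^ M.α) := by
          rw [← Finset.mul_sum]
          exact mul_le_mul_of_nonneg_left (hK.vol_le x ρ hρ1) (by positivity)
      _ = (K⁻¹ * K) ^ 2 * (K⁻¹ ^ 2 / 2 * (ρ ^ (-M.ν) * ρ ^ M.α)) := by ring
      _ = Δ := by rw [hinv, hadd, one_pow, one_mul]
  · have h1 : ∀ w ∈ D, K⁻¹ * ρ ^ (-M.ν) ≤ M.green x w := by
      intro w hw
      rw [inv_mul_le_iff₀ hK0]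
      rw [hD, hS.mem_ballF] at hw
      by_cases hxw : x = w
      · subst hxw
        exact (Real.rpow_le_one_of_one_le_of_nonpos hρ1 (by linarith)).trans (hK.le_green_self x)
      · exact (Real.rpow_le_rpow_of_nonpos (M.d_pos x w hxw) hw (by linarith)).trans
          (hK.le_green x w hxw)
    rw [gpot]
    have h2 : K⁻¹ * ρ ^ M.α ≤ ∑ w ∈ D, M.lamTot w := by
      rw [inv_mul_le_iff₀ hK0]
      exact hK.le_vol x ρ hρ1
    calc Δ + Δ = K⁻¹ * ρ ^ (-M.ν) * (K⁻¹ * ρ ^ M.α) := by rw [hΔ, ← hadd]; ring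
      _ ≤ K⁻¹ * ρ ^ (-M.ν) * ∑ w ∈ D, M.lamTot w := mul_le_mul_of_nonneg_left h2 (by positivity)
      _ ≤ _ := by
        rw [Finset.mul_sum]
        refine Finset.sum_le_sum fun w hw => ?_
        rw [mul_one]
        exact mul_le_mul_of_nonneg_right (h1 w hw) (M.lamTot_nonneg w)
  · intro s z hz hzs
    exact hstep s z (hS.mem_ballF.1 hz) hzs
  · rintro s z - ⟨y, hy, hzy⟩ hzs
    refine hexit s z ?_ hzs
    have h1 := hS.mem_ballF.1 hy
    have h2 := hK.nbr_le y z (lt_of_le_of_ne (M.lam_nonneg y z) (Ne.symm ((M.mem_nbr).1 hzy)))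
    linarith [M.d_triangle x y z]

end WGraph

namespace WGraph

variable {M : WGraph} {K : ℝ}

lemma Bd.iterated_crossing (hK : M.Bd K) (hν : 1 ≤ M.ν) (hνα : M.ν ≤ M.α / 2) :
    ∃ κ > 0, κ ≤ 1 ∧ ∃ Λ ≥ 1, ∀ (o : M.V) (R : ℝ) (n : ℕ) (Γ : Finset M.V → M.V → ℝ) (C e : ℝ),
      0 ≤ C → 0 ≤ e →
      (∀ s z, M.d o z ≤ R → z ∈ s → Γ s z ≤ ∑ w ∈ M.nbr z, M.p z w * Γ (insert w s) w) →
      (∀ s z, Γ s z ≤ C) →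
      (∀ D : Finset M.V, (∀ w ∈ D, M.d o w ≤ R) → ∀ s z,
        M.Charged D (κ / (n + 2) ^ 4 * ((2 : ℝ) ^ n) ^ M.ν) s → Γ s z ≤ e) →
      ∀ (N : ℕ) (s : Finset M.V) (z : M.V), z ∈ s → M.d o z + N * (Λ * 2 ^ n) ≤ R →
        Γ s z ≤ C * (1 - κ / (n + 2) ^ 2) ^ N + e * ((n + 2) ^ 2 / κ) := by
  have hK1 := hK.one_le
  have hK0 : 0 < K := by linarith
  set q : ℝ := (8 * K ^ 10 * 4 ^ (2 * M.α))⁻¹ with hq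
  set t : ℝ := q / (512 * K ^ 10 * 4 ^ (2 * M.α)) with ht
  have h4 : (1 : ℝ) ≤ 4 ^ (2 * M.α) := Real.one_le_rpow (by norm_num) (by linarith)
  have hK10 : 1 ≤ K ^ 10 := one_le_pow₀ hK1
  have hKK : 1 ≤ K ^ 10 * 4 ^ (2 * M.α) := one_le_mul_of_one_le_of_one_le hK10 h4
  have hq0 : 0 < q := by positivity
  have hq1 : q ≤ 1 := inv_le_one_of_one_le₀ (by linarith)
  have ht0 : 0 < t := by positivity
  have ht1 : t ≤ q / 4 := by
    refine div_le_div_of_nonneg_left hq0.le (by norm_num) (by linarith)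
  refine ⟨t, ht0, by linarith, 1 + 2 * K ^ 4 + K, by have := pow_pos hK0 4; linarith, ?_⟩
  intro o R n Γ C e hC0 he hstep hC hch N
  set c : ℝ := t / (n + 2) ^ 2 with hc
  have hn2 : (0 : ℝ) < (n + 2) ^ 2 := by positivity
  have hn1 : (1 : ℝ) ≤ (n + 2) ^ 2 := one_le_pow₀ (by linarith [Nat.cast_nonneg (α := ℝ) n])
  have hc0 : 0 < c := by positivity
  have hc1 : c ≤ 1 := (div_le_self ht0.le hn1).trans (by linarith)
  have hcq : c ≤ q / (n + 2) ^ 2 / 4 := by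
    rw [hc, div_right_comm q _ 4]
    exact div_le_div_of_nonneg_right ht1 hn2.le
  have hec : e * ((n + 2) ^ 2 / t) = e / c := by rw [hc]; field_simp
  rw [hec]
  have h2n : (1 : ℝ) ≤ 2 ^ n := one_le_pow₀ (by norm_num)
  induction N with
  | zero =>
    intro s z _ _
    have := div_nonneg he hc0.le
    rw [pow_zero, mul_one]
    linarith [hC s z]
  | succ N ih =>
    intro s z hz hd
    push_cast at hd
    have hb : 0 ≤ C * (1 - c) ^ N + e / c := by
      have : 0 ≤ 1 - c := by linarith
      positivity
    have hN : 0 ≤ (N : ℝ) * ((1 + 2 * K ^ 4 + K) * 2 ^ n) := by positivity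
    have hK2 : K ≤ K * 2 ^ n := le_mul_of_one_le_right hK0.le h2n
    have hexp : (1 + 2 * K ^ 4 + K) * 2 ^ n = (1 + 2 * K ^ 4) * 2 ^ n + K * 2 ^ n := by ring
    have h1 := hK.crossing hν hνα z n hz hb he (Γ := Γ) (C := C) ?_ hC ?_ ?_
    · refine h1.trans ?_
      have h5 := mul_le_mul_of_nonneg_right hcq hb
      have h6 : c * (C * (1 - c) ^ N + e / c) = c * (C * (1 - c) ^ N) + e := by
        rw [mul_add, mul_div_cancel₀ _ hc0.ne']
      have h7 : C * (1 - c) ^ (N + 1) = C * (1 - c) ^ N - c * (C * (1 - c) ^ N) := by ring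
      linarith
    · intro s w hw hws
      refine hstep s w ?_ hws
      linarith [M.d_triangle o z w]
    · intro s w hw hws
      refine ih s w hws ?_
      linarith [M.d_triangle o z w]
    · intro s w hs
      refine hch _ (fun w hw => ?_) s w hs
      rw [hK.std.mem_ballF] at hw
      have : (1 : ℝ) * 2 ^ n ≤ (1 + 2 * K ^ 4) * 2 ^ n := by
        have := pow_pos hK0 4
        gcongr
        linarith
      linarith [M.d_triangle o z w]

end WGraph

namespace Model

variable {M : Model} {U : Finset M.V} {enc : M.V → ℕ} {o : M.V} {R a K : ℝ} {A : FK U}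

lemma walkFun_decay (hK : M.toWGraph.Bd K) (hν : 1 ≤ M.ν) (hνα : M.ν ≤ M.α / 2) :
    ∃ κ > 0, κ ≤ 1 ∧ ∃ Λ ≥ 1, ∀ (o : M.V) (R a : ℝ) (n N : ℕ) (U : Finset M.V) (enc : M.V → ℕ)
      (A : FK U) (y : U), Function.Injective enc → A.c = M.coupling U enc →
      (∀ x, A.D x = M.toWGraph.prec U x x) → A.μ.map Prod.fst = M.P.map (M.field U a) →
      0 ≤ a → a ≤ 1 → (∀ z, M.d o z ≤ R → z ∈ U ∧ M.toWGraph.nbr z ⊆ U) → R < M.d o y →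
      N * (Λ * 2 ^ n) ≤ R →
      M.walkFun A y {o} o ≤ (K + 2) * ((1 - κ / (n + 2) ^ 2) ^ N +
        Real.exp (-(a ^ 2 * (κ / (n + 2) ^ 4 * ((2 : ℝ) ^ n) ^ M.ν) / 4)) * ((n + 2) ^ 2 / κ)) := by
  obtain ⟨κ, hκ0, hκ1, Λ, hΛ, h⟩ := hK.iterated_crossing hν hνα
  have hK1 := hK.one_le
  refine ⟨κ, hκ0, hκ1, Λ, hΛ, ?_⟩
  intro o R a n N U enc A y henc hc hD hA ha ha1 hU hy hN
  have h1 := h o R n (M.walkFun A y) (K + 2)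
    ((K + 2) * Real.exp (-(a ^ 2 * (κ / (n + 2) ^ 4 * ((2 : ℝ) ^ n) ^ M.ν) / 4)))
    (by linarith) (by positivity)
    (fun s z hz hzs => walkFun_le_sum hK.std (by linarith) henc hc hD hA hzs (hU z hz).1 (hU z hz).2
      (by rintro rfl; exact absurd hz (not_le.2 hy)))
    (fun s z => walkFun_le hK hA ha ha1 y s z)
    (fun D hD s z hs => walkFun_le_exp hK hA ha ha1 y (fun w hw => (hU w (hD w hw)).1) hs z)
    N {o} o (Finset.mem_singleton_self o) (by rw [M.d_self]; linarith)
  refine h1.trans (le_of_eq (by ring))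

end Model

namespace Model

variable {M : Model} {U : Finset M.V} {enc : M.V → ℕ} {o : M.V} {R a K : ℝ}

lemma gaussDens_shift (hS : M.toWGraph.Standing) (a : ℝ) (v : U → ℝ) :
    M.gaussDens U a v = M.gaussDens U 0 v *
      Real.exp (a * ∑ x, M.toWGraph.kill U x * v x - a ^ 2 * (∑ x, M.toWGraph.kill U x) / 2) := by
  rw [gaussDens, gaussDens, ← Real.exp_add]
  congr 1
  have e : ∑ i, ∑ j, (v i - a) * M.toWGraph.prec U i j * (v j - a) =
      ∑ i, ∑ j, (v i - 0) * M.toWGraph.prec U i j * (v j - 0) -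
        2 * a * ∑ x, M.toWGraph.kill U x * v x + a ^ 2 * ∑ x, M.toWGraph.kill U x := by
    have e1 : ∑ x, M.toWGraph.kill U x * v x = ∑ i, ∑ j, M.toWGraph.prec U i j * v i := by
      simp only [WGraph.kill, Finset.sum_mul]
    have e2 : ∑ x, M.toWGraph.kill U x * v x = ∑ i, ∑ j, M.toWGraph.prec U i j * v j := by
      rw [e1, Finset.sum_comm]
      exact Finset.sum_congr rfl fun i _ => Finset.sum_congr rfl fun j _ => by
        rw [hS.prec_symm j i]
    have e3 : 2 * a * ∑ x, M.toWGraph.kill U x * v x =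
        a * ∑ x, M.toWGraph.kill U x * v x + a * ∑ x, M.toWGraph.kill U x * v x := by ring
    rw [e3]
    nth_rewrite 1 [e1]
    rw [e2]
    simp only [WGraph.kill, Finset.mul_sum, ← Finset.sum_add_distrib, ← Finset.sum_sub_distrib]
    exact Finset.sum_congr rfl fun i _ => Finset.sum_congr rfl fun j _ => by ring
  rw [e]; ring

lemma integral_field_le (hS : M.toWGraph.Standing) (hν : 0 < M.ν) (hU : U.Nonempty)
    {f : (U → ℝ) → ℝ} (hf : Measurable f) (hf0 : ∀ v, 0 ≤ f v) (hf1 : ∀ v, f v ≤ 1) (a : ℝ) {T : ℝ}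
    (hT : 0 < T) {p : ℕ} (hpp : 0 < p) :
    ∫ ω, f (M.field U a ω) ∂M.P ≤ T * ∫ ω, f (M.field U 0 ω) ∂M.P +
      T / T ^ p * Real.exp ((p ^ 2 - p) * (a ^ 2 * (∑ x, M.toWGraph.kill U x) / 2)) := by
  have := M.Pprob
  obtain ⟨Z, hZ, hd⟩ := M.exists_field_density hS hν hU
  have hgm : ∀ b, Measurable fun v => Z * M.gaussDens U b v := fun b =>
    (M.gaussDens_meas U b).const_mul Z
  have hg0 : ∀ b v, 0 ≤ Z * M.gaussDens U b v := fun b v => mul_nonneg hZ.le (Real.exp_pos _).le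
  have hprob : ∀ b, IsProbabilityMeasure (M.P.map (M.field U b)) := fun b =>
    Measure.isProbabilityMeasure_map (M.measurable_field U b).aemeasurable
  have key : ∀ b, ∀ g : (U → ℝ) → ℝ, Measurable g → (∀ v, 0 ≤ g v) → (∀ v, g v ≤ 1) →
      Integrable (fun v => Z * M.gaussDens U b v * g v) ∧
      ∫ ω, g (M.field U b ω) ∂M.P = ∫ v, Z * M.gaussDens U b v * g v := by
    intro b g hg hg0' hg1
    have hi : Integrable g (M.P.map (M.field U b)) := by
      have := hprob b
      exact Integrable.of_bound hg.aestronglyMeasurable 1 (Eventually.of_forall fun v => by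
        rw [Real.norm_of_nonneg (hg0' v)]; exact hg1 v)
    have hlt : ∀ᵐ v : U → ℝ, ENNReal.ofReal (Z * M.gaussDens U b v) < ⊤ :=
      Eventually.of_forall fun v => ENNReal.ofReal_lt_top
    have htr : ∀ v, (ENNReal.ofReal (Z * M.gaussDens U b v)).toReal = Z * M.gaussDens U b v :=
      fun v => ENNReal.toReal_ofReal (hg0 b v)
    rw [← integral_map (M.measurable_field U b).aemeasurable hg.aestronglyMeasurable]
    rw [hd b] at hi ⊢
    rw [integral_withDensity_eq_integral_toReal_smul (hgm b).ennreal_ofReal hlt]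
    rw [integrable_withDensity_iff (hgm b).ennreal_ofReal hlt] at hi
    simp only [htr, smul_eq_mul] at hi ⊢
    exact ⟨hi.congr (Eventually.of_forall fun v => mul_comm _ _), trivial⟩
  obtain ⟨i1, e1⟩ := key a f hf hf0 hf1
  obtain ⟨i2, e2⟩ := key 0 f hf hf0 hf1
  obtain ⟨i3, e3⟩ := key (p * a) (fun _ => 1) measurable_const (fun _ => zero_le_one) fun _ => le_rfl
  simp only [integral_const, probReal_univ, smul_eq_mul, mul_one] at e3 i3
  set cap := ∑ x, M.toWGraph.kill U x
  set E := Real.exp ((p ^ 2 - p) * (a ^ 2 * cap / 2))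
  have hpt : ∀ v, Z * M.gaussDens U a v * f v ≤
      T * (Z * M.gaussDens U 0 v * f v) + T / T ^ p * E * (Z * M.gaussDens U (p * a) v) := by
    intro v
    set X := ∑ x, M.toWGraph.kill U x * v x
    set δ := Real.exp (a * X - a ^ 2 * cap / 2) with hδ
    have h1 : M.gaussDens U a v = M.gaussDens U 0 v * δ := gaussDens_shift hS a v
    have h2 : E * M.gaussDens U (p * a) v = M.gaussDens U 0 v * δ ^ p := by
      rw [gaussDens_shift hS (p * a) v, mul_left_comm, ← Real.exp_add, hδ, ← Real.exp_nat_mul]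
      congr 2
      ring
    have hg : 0 ≤ Z * M.gaussDens U 0 v := hg0 0 v
    have hδ0 : 0 < δ := Real.exp_pos _
    have h3 : δ * f v ≤ T * f v + T / T ^ p * δ ^ p := by
      by_cases hp : δ ≤ T
      · have := mul_le_mul_of_nonneg_right hp (hf0 v)
        have : 0 ≤ T / T ^ p * δ ^ p := by positivity
        linarith
      · push Not at hp
        have h4 : δ ≤ T / T ^ p * δ ^ p := by
          obtain ⟨k, rfl⟩ : ∃ k, p = k + 1 := ⟨p - 1, by omega⟩
          have h5 : T ^ k ≤ δ ^ k := pow_le_pow_left₀ hT.le hp.le k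
          rw [div_mul_eq_mul_div, le_div_iff₀ (by positivity)]
          calc δ * T ^ (k + 1) = T * δ * T ^ k := by ring
            _ ≤ T * δ * δ ^ k := by gcongr
            _ = _ := by ring
        have h6 := mul_le_of_le_one_right hδ0.le (hf1 v)
        have := mul_nonneg hT.le (hf0 v)
        linarith
    have h4 := mul_le_mul_of_nonneg_left h3 hg
    rw [h1]
    have h5 : T / T ^ p * E * (Z * M.gaussDens U (p * a) v) =
        T / T ^ p * (Z * (E * M.gaussDens U (p * a) v)) := by ring
    rw [h5, h2]
    linarith
  rw [e1, e2]
  have hfin := integral_mono i1 ((i2.const_mul T).add (i3.const_mul (T / T ^ p * E))) hpt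
  simp only [Pi.add_apply] at hfin
  rw [integral_add (i2.const_mul T) (i3.const_mul _), integral_const_mul, integral_const_mul,
    ← e3, mul_one] at hfin
  exact hfin

lemma le_prob_armEvent (hK : M.toWGraph.Bd K) (hν : 0 < M.ν) (henc : Function.Injective enc)
    (ho : o ∈ U) (hR : 0 ≤ R) (hU : ∀ z, M.d o z ≤ R → M.toWGraph.nbr z ⊆ U)
    (hUR : ∀ y ∈ U, M.d o y ≤ R + K) (ha : 0 < a) (ha1 : a ≤ 1) {T : ℝ} (hT : 0 < T) {p : ℕ}
    (hp : 0 < p) :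
    (√(2 * π * K))⁻¹ * Real.exp (-K) * a ≤ T * M.prob (M.armEvent o R) +
      T / T ^ p * Real.exp (p ^ 2 * (a ^ 2 * (K * (R + K) ^ M.ν))) := by
  have hK1 := hK.one_le
  have hne : U.Nonempty := ⟨o, ho⟩
  obtain ⟨A, hAa, hc, hD, hA⟩ := M.exists_fk hK.std hν hne henc a
  have h1 := (fk_ghost hK hA ha hAa ⟨o, ho⟩).1
  have h2 := cn_none_le hK.std hν ho hR hU hc hAa ha hA
  have hgp := hK.std.green_pos o o
  have h3 := le_gaussianReal_Ioo (v := Real.toNNReal (M.toWGraph.green o o)) hK1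
    (by rw [Real.coe_toNNReal _ hgp.le]; exact hK.le_green_self o)
    (by rw [Real.coe_toNNReal _ hgp.le]; exact hK.green_self_le o) ha.le ha1
  have h4 := integral_field_le hK.std hν hne (f := M.armP U enc o R) measurable_armP
    armP_nonneg armP_le_one a hT hp
  rw [← prob_armEvent henc ho hR hU] at h4
  refine (((h3.trans h1).trans h2).trans h4).trans ?_
  have hcap : ∑ x, M.toWGraph.kill U x ≤ K * (R + K) ^ M.ν := by
    have h5 := hK.std.sum_green_kill hν hne ⟨o, ho⟩
    have hRK : 1 ≤ R + K := by linarith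
    have hpos : (0 : ℝ) < (R + K) ^ M.ν := Real.rpow_pos_of_pos (by linarith) _
    have h6 : ∀ y : U, 1 ≤ K * (R + K) ^ M.ν * M.toWGraph.green o y := by
      intro y
      have h7 : (R + K) ^ (-M.ν) ≤ K * M.toWGraph.green o y := by
        by_cases hoy : o = y
        · rw [← hoy]
          exact (Real.rpow_le_one_of_one_le_of_nonpos hRK (by linarith)).trans (hK.le_green_self o)
        · exact (Real.rpow_le_rpow_of_nonpos (M.d_pos _ _ hoy) (hUR y y.2) (by linarith)).trans
            (hK.le_green _ _ hoy)
      rw [Real.rpow_neg (by linarith)] at h7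
      have := mul_le_mul_of_nonneg_left h7 hpos.le
      rw [mul_inv_cancel₀ hpos.ne'] at this
      linarith
    calc ∑ x, M.toWGraph.kill U x
        ≤ ∑ x : U, K * (R + K) ^ M.ν * M.toWGraph.green o x * M.toWGraph.kill U x :=
          Finset.sum_le_sum fun x _ =>
            le_mul_of_one_le_left (hK.std.kill_nonneg hν hne x) (h6 x)
      _ = K * (R + K) ^ M.ν * ∑ x : U, M.toWGraph.green o x * M.toWGraph.kill U x := by
          rw [Finset.mul_sum]
          exact Finset.sum_congr rfl fun x _ => by ring
      _ = _ := by rw [h5, mul_one]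
  have hcap0 : 0 ≤ ∑ x, M.toWGraph.kill U x :=
    Finset.sum_nonneg fun x _ => hK.std.kill_nonneg hν hne x
  have h8 : ((p : ℝ) ^ 2 - p) * (a ^ 2 * (∑ x, M.toWGraph.kill U x) / 2) ≤
      p ^ 2 * (a ^ 2 * (K * (R + K) ^ M.ν)) := by
    have h9 := mul_le_mul_of_nonneg_left hcap (sq_nonneg a)
    have h10 : 0 ≤ a ^ 2 * ∑ x, M.toWGraph.kill U x := mul_nonneg (sq_nonneg a) hcap0
    have h11 := mul_le_mul_of_nonneg_left h9 (sq_nonneg (p : ℝ))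
    have h12 : 0 ≤ (p : ℝ) * (a ^ 2 * ∑ x, M.toWGraph.kill U x) := by positivity
    have h13 : 0 ≤ (p : ℝ) ^ 2 * (a ^ 2 * ∑ x, M.toWGraph.kill U x) := by positivity
    linarith
  have h9 : T / T ^ p * Real.exp (((p : ℝ) ^ 2 - p) * (a ^ 2 * (∑ x, M.toWGraph.kill U x) / 2)) ≤
      T / T ^ p * Real.exp (p ^ 2 * (a ^ 2 * (K * (R + K) ^ M.ν))) :=
    mul_le_mul_of_nonneg_left (Real.exp_le_exp.2 h8) (by positivity)
  linarith

end Model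

namespace Model

variable {M : Model} {K : ℝ}

lemma card_ballF_le (hK : M.toWGraph.Bd K) (o : M.V) {r : ℝ} (hr : 1 ≤ r) :
    ((M.toWGraph.ballF o r).card : ℝ) ≤ K ^ 2 * r ^ M.α := by
  have hK1 := hK.one_le
  have h1 : ∑ y ∈ M.toWGraph.ballF o r, (1 : ℝ) ≤
      ∑ y ∈ M.toWGraph.ballF o r, K * M.toWGraph.lamTot y :=
    Finset.sum_le_sum fun y _ => hK.le_lamTot y
  rw [Finset.sum_const, nsmul_eq_mul, mul_one, ← Finset.mul_sum] at h1
  have h2 := mul_le_mul_of_nonneg_left (hK.vol_le o r hr) (by linarith : 0 ≤ K)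
  refine (h1.trans h2).trans (le_of_eq (by ring))

lemma ballF_nbr (hK : M.toWGraph.Bd K) {o : M.V} {R : ℝ} (z : M.V) (hz : M.d o z ≤ R) :
    z ∈ M.toWGraph.ballF o (R + K) ∧ M.toWGraph.nbr z ⊆ M.toWGraph.ballF o (R + K) := by
  have hK1 := hK.one_le
  refine ⟨hK.std.mem_ballF.2 (by linarith), fun w hw => hK.std.mem_ballF.2 ?_⟩
  have h2 := hK.nbr_le z w (lt_of_le_of_ne (M.lam_nonneg z w) (Ne.symm (M.toWGraph.mem_nbr.1 hw)))
  linarith [M.d_triangle o z w]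

lemma prob_armEvent_upper (hK : M.toWGraph.Bd K) (hν : 1 ≤ M.ν) (hνα : M.ν ≤ M.α / 2) (o : M.V) :
    ∃ κ > 0, κ ≤ 1 ∧ ∃ Λ ≥ 1, ∀ (R a δ : ℝ) (n N : ℕ), 0 ≤ R → 0 < a → a ≤ 1 → 0 < δ →
      N * (Λ * 2 ^ n) ≤ R →
      M.prob (M.armEvent o R) ≤ 2 * K * a + K ^ 2 * (R + K) ^ M.α *
        ((K + 2) * ((1 - κ / (n + 2) ^ 2) ^ N +
          Real.exp (-(a ^ 2 * (κ / (n + 2) ^ 4 * ((2 : ℝ) ^ n) ^ M.ν) / 4)) * ((n + 2) ^ 2 / κ)) /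
            δ + 2 * K * δ) := by
  obtain ⟨κ, hκ0, hκ1, Λ, hΛ, h⟩ := walkFun_decay hK hν hνα
  have hK1 := hK.one_le
  have hν0 : 0 < M.ν := by linarith
  refine ⟨κ, hκ0, hκ1, Λ, hΛ, fun R a δ n N hR ha ha1 hδ hN => ?_⟩
  have := M.countableV
  obtain ⟨enc, henc⟩ := Countable.exists_injective_nat M.V
  set U := M.toWGraph.ballF o (R + K)
  have ho : o ∈ U := (ballF_nbr hK o (by rw [M.d_self]; exact hR)).1
  obtain ⟨A, hAa, hc, hD, hA⟩ := M.exists_fk hK.std hν0 ⟨o, ho⟩ henc a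
  have hn2 : (1 : ℝ) ≤ (n + 2) ^ 2 := one_le_pow₀ (by linarith [Nat.cast_nonneg (α := ℝ) n])
  have hc1 : 0 ≤ 1 - κ / ((n : ℝ) + 2) ^ 2 := by
    rw [sub_nonneg, div_le_one (by linarith)]
    linarith
  refine (prob_armEvent_le hK hν0 henc ho hR (fun z hz => (ballF_nbr hK z hz).2) hc hAa ha hA hδ
    (by positivity)
    fun y hy => h o R a n N U enc A y henc hc hD hA ha.le ha1 (fun z hz => ballF_nbr hK z hz)
      hy hN).trans ?_
  refine add_le_add le_rfl (mul_le_mul_of_nonneg_right (card_ballF_le hK o (by linarith)) ?_)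
  positivity

lemma prob_armEvent_lower (hK : M.toWGraph.Bd K) (hν : 0 < M.ν) (o : M.V) {R a T : ℝ} {p : ℕ}
    (hR : 0 ≤ R) (ha : 0 < a) (ha1 : a ≤ 1) (hT : 0 < T) (hp : 0 < p) :
    (√(2 * π * K))⁻¹ * Real.exp (-K) * a ≤ T * M.prob (M.armEvent o R) +
      T / T ^ p * Real.exp (p ^ 2 * (a ^ 2 * (K * (R + K) ^ M.ν))) := by
  have := M.countableV
  obtain ⟨enc, henc⟩ := Countable.exists_injective_nat M.V
  exact le_prob_armEvent hK hν henc (ballF_nbr hK o (by rw [M.d_self]; exact hR)).1 hR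
    (fun z hz => (ballF_nbr hK z hz).2) (fun y hy => hK.std.mem_ballF.1 hy) ha ha1 hT hp

end Model

lemma eventually_le_rpow (C : ℝ) {s : ℝ} (hs : 0 < s) : ∀ᶠ R : ℝ in atTop, C ≤ R ^ s :=
  (tendsto_rpow_atTop hs).eventually_ge_atTop C

lemma eventually_rpow_mul_exp_neg_rpow_le (q : ℝ) {s C : ℝ} (hs : 0 < s) (hC : 0 < C) :
    ∀ᶠ R : ℝ in atTop, R ^ q * Real.exp (-R ^ s) ≤ C := by
  have h := (tendsto_rpow_mul_exp_neg_mul_atTop_nhds_zero (q / s) 1 one_pos).comp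
    (tendsto_rpow_atTop hs)
  filter_upwards [h.eventually_le_const hC, eventually_gt_atTop 0] with R hR h0
  simp only [Function.comp, neg_mul, one_mul] at hR
  rwa [← Real.rpow_mul h0.le, mul_div_cancel₀ _ hs.ne'] at hR

namespace Model

variable {M : Model} {K : ℝ}

lemma eventually_le_prob_armEvent (hK : M.toWGraph.Bd K) (hν : 0 < M.ν) (o : M.V) {ε : ℝ}
    (hε : 0 < ε) :
    ∀ᶠ R : ℝ in atTop, R ^ (-(M.ν / 2) - 2 * ε) ≤ M.prob (M.armEvent o R) := by
  have hK1 := hK.one_le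
  set c := (√(2 * π * K))⁻¹ * Real.exp (-K) with hc
  have hc0 : 0 < c := by positivity
  obtain ⟨p, hp⟩ := exists_nat_gt (M.ν / 2 / ε + 2)
  have hp0 : 0 < p := by
    have : (0 : ℝ) < p := lt_trans (by positivity) hp
    exact_mod_cast this
  set E := Real.exp (p ^ 2 * (K * 2 ^ M.ν)) with hE
  filter_upwards [eventually_ge_atTop K, eventually_le_rpow (2 * E / c) hε,
    eventually_le_rpow (2 / c) hε] with R hRK h1 h2
  have hR1 : 1 ≤ R := by linarith
  have hR0 : 0 < R := by linarith
  have h3 := prob_armEvent_lower hK hν o (p := p) (T := R ^ ε) hR0.le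
    (Real.rpow_pos_of_pos hR0 (-(M.ν / 2)))
    (Real.rpow_le_one_of_one_le_of_nonpos hR1 (by linarith)) (by positivity) hp0
  rw [← hc] at h3
  have h4 : (R ^ (-(M.ν / 2))) ^ 2 * (K * (R + K) ^ M.ν) ≤ K * 2 ^ M.ν := by
    have h5 : (R + K) ^ M.ν ≤ 2 ^ M.ν * R ^ M.ν := by
      rw [← Real.mul_rpow (by norm_num) hR0.le]
      exact Real.rpow_le_rpow (by linarith) (by linarith) hν.le
    have h6 : (R ^ (-(M.ν / 2))) ^ 2 * R ^ M.ν = 1 := by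
      rw [← Real.rpow_mul_natCast hR0.le, ← Real.rpow_add hR0]
      convert Real.rpow_zero R using 2
      push_cast; ring
    calc (R ^ (-(M.ν / 2))) ^ 2 * (K * (R + K) ^ M.ν)
        ≤ (R ^ (-(M.ν / 2))) ^ 2 * (K * (2 ^ M.ν * R ^ M.ν)) := by gcongr
      _ = (R ^ (-(M.ν / 2))) ^ 2 * R ^ M.ν * (K * 2 ^ M.ν) := by ring
      _ = _ := by rw [h6, one_mul]
  have h5 : Real.exp (p ^ 2 * ((R ^ (-(M.ν / 2))) ^ 2 * (K * (R + K) ^ M.ν))) ≤ E :=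
    Real.exp_le_exp.2 (mul_le_mul_of_nonneg_left h4 (by positivity))
  have h6 : R ^ ε / (R ^ ε) ^ p ≤ R ^ (-(M.ν / 2)) * R ^ (-ε) := by
    rw [← Real.rpow_mul_natCast hR0.le, ← Real.rpow_sub hR0, ← Real.rpow_add hR0]
    refine Real.rpow_le_rpow_of_exponent_le hR1 ?_
    have h7 := mul_lt_mul_of_pos_left hp hε
    have h8 : ε * (M.ν / 2 / ε + 2) = M.ν / 2 + ε * 2 := by field_simp
    linarith
  have hRε : 0 < R ^ ε := by positivity
  have hinv : R ^ ε * R ^ (-ε) = 1 := by rw [← Real.rpow_add hR0, add_neg_cancel, Real.rpow_zero]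
  have hRn : 0 < R ^ (-ε) := by positivity
  have hRν : 0 < R ^ (-(M.ν / 2)) := by positivity
  have h7 : R ^ ε / (R ^ ε) ^ p *
      Real.exp (p ^ 2 * ((R ^ (-(M.ν / 2))) ^ 2 * (K * (R + K) ^ M.ν))) ≤
      c / 2 * R ^ (-(M.ν / 2)) := by
    refine (mul_le_mul h6 h5 (Real.exp_pos _).le (by positivity)).trans ?_
    have h8 : E * R ^ (-ε) ≤ c / 2 := by
      rw [div_le_iff₀ hc0] at h1
      have := mul_le_mul_of_nonneg_right h1 hRn.le
      have e : R ^ ε * c * R ^ (-ε) = c := by rw [mul_right_comm, hinv, one_mul]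
      linarith
    have := mul_le_mul_of_nonneg_left h8 hRν.le
    linarith
  have h8 : c / 2 * R ^ (-(M.ν / 2)) ≤ R ^ ε * M.prob (M.armEvent o R) := by linarith
  have h9 : R ^ (-(M.ν / 2) - 2 * ε) = R ^ (-(M.ν / 2)) * R ^ (-ε) * R ^ (-ε) := by
    rw [← Real.rpow_add hR0, ← Real.rpow_add hR0]; congr 1; ring
  have h10 : R ^ (-ε) ≤ c / 2 := by
    rw [div_le_iff₀ hc0] at h2
    have := mul_le_mul_of_nonneg_right h2 hRn.le
    have e : R ^ ε * c * R ^ (-ε) = c := by rw [mul_right_comm, hinv, one_mul]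
    linarith
  rw [h9]
  calc R ^ (-(M.ν / 2)) * R ^ (-ε) * R ^ (-ε) ≤ R ^ (-(M.ν / 2)) * (c / 2) * R ^ (-ε) := by gcongr
    _ = c / 2 * R ^ (-(M.ν / 2)) * R ^ (-ε) := by ring
    _ ≤ R ^ ε * M.prob (M.armEvent o R) * R ^ (-ε) := by gcongr
    _ = R ^ ε * R ^ (-ε) * M.prob (M.armEvent o R) := by ring
    _ = _ := by rw [hinv, one_mul]

end Model

lemma one_sub_pow_le_exp_neg {c : ℝ} (hc : 0 ≤ 1 - c) (N : ℕ) :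
    (1 - c) ^ N ≤ Real.exp (-(c * N)) := by
  calc (1 - c) ^ N ≤ Real.exp (-c) ^ N := pow_le_pow_left₀ hc (Real.one_sub_le_exp_neg c) N
    _ = _ := by rw [← Real.exp_nat_mul]; ring_nf

lemma eventually_exists_pow_two_scale {ε s : ℝ} (hε1 : ε < 1) (hs : 0 < s) :
    ∀ᶠ R : ℝ in atTop, ∃ n : ℕ, (2 : ℝ) ^ n ≤ R ^ (1 - ε) ∧ R ^ (1 - ε) < 2 ^ (n + 1) ∧
      (n + 2 : ℝ) ≤ R ^ s := by
  have hlog := (isLittleO_log_rpow_atTop hs).bound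
    (show (0 : ℝ) < 1 / (4 * (1 - ε)) by have : 0 < 1 - ε := by linarith
                                         positivity)
  filter_upwards [hlog, eventually_le_rpow 4 hs, eventually_ge_atTop 1] with R h1 h2 hR
  have hR0 : 0 < R := by linarith
  have hX : 0 < R ^ s := Real.rpow_pos_of_pos hR0 s
  have hε0 : 0 < 1 - ε := by linarith
  obtain ⟨n, hn1, hn2⟩ := exists_nat_pow_near (Real.one_le_rpow hR hε0.le) one_lt_two
  refine ⟨n, hn1, hn2, ?_⟩
  rw [Real.norm_eq_abs, Real.norm_eq_abs, abs_of_nonneg (Real.log_nonneg hR), abs_of_pos hX] at h1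
  have h3 := Real.log_le_log (by positivity) hn1
  rw [Real.log_pow, Real.log_rpow hR0] at h3
  have h4 : (1 / 2 : ℝ) ≤ Real.log 2 := by linarith [Real.log_two_gt_d9]
  have h5 : (n : ℝ) * (1 / 2) ≤ n * Real.log 2 := by gcongr
  have h6 : (1 - ε) * Real.log R ≤ R ^ s / 4 := by
    calc (1 - ε) * Real.log R ≤ (1 - ε) * (1 / (4 * (1 - ε)) * R ^ s) := by gcongr
      _ = R ^ s / 4 := by field_simp
  linarith

namespace Model

variable {M : Model} {K : ℝ}

lemma eventually_prob_armEvent_le (hK : M.toWGraph.Bd K) (hν : 1 ≤ M.ν) (hνα : M.ν ≤ M.α / 2)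
    (o : M.V) {ε : ℝ} (hε : 0 < ε) (hε1 : ε < 1 / 2) :
    ∀ᶠ R : ℝ in atTop, M.prob (M.armEvent o R) ≤ R ^ (-(M.ν / 2) + 2 * (M.ν * ε)) := by
  obtain ⟨κ, hκ0, hκ1, Λ, hΛ, H⟩ := prob_armEvent_upper hK hν hνα o
  have hK1 := hK.one_le
  obtain ⟨s, rfl⟩ : ∃ s, ε = 6 * s := ⟨ε / 6, by ring⟩
  have hs : 0 < s := by linarith
  have hνs : 0 < M.ν * (6 * s) := by positivity
  have hC1 : 0 < K ^ 2 * 2 ^ M.α * ((K + 2) * (1 + 1 / κ)) := by positivity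
  filter_upwards [eventually_exists_pow_two_scale (ε := 6 * s) (by linarith) hs,
    eventually_ge_atTop K, eventually_le_rpow (2 * Λ / κ) hs,
    eventually_le_rpow (4 * 2 ^ M.ν / κ) hs, eventually_le_rpow (8 * K) hνs,
    eventually_le_rpow (4 * (K ^ 2 * 2 ^ M.α * (2 * K))) (show 0 < M.ν / 2 by linarith),
    eventually_rpow_mul_exp_neg_rpow_le (2 * M.α + M.ν + 2 * s + M.ν / 2) hs
      (show 0 < 1 / (4 * (K ^ 2 * 2 ^ M.α * ((K + 2) * (1 + 1 / κ)))) by positivity)]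
    with R ⟨n, hn1, hn2, hn⟩ hRK hX1 hX2 hX3 hX4 hexp
  have hR1 : 1 ≤ R := by linarith
  have hR0 : 0 < R := by linarith
  set X := R ^ s with hX
  have hXone : 1 ≤ X := Real.one_le_rpow hR1 hs.le
  have hX0 : 0 < X := by linarith
  have hXp : ∀ k : ℕ, X ^ k = R ^ (s * k) := fun k => (Real.rpow_mul_natCast hR0.le s k).symm
  set t := R ^ (-(M.ν / 2)) with ht
  have ht0 : 0 < t := Real.rpow_pos_of_pos hR0 _
  set Y := R ^ (M.ν * (6 * s)) with hY
  have hY0 : 0 < Y := Real.rpow_pos_of_pos hR0 _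
  have hYone : 1 ≤ Y := Real.one_le_rpow hR1 hνs.le
  have hYX : X ^ 6 ≤ Y := by
    rw [hXp]
    refine Real.rpow_le_rpow_of_exponent_le hR1 ?_
    push_cast
    nlinarith
  set a := t * Y with ha
  have ha1 : a ≤ 1 := by
    rw [ha, ht, hY, ← Real.rpow_add hR0]
    refine Real.rpow_le_one_of_one_le_of_nonpos hR1 ?_
    nlinarith
  set δ := R ^ (-(M.α + M.ν)) with hδ
  have hδ0 : 0 < δ := Real.rpow_pos_of_pos hR0 _
  set N := ⌊R / (Λ * 2 ^ n)⌋₊ with hN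
  have hΛn : 0 < Λ * 2 ^ n := by positivity
  have hNle : (N : ℝ) * (Λ * 2 ^ n) ≤ R :=
    (le_div_iff₀ hΛn).1 (Nat.floor_le (by positivity))
  have hHR := H R a δ n N hR0.le (by positivity) ha1 hδ0 hNle
  have hn0 : (0 : ℝ) < n + 2 := by positivity
  have hNge : X ^ 6 / Λ - 1 ≤ N := by
    have h1 : X ^ 6 / Λ ≤ R / (Λ * 2 ^ n) := by
      rw [div_le_div_iff₀ (by linarith) hΛn]
      have h2 : X ^ 6 * R ^ (1 - 6 * s) = R := by
        rw [hXp, ← Real.rpow_add hR0]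
        convert Real.rpow_one R using 2
        push_cast; ring
      calc X ^ 6 * (Λ * 2 ^ n) ≤ X ^ 6 * (Λ * R ^ (1 - 6 * s)) := by gcongr
        _ = X ^ 6 * R ^ (1 - 6 * s) * Λ := by ring
        _ = R * Λ := by rw [h2]
    linarith [Nat.lt_floor_add_one (R / (Λ * 2 ^ n))]
  have hcN : X ≤ κ / (n + 2) ^ 2 * N := by
    have h1 : κ / X ^ 2 ≤ κ / (n + 2) ^ 2 := by gcongr
    have h2 : X ^ 3 ≤ κ * N := by
      have h3 : 2 * X ^ 5 ≤ κ * (X ^ 6 / Λ) := by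
        rw [div_le_iff₀ hκ0] at hX1
        rw [mul_div_assoc', le_div_iff₀ (by linarith)]
        calc 2 * X ^ 5 * Λ = X ^ 5 * (2 * Λ) := by ring
          _ ≤ X ^ 5 * (X * κ) := by gcongr
          _ = κ * X ^ 6 := by ring
      have h4 : X ^ 3 ≤ X ^ 5 := pow_le_pow_right₀ hXone (by norm_num)
      have h5 : 1 ≤ X ^ 5 := one_le_pow₀ hXone
      have h6 := mul_le_mul_of_nonneg_left hNge hκ0.le
      linarith
    calc X = X ^ 3 / X ^ 2 := by field_simp
      _ ≤ κ * N / X ^ 2 := by gcongr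
      _ = κ / X ^ 2 * N := by ring
      _ ≤ _ := by gcongr
  have hn2' : (1 : ℝ) ≤ (n + 2) ^ 2 := one_le_pow₀ (by linarith [Nat.cast_nonneg (α := ℝ) n])
  have hc1 : 0 ≤ 1 - κ / ((n : ℝ) + 2) ^ 2 := by
    rw [sub_nonneg, div_le_one (by linarith)]
    linarith
  have hpow : (1 - κ / ((n : ℝ) + 2) ^ 2) ^ N ≤ Real.exp (-X) :=
    (one_sub_pow_le_exp_neg hc1 N).trans (Real.exp_le_exp.2 (by linarith))
  have hexpo : X ≤ a ^ 2 * (κ / (n + 2) ^ 4 * ((2 : ℝ) ^ n) ^ M.ν) / 4 := by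
    have h1 : κ / X ^ 4 ≤ κ / (n + 2) ^ 4 := by gcongr
    have h2 : (R ^ (1 - 6 * s) / 2) ^ M.ν ≤ ((2 : ℝ) ^ n) ^ M.ν := by
      refine Real.rpow_le_rpow (by positivity) ?_ (by linarith)
      rw [pow_succ] at hn2
      linarith
    have h3 : t ^ 2 * Y * (R ^ (1 - 6 * s)) ^ M.ν = 1 := by
      rw [ht, hY, ← Real.rpow_mul_natCast hR0.le, ← Real.rpow_mul hR0.le, ← Real.rpow_add hR0,
        ← Real.rpow_add hR0]
      convert Real.rpow_zero R using 2
      push_cast; ring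
    rw [div_le_iff₀ hκ0] at hX2
    have h2ν : (0 : ℝ) < 2 ^ M.ν := by positivity
    calc X ≤ X * (X * κ / (4 * 2 ^ M.ν)) := by
          refine le_mul_of_one_le_right hX0.le ?_
          rwa [one_le_div (by positivity)]
      _ = X ^ 6 * (κ / X ^ 4) / 2 ^ M.ν / 4 := by field_simp
      _ ≤ Y * (κ / X ^ 4) / 2 ^ M.ν / 4 := by gcongr
      _ = (t ^ 2 * Y * (R ^ (1 - 6 * s)) ^ M.ν) * (Y * (κ / X ^ 4) / 2 ^ M.ν / 4) := by
          rw [h3, one_mul]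
      _ = a ^ 2 * (κ / X ^ 4 * (R ^ (1 - 6 * s) / 2) ^ M.ν) / 4 := by
          rw [Real.div_rpow (by positivity) (by norm_num), ha]; ring
      _ ≤ _ := by gcongr
  have hexp2 : Real.exp (-(a ^ 2 * (κ / (n + 2) ^ 4 * ((2 : ℝ) ^ n) ^ M.ν) / 4)) ≤
      Real.exp (-X) := Real.exp_le_exp.2 (by linarith)
  have hvol : (R + K) ^ M.α ≤ 2 ^ M.α * R ^ M.α := by
    rw [← Real.mul_rpow (by norm_num) hR0.le]
    exact Real.rpow_le_rpow (by linarith) (by linarith) (by linarith)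
  have hsum : (1 - κ / ((n : ℝ) + 2) ^ 2) ^ N +
      Real.exp (-(a ^ 2 * (κ / (n + 2) ^ 4 * ((2 : ℝ) ^ n) ^ M.ν) / 4)) * ((n + 2) ^ 2 / κ) ≤
      (1 + 1 / κ) * (X ^ 2 * Real.exp (-X)) := by
    have h1 : Real.exp (-(a ^ 2 * (κ / (n + 2) ^ 4 * ((2 : ℝ) ^ n) ^ M.ν) / 4)) *
        ((n + 2) ^ 2 / κ) ≤ Real.exp (-X) * (X ^ 2 / κ) := by gcongr
    have h2 : Real.exp (-X) ≤ X ^ 2 * Real.exp (-X) :=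
      le_mul_of_one_le_left (Real.exp_pos _).le (one_le_pow₀ hXone)
    calc _ ≤ X ^ 2 * Real.exp (-X) + Real.exp (-X) * (X ^ 2 / κ) :=
          add_le_add (hpow.trans h2) h1
      _ = _ := by ring
  have hmain : K ^ 2 * (R + K) ^ M.α *
        ((K + 2) * ((1 - κ / (n + 2) ^ 2) ^ N +
          Real.exp (-(a ^ 2 * (κ / (n + 2) ^ 4 * ((2 : ℝ) ^ n) ^ M.ν) / 4)) * ((n + 2) ^ 2 / κ)) /
            δ + 2 * K * δ) ≤ t / 4 + t / 4 := by
    have e1 : K ^ 2 * (2 ^ M.α * R ^ M.α) * ((K + 2) * ((1 + 1 / κ) * (X ^ 2 * Real.exp (-X))) / δ)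
        ≤ t / 4 := by
      have h1 : R ^ M.α * X ^ 2 / δ = t * R ^ (2 * M.α + M.ν + 2 * s + M.ν / 2) := by
        rw [hXp, hδ, ht, ← Real.rpow_add hR0, ← Real.rpow_sub hR0, ← Real.rpow_add hR0]
        congr 1
        push_cast; ring
      rw [le_div_iff₀ (by positivity)] at hexp
      calc _ = K ^ 2 * 2 ^ M.α * ((K + 2) * (1 + 1 / κ)) * Real.exp (-X) *
            (R ^ M.α * X ^ 2 / δ) := by ring
        _ = t * (R ^ (2 * M.α + M.ν + 2 * s + M.ν / 2) * Real.exp (-X) *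
              (4 * (K ^ 2 * 2 ^ M.α * ((K + 2) * (1 + 1 / κ))))) / 4 := by rw [h1]; ring
        _ ≤ t * 1 / 4 := by gcongr
        _ = _ := by ring
    have e2 : K ^ 2 * (2 ^ M.α * R ^ M.α) * (2 * K * δ) ≤ t / 4 := by
      have h1 : R ^ M.α * δ = t * t := by
        rw [hδ, ht, ← Real.rpow_add hR0, ← Real.rpow_add hR0]
        congr 1; ring
      have h2 : R ^ (M.ν / 2) * t = 1 := by
        rw [ht, ← Real.rpow_add hR0, add_neg_cancel, Real.rpow_zero]
      calc _ = (4 * (K ^ 2 * 2 ^ M.α * (2 * K))) * (R ^ M.α * δ) / 4 := by ring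
        _ ≤ R ^ (M.ν / 2) * (R ^ M.α * δ) / 4 := by gcongr
        _ = (R ^ (M.ν / 2) * t) * t / 4 := by rw [h1]; ring
        _ = _ := by rw [h2, one_mul]
    calc _ ≤ K ^ 2 * (2 ^ M.α * R ^ M.α) *
          ((K + 2) * ((1 + 1 / κ) * (X ^ 2 * Real.exp (-X))) / δ + 2 * K * δ) := by gcongr
      _ = K ^ 2 * (2 ^ M.α * R ^ M.α) * ((K + 2) * ((1 + 1 / κ) * (X ^ 2 * Real.exp (-X))) / δ) +
          K ^ 2 * (2 ^ M.α * R ^ M.α) * (2 * K * δ) := by ring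
      _ ≤ _ := add_le_add e1 e2
  have hT : R ^ (-(M.ν / 2) + 2 * (M.ν * (6 * s))) = t * Y * Y := by
    rw [ht, hY, ← Real.rpow_add hR0, ← Real.rpow_add hR0]
    congr 1; ring
  rw [hT]
  have h1 : 2 * K * a ≤ t * Y * Y / 4 := by
    have := mul_le_mul_of_nonneg_left hX3 (mul_pos ht0 hY0).le
    rw [ha]; linarith
  have h2 : t ≤ t * Y * Y := by
    rw [mul_assoc]
    exact le_mul_of_one_le_right ht0.le (one_le_mul_of_one_le_of_one_le hYone hYone)
  linarith

end Model

/-- **Theorem 1.1 (critical one-arm exponent).** For every `x ∈ G`,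
`-lim_{R→∞} log ℙ(x ↔ B(x,R)^c) / log R` exists and equals `ν/2`. -/
theorem one_arm_critical_exponent (M : Model)
    (hS : M.toWGraph.Standing) (hν1 : 1 ≤ M.ν) (hνα : M.ν ≤ M.α / 2) (x : M.V) :
    Filter.Tendsto (fun R : ℝ => Real.log (M.prob (M.armEvent x R)) / Real.log R)
      Filter.atTop (nhds (-(M.ν / 2))) := by
  have hν0 : 0 < M.ν := by linarith
  obtain ⟨K, hK⟩ := hS.exists_bd hν0
  have hlow : ∀ ε : ℝ, 0 < ε → ∀ᶠ R : ℝ in atTop,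
      0 < M.prob (M.armEvent x R) ∧
        (-(M.ν / 2) - 2 * ε) * Real.log R ≤ Real.log (M.prob (M.armEvent x R)) := by
    intro ε hε
    filter_upwards [Model.eventually_le_prob_armEvent hK hν0 x hε, eventually_gt_atTop 0]
      with R h hR
    have h0 := Real.rpow_pos_of_pos hR (-(M.ν / 2) - 2 * ε)
    refine ⟨h0.trans_le h, ?_⟩
    rw [← Real.log_rpow hR]
    exact Real.log_le_log h0 h
  refine tendsto_order.2 ⟨fun b hb => ?_, fun b hb => ?_⟩
  · filter_upwards [hlow ((-(M.ν / 2) - b) / 4) (by linarith), eventually_gt_atTop 1]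
      with R h hR
    rw [lt_div_iff₀ (Real.log_pos hR)]
    refine lt_of_lt_of_le (mul_lt_mul_of_pos_right ?_ (Real.log_pos hR)) h.2
    linarith
  · set ε := min (1 / 4) ((b + M.ν / 2) / (4 * M.ν)) with hε
    have hε0 : 0 < ε := lt_min (by norm_num) (div_pos (by linarith) (by linarith))
    have hε1 : ε < 1 / 2 := (min_le_left _ _).trans_lt (by norm_num)
    have hε2 : M.ν * ε ≤ (b + M.ν / 2) / 4 := by
      have := mul_le_mul_of_nonneg_left (min_le_right (1 / 4) ((b + M.ν / 2) / (4 * M.ν))) hν0.le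
      refine this.trans (le_of_eq ?_)
      field_simp
    filter_upwards [hlow 1 one_pos, Model.eventually_prob_armEvent_le hK hν1 hνα x hε0 hε1,
      eventually_gt_atTop 1] with R h h2 hR
    have h3 := Real.log_le_log h.1 h2
    rw [Real.log_rpow (by linarith)] at h3
    rw [div_lt_iff₀ (Real.log_pos hR)]
    refine h3.trans_lt (mul_lt_mul_of_pos_right ?_ (Real.log_pos hR))
    linarith
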